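/- In the one-boundary setting (ξ₂(t) ≡ X constant and u(X,t) ≠ 0 for all t ∈ [0,T]): let s ∈ (0,T) be an NZ*-moment of w₁(t) := u(ξ₁(t),t), i.e. w₁(s) = 0 and w₁(t) ≠ 0 for all t in some left neighborhood (s−ε, s), and assume (H2) holds at s (with i = 1) and (H1) holds. Then Z(s) ≤ Z(t) < ∞ for all t < s sufficiently close to s. -/

import Mathlib

open Set

/-- spatial partial derivative `u_x` -/
noncomputable def pdx (u : ℝ → ℝ → ℝ) (x t : ℝ) : ℝ := deriv (fun y => u y t) x

/-- second spatial partial derivative `u_xx` -/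
noncomputable def pdxx (u : ℝ → ℝ → ℝ) (x t : ℝ) : ℝ := deriv (fun y => pdx u y t) x

/-- time partial derivative `u_t` -/
noncomputable def pdt (u : ℝ → ℝ → ℝ) (x t : ℝ) : ℝ := deriv (fun s => u x s) t

/-- the closure of the space-time domain `Ω` -/
def domCl (xi1 xi2 : ℝ → ℝ) (T : ℝ) : Set (ℝ × ℝ) :=
  {p : ℝ × ℝ | p.2 ∈ Icc (0:ℝ) T ∧ p.1 ∈ Icc (xi1 p.2) (xi2 p.2)}

/-- the domain together with its lateral boundaries -/
def domLat (xi1 xi2 : ℝ → ℝ) (T : ℝ) : Set (ℝ × ℝ) :=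
  {p : ℝ × ℝ | p.2 ∈ Ioc (0:ℝ) T ∧ p.1 ∈ Icc (xi1 p.2) (xi2 p.2)}

/-- `u` is a classical solution of `u_t = a u_xx + b u_x + c u` on
`Ω = {(x,t) : ξ₁(t) < x < ξ₂(t), 0 < t ≤ T}`: it is continuous on the closure, its
partial derivatives `u_t, u_x, u_xx` exist and are continuous up to the lateral
boundaries, and the equation holds. -/
structure IsClassicalSolution (a b c : ℝ → ℝ → ℝ) (xi1 xi2 : ℝ → ℝ) (T : ℝ)
    (u : ℝ → ℝ → ℝ) : Prop where
  cont : ContinuousOn (fun p : ℝ × ℝ => u p.1 p.2) (domCl xi1 xi2 T)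
  diff_x : ∀ p ∈ domLat xi1 xi2 T, DifferentiableAt ℝ (fun y => u y p.2) p.1
  diff_xx : ∀ p ∈ domLat xi1 xi2 T, DifferentiableAt ℝ (fun y => pdx u y p.2) p.1
  diff_t : ∀ p ∈ domLat xi1 xi2 T, DifferentiableAt ℝ (fun s => u p.1 s) p.2
  cont_x : ContinuousOn (fun p : ℝ × ℝ => pdx u p.1 p.2) (domLat xi1 xi2 T)
  cont_xx : ContinuousOn (fun p : ℝ × ℝ => pdxx u p.1 p.2) (domLat xi1 xi2 T)
  cont_t : ContinuousOn (fun p : ℝ × ℝ => pdt u p.1 p.2) (domLat xi1 xi2 T)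
  eqn : ∀ p ∈ domLat xi1 xi2 T,
    pdt u p.1 p.2 =
      a p.1 p.2 * pdxx u p.1 p.2 + b p.1 p.2 * pdx u p.1 p.2 + c p.1 p.2 * u p.1 p.2

/-- the regularity assumption (1.2): `a, a⁻¹, a_t, a_x, a_xx, b, b_t, b_x, c ∈ L^∞`,
with `a > 0` -/
def Reg12 (a b c : ℝ → ℝ → ℝ) (xi1 xi2 : ℝ → ℝ) (T : ℝ) : Prop :=
  ∃ M : ℝ, ∀ p ∈ domLat xi1 xi2 T,
    0 < a p.1 p.2 ∧
    DifferentiableAt ℝ (fun y => a y p.2) p.1 ∧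
    DifferentiableAt ℝ (fun y => pdx a y p.2) p.1 ∧
    DifferentiableAt ℝ (fun s => a p.1 s) p.2 ∧
    DifferentiableAt ℝ (fun y => b y p.2) p.1 ∧
    DifferentiableAt ℝ (fun s => b p.1 s) p.2 ∧
    |a p.1 p.2| ≤ M ∧ |(a p.1 p.2)⁻¹| ≤ M ∧ |pdt a p.1 p.2| ≤ M ∧ |pdx a p.1 p.2| ≤ M ∧
    |pdxx a p.1 p.2| ≤ M ∧ |b p.1 p.2| ≤ M ∧ |pdt b p.1 p.2| ≤ M ∧ |pdx b p.1 p.2| ≤ M ∧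
    |c p.1 p.2| ≤ M

/-- the set of zeroes of `u(·,t)` in `I(t) = [ξ₁(t), ξ₂(t)]` -/
def zeroSet (u : ℝ → ℝ → ℝ) (xi1 xi2 : ℝ → ℝ) (t : ℝ) : Set ℝ :=
  {x ∈ Icc (xi1 t) (xi2 t) | u x t = 0}

/-- `Z(t)`: the (extended-natural) number of zeroes of `u(·,t)` in `I(t)` -/
noncomputable def Znum (u : ℝ → ℝ → ℝ) (xi1 xi2 : ℝ → ℝ) (t : ℝ) : ℕ∞ :=
  (zeroSet u xi1 xi2 t).encard

/-- `u(·,s)` has a multiple (degenerate) zero in `I(s)` -/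
def HasMultipleZero (u : ℝ → ℝ → ℝ) (xi1 xi2 : ℝ → ℝ) (s : ℝ) : Prop :=
  ∃ x₀ ∈ Icc (xi1 s) (xi2 s), u x₀ s = 0 ∧ pdx u x₀ s = 0

/-- the boundary trace `wᵢ(t) := u(ξᵢ(t), t)` -/
def bdryTrace (u : ℝ → ℝ → ℝ) (xi : ℝ → ℝ) : ℝ → ℝ := fun t => u (xi t) t

/-- some left neighborhood of `s` consists entirely of N-moments -/
def leftN (w : ℝ → ℝ) (s : ℝ) : Prop := ∃ ε > 0, ∀ t ∈ Ioo (s - ε) s, w t ≠ 0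

/-- some left neighborhood of `s` consists entirely of Z-moments -/
def leftZ (w : ℝ → ℝ) (s : ℝ) : Prop := ∃ ε > 0, ∀ t ∈ Ioo (s - ε) s, w t = 0

/-- some right neighborhood of `s` consists entirely of N-moments -/
def rightN (w : ℝ → ℝ) (s : ℝ) : Prop := ∃ ε > 0, ∀ t ∈ Ioo s (s + ε), w t ≠ 0

/-- some right neighborhood of `s` consists entirely of Z-moments -/
def rightZ (w : ℝ → ℝ) (s : ℝ) : Prop := ∃ ε > 0, ∀ t ∈ Ioo s (s + ε), w t = 0

/-- `s` is an NZN-moment of `w` -/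
def IsNZN (w : ℝ → ℝ) (s : ℝ) : Prop := w s = 0 ∧ leftN w s ∧ rightN w s

/-- `s` is a ZZZ-moment of `w` -/
def IsZZZ (w : ℝ → ℝ) (s : ℝ) : Prop := w s = 0 ∧ leftZ w s ∧ rightZ w s

/-- `s` is an NZZ-moment of `w` -/
def IsNZZ (w : ℝ → ℝ) (s : ℝ) : Prop := w s = 0 ∧ leftN w s ∧ rightZ w s

/-- `s` is a ZZN-moment of `w` -/
def IsZZN (w : ℝ → ℝ) (s : ℝ) : Prop := w s = 0 ∧ leftZ w s ∧ rightN w s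

/-- `s` is an NZ*-moment of `w` -/
def IsNZstar (w : ℝ → ℝ) (s : ℝ) : Prop := w s = 0 ∧ leftN w s

/-- (H1): on every nondegenerate closed interval of Z-moments of the boundary trace `w`,
the boundary curve `ξ` is `C¹` -/
def H1cond (w xi : ℝ → ℝ) (T : ℝ) : Prop :=
  ∀ p q : ℝ, 0 ≤ p → p < q → q ≤ T → (∀ t ∈ Icc p q, w t = 0) → ContDiffOn ℝ 1 xi (Icc p q)

/-- (H2) at an NZ*-moment `s` of `u(ξ(·),·)`, with sign `σ = (-1)^i`:
`ξ'(s-0)` exists, and `σ · u_x(ξ(s),s) ≥ 0` (resp. `≤ 0`) if `u(ξ(t),t) > 0`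
(resp. `< 0`) shortly before `s`. -/
def H2at (u : ℝ → ℝ → ℝ) (xi : ℝ → ℝ) (σ s : ℝ) : Prop :=
  (∃ L : ℝ, HasDerivWithinAt xi L (Iio s) s) ∧
  ((∃ ε > 0, ∀ t ∈ Ioo (s - ε) s, 0 < u (xi t) t) → 0 ≤ σ * pdx u (xi s) s) ∧
  ((∃ ε > 0, ∀ t ∈ Ioo (s - ε) s, u (xi t) t < 0) → σ * pdx u (xi s) s ≤ 0)

/-- (H3) at a Z-moment `s` of `u(ξ(·),·)`, with sign `σ = (-1)^i`:
`σ · u(ξ(t),t) · u(x,s) ≤ 0` for `t` slightly after `s` and `x ∈ I(s)` near (but not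
equal to) `ξ(s)`. -/
def H3at (u : ℝ → ℝ → ℝ) (xi1 xi2 xi : ℝ → ℝ) (σ s : ℝ) : Prop :=
  ∃ ε > 0, ∃ δ > 0, ∀ t ∈ Ioo s (s + ε), ∀ x ∈ Icc (xi1 s) (xi2 s),
    x ≠ xi s → |x - xi s| < δ → σ * (u (xi t) t * u x s) ≤ 0

/-- (H3) at a Z-moment `s` for the left boundary (`i = 1`, one-boundary setting):
`-u(ξ₁(t),t) · u(x,s) ≤ 0` for `t` slightly after `s` and `x` slightly to the right
of `ξ₁(s)`. -/
def H3one (u : ℝ → ℝ → ℝ) (xi : ℝ → ℝ) (s : ℝ) : Prop :=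
  ∃ ε > 0, ∃ δ > 0, ∀ t ∈ Ioo s (s + ε), ∀ x : ℝ,
    xi s < x → x - xi s < δ → -(u (xi t) t) * u x s ≤ 0

open Set MeasureTheory ProbabilityTheory Filter Topology

noncomputable abbrev gam : Measure ℝ := gaussianReal 0 1

lemma gam_pdf (x : ℝ) : gaussianPDFReal 0 1 x = (Real.sqrt (2 * Real.pi))⁻¹ * Real.exp (-x^2/2) := by
  simp [gaussianPDFReal]

lemma gam_integral (f : ℝ → ℝ) :
    ∫ x, f x ∂gam = ∫ x, gaussianPDFReal 0 1 x * f x := by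
  simpa using integral_gaussianReal_eq_integral_smul (μ := 0) (v := 1) (f := f) (by norm_num)

lemma gam_integrable {f : ℝ → ℝ} (hf : Integrable f gam) :
    Integrable (fun x => gaussianPDFReal 0 1 x * f x) := by
  rw [gam, gaussianReal_of_var_ne_zero _ (by norm_num)] at hf
  rw [integrable_withDensity_iff_integrable_smul₀' (by fun_prop) (by simp [gaussianPDF])] at hf
  refine hf.congr (ae_of_all _ fun x => ?_)
  simp [gaussianPDF, ENNReal.toReal_ofReal (gaussianPDFReal_nonneg 0 1 x)]

lemma gam_hasDerivAt (x : ℝ) :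
    HasDerivAt (gaussianPDFReal 0 1) (-x * gaussianPDFReal 0 1 x) x := by
  have : gaussianPDFReal 0 1 = fun x => (Real.sqrt (2 * Real.pi))⁻¹ * Real.exp (-x^2/2) := by
    ext y; exact gam_pdf y
  rw [this]
  have h1 : HasDerivAt (fun x : ℝ => -x^2/2) (-x) x := by
    have := ((hasDerivAt_pow 2 x).fun_neg).div_const 2
    exact this.congr_deriv (by norm_num; ring)
  exact ((h1.exp).const_mul (Real.sqrt (2 * Real.pi))⁻¹).congr_deriv (by ring)

lemma gam_stein {φ φ' : ℝ → ℝ} (h : ∀ x, HasDerivAt φ (φ' x) x)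
    (i1 : Integrable φ gam) (i2 : Integrable φ' gam) (i3 : Integrable (fun x => x * φ x) gam) :
    ∫ x, φ' x ∂gam = ∫ x, x * φ x ∂gam := by
  have e : ∫ x, (-x * gaussianPDFReal 0 1 x * φ x + gaussianPDFReal 0 1 x * φ' x) = 0 := by
    refine integral_eq_zero_of_hasDerivAt_of_integrable
      (f := fun x => gaussianPDFReal 0 1 x * φ x) (fun x => (gam_hasDerivAt x).fun_mul (h x)) ?_
      (gam_integrable i1)
    refine ((gam_integrable i2).sub (gam_integrable i3)).congr (ae_of_all _ fun x => ?_)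
    simp; ring
  rw [gam_integral, gam_integral, ← sub_eq_zero, ← integral_sub (gam_integrable i2) (gam_integrable i3)]
  refine Eq.trans ?_ e
  congr 1; ext x; ring

/-- chain rule from a jointly continuous first partial and a plain second partial -/
lemma chain2 {f f1 : ℝ → ℝ → ℝ} {f2 p' q' r : ℝ} {p q : ℝ → ℝ}
    (h1 : ∀ᶠ z : ℝ × ℝ in 𝓝 (p r, q r), HasDerivAt (fun x => f x z.2) (f1 z.1 z.2) z.1)
    (hc : ContinuousAt (fun z : ℝ × ℝ => f1 z.1 z.2) (p r, q r))
    (h2 : HasDerivAt (fun t => f (p r) t) f2 (q r))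
    (hp : HasDerivAt p p' r) (hq : HasDerivAt q q' r) :
    HasDerivAt (fun s => f (p s) (q s)) (f1 (p r) (q r) * p' + f2 * q') r := by
  have A : HasDerivAt (fun s => f (p r) (q s)) (f2 * q') r := h2.comp r hq
  have B : HasDerivAt (fun s => f (p s) (q s) - f (p r) (q s)) (f1 (p r) (q r) * p') r := by
    have key : (fun s => f (p s) (q s) - f (p r) (q s) - f1 (p r) (q r) * (p s - p r)) =o[𝓝 r]
        fun s => p s - p r := by
      rw [Asymptotics.isLittleO_iff]
      intro ε hε
      have hc' := Metric.continuousAt_iff'.1 hc ε hε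
      obtain ⟨δ, hδ, hb⟩ := Metric.eventually_nhds_iff.1 (h1.and hc')
      have e1 := Metric.continuousAt_iff'.1 hp.continuousAt δ hδ
      have e2 := Metric.continuousAt_iff'.1 hq.continuousAt δ hδ
      filter_upwards [e1, e2] with s s1 s2
      have := Convex.norm_image_sub_le_of_norm_hasDerivWithin_le
        (f := fun x => f x (q s) - f1 (p r) (q r) * x) (f' := fun x => f1 x (q s) - f1 (p r) (q r))
        (s := Metric.ball (p r) δ) (C := ε) (x := p r) (y := p s) ?_ ?_ (convex_ball _ _) (Metric.mem_ball_self hδ) s1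
      · calc _ = ‖(f (p s) (q s) - f1 (p r) (q r) * p s) - (f (p r) (q s) - f1 (p r) (q r) * p r)‖ := by
              congr 1; ring
          _ ≤ _ := this
      · intro x hx
        have := (@hb (x, q s) (by rw [Prod.dist_eq]; exact max_lt hx s2)).1
        exact (by simpa using this.fun_sub ((hasDerivAt_id x).const_mul (f1 (p r) (q r))) : HasDerivAt _ _ _).hasDerivWithinAt
      · intro x hx
        have := (@hb (x, q s) (by rw [Prod.dist_eq]; exact max_lt hx s2)).2
        exact this.le
    rw [hasDerivAt_iff_isLittleO]
    have k2 := key.trans_isBigO hp.isBigO_sub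
    have k3 := (hasDerivAt_iff_isLittleO.1 hp).const_mul_left (f1 (p r) (q r))
    refine (k2.add k3).congr_left fun s => ?_
    simp; ring
  have := B.add A
  refine this.congr_of_eventuallyEq (Eventually.of_forall fun s => ?_)
  simp

lemma gam_int_bdd {f : ℝ → ℝ} (hf : Continuous f) {C : ℝ} (h : ∀ x, |f x| ≤ C) : Integrable f gam :=
  Integrable.of_bound hf.aestronglyMeasurable C (ae_of_all _ h)

lemma gam_int_cs {f : ℝ → ℝ} (hf : Continuous f) {C : ℝ} (h : ∀ x, C ≤ |x| → f x = 0) : Integrable f gam := by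
  obtain ⟨B, hB⟩ := (isCompact_Icc (a := -C) (b := C)).exists_bound_of_continuousOn hf.continuousOn
  refine gam_int_bdd hf (C := max B 0) fun x => ?_
  by_cases hx : C ≤ |x|
  · rw [h x hx]; simp
  · push Not at hx
    exact (hB x (abs_le.1 hx.le)).trans (le_max_left _ _)

lemma gam_int_pow_exp (n : ℕ) (η : ℝ) : Integrable (fun x => |x| ^ n * Real.exp (η * x)) gam := by
  have := integrable_pow_abs_mul_exp_of_mem_interior_integrableExpSet (X := id) (μ := gam) (v := η)
    (by simp) n
  simpa using this

lemma gam_int_poly_exp (p : Polynomial ℝ) (η : ℝ) :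
    Integrable (fun x => p.eval x * Real.exp (η * x)) gam := by
  have h : ∀ x, p.eval x * Real.exp (η * x) =
      ∑ i ∈ Finset.range (p.natDegree + 1), p.coeff i * (x ^ i * Real.exp (η * x)) := by
    intro x
    rw [Polynomial.eval_eq_sum_range, Finset.sum_mul]
    exact Finset.sum_congr rfl fun i _ => by ring
  simp_rw [h]
  refine integrable_finsetSum _ fun i _ => Integrable.const_mul ?_ _
  refine (gam_int_pow_exp i η).mono' (by fun_prop) (ae_of_all _ fun x => ?_)
  simp

lemma gam_int_poly (p : Polynomial ℝ) : Integrable (fun x => p.eval x) gam := by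
  simpa using gam_int_poly_exp p 0

noncomputable def He : ℕ → Polynomial ℝ
  | 0 => 1
  | n + 1 => Polynomial.X * He n - Polynomial.derivative (He n)

lemma He_deriv (n : ℕ) : Polynomial.derivative (He (n+1)) = ((n:ℝ)+1) • He n := by
  induction n with
  | zero => simp [He]
  | succ n ih =>
    have e : He (n+1+1) = Polynomial.X * He (n+1) - Polynomial.derivative (He (n+1)) := rfl
    rw [e, Polynomial.derivative_sub, Polynomial.derivative_mul, ih]
    have e2 : He (n+1) = Polynomial.X * He n - Polynomial.derivative (He n) := rfl
    simp only [Polynomial.derivative_X, one_mul, Polynomial.derivative_smul]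
    push_cast
    rw [add_smul _ (1:ℝ) (He (n+1)), one_smul]
    rw [add_comm, ← sub_add_eq_add_sub, mul_smul_comm, ← smul_sub, ← e2]

lemma He_deriv' (n : ℕ) : Polynomial.derivative (He n) = (n:ℝ) • He (n-1) := by
  cases n with
  | zero => simp [He]
  | succ n => simpa using He_deriv n

lemma He_ode (n : ℕ) : Polynomial.derivative (Polynomial.derivative (He n)) =
    Polynomial.X * Polynomial.derivative (He n) - (n:ℝ) • He n := by
  have e : He (n+1) = Polynomial.X * He n - Polynomial.derivative (He n) := rfl
  have h := He_deriv n
  rw [e, Polynomial.derivative_sub, Polynomial.derivative_mul, add_smul, one_smul] at h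
  simp only [Polynomial.derivative_X, one_mul] at h
  linear_combination -h

lemma gam_stein_poly (p : Polynomial ℝ) :
    ∫ x, (Polynomial.derivative p).eval x ∂gam = ∫ x, x * p.eval x ∂gam :=
  gam_stein (fun x => p.hasDerivAt x) (gam_int_poly p) (gam_int_poly _)
    ((gam_int_poly (Polynomial.X * p)).congr (ae_of_all _ fun x => by simp))

lemma He_rec_int (n : ℕ) (q : Polynomial ℝ) :
    ∫ x, (He (n+1)).eval x * q.eval x ∂gam = ∫ x, (He n).eval x * (Polynomial.derivative q).eval x ∂gam := by
  have h := gam_stein_poly (He n * q)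
  have h2 : Integrable (fun x => x * (He n * q).eval x) gam := by
    exact (gam_int_poly (Polynomial.X * (He n * q))).congr (ae_of_all _ fun x => by simp)
  have e1 : ∀ x, (He (n+1)).eval x * q.eval x =
      x * (He n * q).eval x - (Polynomial.derivative (He n) * q).eval x := by
    intro x; simp [He]; ring
  have e2 : ∀ x, (He n).eval x * (Polynomial.derivative q).eval x =
      (Polynomial.derivative (He n * q)).eval x - (Polynomial.derivative (He n) * q).eval x := by
    intro x; simp [Polynomial.derivative_mul]
  simp_rw [e1, e2]
  rw [integral_sub h2 (gam_int_poly _), integral_sub (gam_int_poly _) (gam_int_poly _), h]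

lemma He_orth (n m : ℕ) : ∫ x, (He n).eval x * (He m).eval x ∂gam = if n = m then (n.factorial : ℝ) else 0 := by
  induction n generalizing m with
  | zero =>
    cases m with
    | zero => simp [He]
    | succ m =>
      have := He_rec_int m 1
      simp_rw [mul_comm ((He 0).eval _)]
      simpa [He] using this
  | succ n ih =>
    rw [He_rec_int, He_deriv']
    simp only [Polynomial.eval_smul, smul_eq_mul]
    have : ∀ x, (He n).eval x * ((m:ℝ) * (He (m-1)).eval x) = m * ((He n).eval x * (He (m-1)).eval x) :=
      fun x => by ring
    simp_rw [this]
    rw [integral_const_mul, ih]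
    cases m with
    | zero => simp
    | succ m =>
      by_cases h : n = m
      · subst h; simp [Nat.factorial_succ]
      · simp [h]

lemma He_shift (n : ℕ) (η : ℝ) : ∫ x, (He n).eval x * Real.exp (η * x) ∂gam = η ^ n * Real.exp (η^2/2) := by
  induction n with
  | zero =>
    have := mgf_id_gaussianReal (μ := 0) (v := 1)
    have := congrFun this η
    simpa [mgf, He] using this
  | succ n ih =>
    have hd : ∀ x, HasDerivAt (fun x => (He n).eval x * Real.exp (η * x))
        ((Polynomial.derivative (He n)).eval x * Real.exp (η * x) + η * ((He n).eval x * Real.exp (η * x))) x := by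
      intro x
      have h1 : HasDerivAt (fun x => Real.exp (η * x)) (Real.exp (η * x) * (η * 1)) x :=
        ((hasDerivAt_id x).const_mul η).exp
      exact (((He n).hasDerivAt x).fun_mul h1).congr_deriv (by ring)
    have i3 : Integrable (fun x => x * ((He n).eval x * Real.exp (η * x))) gam := by
      exact (gam_int_poly_exp (Polynomial.X * He n) η).congr (ae_of_all _ fun x => by simp [mul_assoc])
    have h := gam_stein hd (gam_int_poly_exp _ _) ((gam_int_poly_exp _ _).add ((gam_int_poly_exp _ _).const_mul _)) i3
    rw [integral_add (gam_int_poly_exp _ _) ((gam_int_poly_exp _ _).const_mul _), integral_const_mul, ih] at h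
    have e : ∀ x, (He (n+1)).eval x * Real.exp (η * x) = x * ((He n).eval x * Real.exp (η * x))
      - (Polynomial.derivative (He n)).eval x * Real.exp (η * x) := by intro x; simp [He]; ring
    simp_rw [e]
    rw [integral_sub i3 (gam_int_poly_exp _ _), ← h]; ring

lemma gam_memLp_poly (p : Polynomial ℝ) : MemLp (fun x => p.eval x) 2 gam := by
  refine (memLp_two_iff_integrable_sq (by fun_prop)).2 ?_
  exact (gam_int_poly (p^2)).congr (ae_of_all _ fun x => by simp)

lemma gam_memLp_exp (η : ℝ) : MemLp (fun x => Real.exp (η * |x|)) 2 gam := by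
  refine (memLp_two_iff_integrable_sq (by fun_prop)).2 ?_
  have h := (gam_int_pow_exp 0 (2*η)).add (gam_int_pow_exp 0 (-(2*η)))
  refine h.mono' (by fun_prop) (ae_of_all _ fun x => ?_)
  simp only [Pi.add_apply, pow_zero, one_mul, Real.norm_eq_abs]
  rw [abs_of_nonneg (by positivity), ← Real.exp_nat_mul]
  rcases abs_cases x with ⟨h, _⟩ | ⟨h, _⟩ <;> rw [h]
  · refine le_trans (le_of_eq ?_) (le_add_of_nonneg_right (by positivity)); congr 1; push_cast; ring
  · refine le_trans (le_of_eq ?_) (le_add_of_nonneg_left (by positivity)); congr 1; push_cast; ring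

lemma He_mul_pow {f : ℝ → ℝ} (hf : MemLp f 2 gam) (h : ∀ n, ∫ x, f x * (He n).eval x ∂gam = 0) (m : ℕ) :
    ∀ n, ∫ x, f x * (x ^ m * (He n).eval x) ∂gam = 0 := by
  induction m with
  | zero => intro n; simpa using h n
  | succ m ih =>
    intro n
    have e : ∀ x, f x * (x ^ (m+1) * (He n).eval x) = f x * (x^m * (He (n+1)).eval x)
        + n * (f x * (x^m * (He (n-1)).eval x)) := by
      intro x
      have : (Polynomial.derivative (He n)).eval x = n * (He (n-1)).eval x := by rw [He_deriv']; simp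
      simp only [He, Polynomial.eval_sub, Polynomial.eval_mul, Polynomial.eval_X, this]; ring
    have hi : ∀ k, Integrable (fun x => f x * (x^m * (He k).eval x)) gam := fun k => by
      exact (hf.integrable_mul (gam_memLp_poly (Polynomial.X^m * He k))).congr (ae_of_all _ fun x => by simp)
    simp_rw [e]
    rw [integral_add (hi _) ((hi _).const_mul _), integral_const_mul, ih, ih]; simp

lemma He_complete_char {f : ℝ → ℝ} (hf : MemLp f 2 gam) (h : ∀ n, ∫ x, f x * (He n).eval x ∂gam = 0) (t : ℝ) :
    ∫ x, Complex.exp (t * x * Complex.I) * (f x : ℂ) ∂gam = 0 := by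
  have h0 : ∀ m : ℕ, ∫ x, f x * x ^ m ∂gam = 0 := fun m => by
    simpa [He] using He_mul_pow hf h m 0
  have S := hasSum_integral_of_dominated_convergence (μ := gam) (ι := ℕ)
    (F := fun n x => ((t * x * Complex.I) ^ n / (n.factorial : ℂ)) * (f x : ℂ))
    (f := fun x => Complex.exp (t * x * Complex.I) * (f x : ℂ))
    (fun n x => (|t| * |x|)^n / (n.factorial : ℝ) * |f x|) ?_ ?_ ?_ ?_ ?_
  · refine S.unique ?_
    convert hasSum_zero with n
    have : ∀ x : ℝ, ((t * x * Complex.I) ^ n / (n.factorial : ℂ)) * (f x : ℂ)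
        = ((t * Complex.I)^n / (n.factorial : ℂ)) * ((f x * x ^ n : ℝ) : ℂ) := by
      intro x; push_cast; ring
    simp_rw [this]
    rw [integral_const_mul, integral_complex_ofReal, h0]; simp
  · intro n
    refine AEStronglyMeasurable.mul (by fun_prop) ?_
    exact Complex.continuous_ofReal.comp_aestronglyMeasurable hf.1
  · intro n
    refine ae_of_all _ fun x => ?_
    simp [mul_pow]
  · refine ae_of_all _ fun x => ?_
    exact (Real.summable_pow_div_factorial _).mul_right _
  · have : ∀ x, ∑' n : ℕ, (|t| * |x|)^n / (n.factorial : ℝ) * |f x| = Real.exp (|t| * |x|) * |f x| := by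
      intro x
      rw [tsum_mul_right, Real.exp_eq_exp_ℝ, NormedSpace.exp_eq_tsum_div]
    simp_rw [this]
    exact (gam_memLp_exp |t|).integrable_mul hf.abs
  · refine ae_of_all _ fun x => ?_
    refine HasSum.mul_right _ ?_
    rw [Complex.exp_eq_exp_ℂ]
    exact NormedSpace.expSeries_div_hasSum_exp _

lemma He_complete {f : ℝ → ℝ} (hf : MemLp f 2 gam) (h : ∀ n, ∫ x, f x * (He n).eval x ∂gam = 0) :
    f =ᵐ[gam] 0 := by
  have hi : Integrable f gam := hf.integrable (by norm_num)
  have key : gam.withDensity (fun x => ENNReal.ofReal (f x)) = gam.withDensity (fun x => ENNReal.ofReal (- f x)) := by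
    have : IsFiniteMeasure (gam.withDensity (fun x => ENNReal.ofReal (f x))) :=
      isFiniteMeasure_withDensity_ofReal hi.2
    have : IsFiniteMeasure (gam.withDensity (fun x => ENNReal.ofReal (-f x))) :=
      isFiniteMeasure_withDensity_ofReal hi.neg.2
    apply Measure.ext_of_charFun
    ext t
    rw [charFun_apply_real, charFun_apply_real,
      integral_withDensity_eq_integral_toReal_smul₀ (by exact hi.1.aemeasurable.ennreal_ofReal) (by simp),
      integral_withDensity_eq_integral_toReal_smul₀ (by exact hi.1.aemeasurable.neg.ennreal_ofReal) (by simp)]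
    have hb : ∀ g : ℝ → ℝ, Integrable g gam →
        Integrable (fun x => (ENNReal.ofReal (g x)).toReal • Complex.exp (t * x * Complex.I)) gam := by
      intro g hg
      refine (hg.norm).mono' ?_ (ae_of_all _ fun x => ?_)
      · have m1 : AEStronglyMeasurable (fun x => (ENNReal.ofReal (g x)).toReal) gam :=
          hg.1.aemeasurable.ennreal_ofReal.ennreal_toReal.aestronglyMeasurable
        have m2 : AEStronglyMeasurable (fun x : ℝ => Complex.exp (t * x * Complex.I)) gam := by fun_prop
        exact m1.smul m2
      · have : ‖Complex.exp (t * x * Complex.I)‖ = 1 := by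
          simpa using Complex.norm_exp_ofReal_mul_I (t * x)
        rw [norm_smul, this, mul_one]
        simp only [ENNReal.toReal_ofReal', Real.norm_eq_abs]
        rw [abs_of_nonneg (le_max_right _ _)]
        exact max_le (le_abs_self _) (abs_nonneg _)
    rw [← sub_eq_zero, ← integral_sub (hb f hi) (hb (fun x => - f x) hi.neg)]
    refine Eq.trans ?_ (He_complete_char hf h t)
    refine integral_congr_ae (ae_of_all _ fun x => ?_)
    simp only [ENNReal.toReal_ofReal', Complex.real_smul]
    rw [← sub_mul, mul_comm]
    congr 1
    rw [← Complex.ofReal_sub]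
    congr 1
    rcases le_total 0 (f x) with h | h
    · rw [max_eq_left h, max_eq_right (by linarith)]; ring
    · rw [max_eq_right h, max_eq_left (by linarith)]; ring
  have k2 := (withDensity_eq_iff_of_sigmaFinite (by exact hi.1.aemeasurable.ennreal_ofReal)
    (by exact hi.1.aemeasurable.neg.ennreal_ofReal)).1 key
  · filter_upwards [k2] with x hx
    have := congrArg ENNReal.toReal hx
    simp only [ENNReal.toReal_ofReal'] at this
    rcases le_total 0 (f x) with h | h
    · rw [max_eq_left h, max_eq_right (by linarith)] at this; exact this
    · rw [max_eq_right h, max_eq_left (by linarith)] at this; simp; linarith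

lemma toLp_inner {f g : ℝ → ℝ} (hf : MemLp f 2 gam) (hg : MemLp g 2 gam) :
    inner ℝ (hf.toLp f) (hg.toLp g) = ∫ x, f x * g x ∂gam := by
  rw [L2.inner_def]
  refine integral_congr_ae ?_
  filter_upwards [hf.coeFn_toLp, hg.coeFn_toLp] with x h1 h2
  rw [h1, h2]; simp [mul_comm]

lemma toLp_normsq {f : ℝ → ℝ} (hf : MemLp f 2 gam) :
    ‖hf.toLp f‖^2 = ∫ x, f x ^2 ∂gam := by
  rw [← real_inner_self_eq_norm_sq, toLp_inner]; simp_rw [pow_two]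

noncomputable def hNf (n : ℕ) : ℝ → ℝ := fun x => (Real.sqrt n.factorial)⁻¹ * (He n).eval x

lemma hNf_mem (n : ℕ) : MemLp (hNf n) 2 gam := (gam_memLp_poly (He n)).const_mul _

noncomputable def hN (n : ℕ) : Lp ℝ 2 gam := (hNf_mem n).toLp _

lemma hN_orthonormal : Orthonormal ℝ hN := by
  rw [orthonormal_iff_ite]
  intro i j
  rw [hN, hN, toLp_inner]
  have : ∀ x, hNf i x * hNf j x = ((Real.sqrt i.factorial)⁻¹ * (Real.sqrt j.factorial)⁻¹) *
      ((He i).eval x * (He j).eval x) := fun x => by simp [hNf]; ring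
  simp_rw [this]
  rw [integral_const_mul, He_orth]
  split_ifs with h
  · subst h
    have h1 : (0:ℝ) < i.factorial := by exact_mod_cast i.factorial_pos
    have := Real.mul_self_sqrt h1.le
    have : Real.sqrt i.factorial ≠ 0 := (Real.sqrt_pos.2 h1).ne'
    field_simp; nlinarith
  · simp

noncomputable def hB : HilbertBasis ℕ ℝ (Lp ℝ 2 gam) :=
  HilbertBasis.mkOfOrthogonalEqBot hN_orthonormal (by
    rw [Submodule.eq_bot_iff]
    intro f hf
    have hm : MemLp f 2 gam := Lp.memLp f
    have e : ∀ n, ∫ x, f x * (He n).eval x ∂gam = 0 := by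
      intro n
      have h := hf (hN n) (Submodule.subset_span ⟨n, rfl⟩)
      have h2 := toLp_inner (hNf_mem n) hm
      rw [Lp.toLp_coeFn] at h2
      rw [hN] at h
      rw [h] at h2
      have : ∀ x, hNf n x * f x = (Real.sqrt n.factorial)⁻¹ * (f x * (He n).eval x) := fun x => by
        simp [hNf]; ring
      simp_rw [this] at h2
      rw [integral_const_mul] at h2
      have h1 : (0:ℝ) < n.factorial := by exact_mod_cast n.factorial_pos
      have := (Real.sqrt_pos.2 h1).ne'
      rcases mul_eq_zero.1 h2.symm with h3 | h3
      · exact absurd (inv_eq_zero.1 h3) this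
      · exact h3
    exact (Lp.eq_zero_iff_ae_eq_zero).2 (He_complete hm e))

lemma hB_eq (n : ℕ) : hB n = hN n := by
  simp [hB]

lemma hB_parseval (x : Lp ℝ 2 gam) : HasSum (fun n => (inner ℝ (hN n) x)^2) (‖x‖^2) := by
  have := hB.hasSum_inner_mul_inner x x
  rw [real_inner_self_eq_norm_sq] at this
  refine this.congr_fun fun n => ?_
  rw [hB_eq, real_inner_comm x, pow_two]

structure CS2 (w w1 w2 : ℝ → ℝ) (C : ℝ) : Prop where
  d1 : ∀ x, HasDerivAt w (w1 x) x
  d2 : ∀ x, HasDerivAt w1 (w2 x) x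
  c2 : Continuous w2
  s0 : ∀ x, C ≤ |x| → w x = 0
  s1 : ∀ x, C ≤ |x| → w1 x = 0
  s2 : ∀ x, C ≤ |x| → w2 x = 0

namespace CS2
variable {w w1 w2 : ℝ → ℝ} {C : ℝ}
lemma c0 (h : CS2 w w1 w2 C) : Continuous w := continuous_iff_continuousAt.2 fun x => (h.d1 x).continuousAt
lemma c1 (h : CS2 w w1 w2 C) : Continuous w1 := continuous_iff_continuousAt.2 fun x => (h.d2 x).continuousAt

/-- integration by parts against any C^1 function -/
lemma ibp (h : CS2 w w1 w2 C) {q q1 : ℝ → ℝ} (hq : ∀ x, HasDerivAt q (q1 x) x) (hc : Continuous q1) :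
    ∫ x, (w2 x - x * w1 x) * q x ∂gam = - ∫ x, w1 x * q1 x ∂gam := by
  have c1 := h.c1
  have c2 := h.c2
  have cq : Continuous q := continuous_iff_continuousAt.2 fun x => (hq x).continuousAt
  have i1 : Integrable (fun x => w1 x * q x) gam :=
    gam_int_cs (by fun_prop) (C := C) fun x hx => by simp [h.s1 x hx]
  have i2 : Integrable (fun x => w2 x * q x) gam :=
    gam_int_cs (by fun_prop) (C := C) fun x hx => by simp [h.s2 x hx]
  have i3 : Integrable (fun x => w1 x * q1 x) gam :=
    gam_int_cs (by fun_prop) (C := C) fun x hx => by simp [h.s1 x hx]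
  have i4 : Integrable (fun x => x * (w1 x * q x)) gam :=
    gam_int_cs (by fun_prop) (C := C) fun x hx => by simp [h.s1 x hx]
  have := gam_stein (fun x => (h.d2 x).fun_mul (hq x)) i1 (i2.add i3) i4
  rw [integral_add i2 i3] at this
  have e : ∀ x, (w2 x - x * w1 x) * q x = w2 x * q x - x * (w1 x * q x) := fun x => by ring
  simp_rw [e]
  rw [integral_sub i2 i4]; linarith

lemma mem0 (h : CS2 w w1 w2 C) : MemLp w 2 gam := by
  have := h.c0
  refine (memLp_two_iff_integrable_sq (by fun_prop)).2 (gam_int_cs (C := C) (by fun_prop) fun x hx => by simp [h.s0 x hx])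

lemma memL (h : CS2 w w1 w2 C) (l : ℝ) : MemLp (fun x => w2 x - x * w1 x + l * w x) 2 gam := by
  have := h.c0
  have := h.c1
  have := h.c2
  refine (memLp_two_iff_integrable_sq (by fun_prop)).2 (gam_int_cs (C := C) (by fun_prop) fun x hx => by
    simp [h.s0 x hx, h.s1 x hx, h.s2 x hx])

lemma eig (h : CS2 w w1 w2 C) (n : ℕ) :
    ∫ x, (w2 x - x * w1 x) * (He n).eval x ∂gam = - n * ∫ x, w x * (He n).eval x ∂gam := by
  have hc0 := h.c0
  have hc1 := h.c1
  rw [h.ibp (fun x => (He n).hasDerivAt x) (by fun_prop)]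
  have hd : ∀ x, HasDerivAt (fun x => w x * (Polynomial.derivative (He n)).eval x)
    (w1 x * (Polynomial.derivative (He n)).eval x + w x * (Polynomial.derivative (Polynomial.derivative (He n))).eval x) x :=
    fun x => (h.d1 x).fun_mul ((Polynomial.derivative (He n)).hasDerivAt x)
  have i1 : Integrable (fun x => w x * (Polynomial.derivative (He n)).eval x) gam :=
    gam_int_cs (by fun_prop) (C := C) fun x hx => by simp [h.s0 x hx]
  have i2 : Integrable (fun x => w1 x * (Polynomial.derivative (He n)).eval x) gam :=
    gam_int_cs (by fun_prop) (C := C) fun x hx => by simp [h.s1 x hx]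
  have i3 : Integrable (fun x => w x * (Polynomial.derivative (Polynomial.derivative (He n))).eval x) gam :=
    gam_int_cs (by fun_prop) (C := C) fun x hx => by simp [h.s0 x hx]
  have i4 : Integrable (fun x => x * (w x * (Polynomial.derivative (He n)).eval x)) gam :=
    gam_int_cs (by fun_prop) (C := C) fun x hx => by simp [h.s0 x hx]
  have i5 : Integrable (fun x => (n:ℝ) * (w x * (He n).eval x)) gam :=
    gam_int_cs (by fun_prop) (C := C) fun x hx => by simp [h.s0 x hx]
  have := gam_stein hd i1 (i2.add i3) i4
  rw [integral_add i2 i3] at this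
  have e : ∀ x, w x * (Polynomial.derivative (Polynomial.derivative (He n))).eval x =
     x * (w x * (Polynomial.derivative (He n)).eval x) - (n:ℝ) * (w x * (He n).eval x) := by
    intro x; rw [He_ode]; simp; ring
  simp_rw [e] at this
  rw [integral_sub i4 i5, integral_const_mul] at this
  linarith
end CS2

lemma spectral {w w1 w2 : ℝ → ℝ} {C : ℝ} (h : CS2 w w1 w2 C) (l : ℝ) :
    ∃ j : ℕ, (j:ℝ) ≤ |l| + 1 ∧ ∃ a : ℝ, a^2 ≤ ∫ x, w x ^2 ∂gam ∧
      ∫ x, w x^2 ∂gam - a^2 ≤ 4 * ∫ x, (w2 x - x * w1 x + l * w x)^2 ∂gam ∧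
      ∫ x, (w x - a * hNf j x)^2 ∂gam ≤ 4 * ∫ x, (w2 x - x * w1 x + l * w x)^2 ∂gam := by
  obtain ⟨j, hj1, hj2⟩ : ∃ j : ℕ, (j:ℝ) ≤ |l| + 1 ∧ ∀ n : ℕ, n ≠ j → 1 ≤ 4 * ((l - n)^2) := by
    rcases le_total l 0 with hl | hl
    · refine ⟨0, by simp; positivity, fun n hn => ?_⟩
      have : (1:ℝ) ≤ n := by exact_mod_cast Nat.one_le_iff_ne_zero.2 hn
      nlinarith
    · refine ⟨⌊l + 1/2⌋₊, ?_, fun n hn => ?_⟩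
      · have := Nat.floor_le (a := l + 1/2) (by linarith)
        rw [abs_of_nonneg hl]; linarith
      · have h1 := Nat.floor_le (a := l + 1/2) (by linarith)
        have h2 := Nat.lt_floor_add_one (l + 1/2)
        rcases lt_or_gt_of_ne hn with h3 | h3
        · have : (n:ℝ) + 1 ≤ (⌊l + 1/2⌋₊ : ℝ) := by exact_mod_cast h3
          nlinarith
        · have : (⌊l + 1/2⌋₊ : ℝ) + 1 ≤ n := by exact_mod_cast h3
          nlinarith
  set W := h.mem0.toLp w with hW
  set G := (h.memL l).toLp _ with hG
  have hc0 := h.c0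
  have hc1 := h.c1
  have hc2 := h.c2
  have e1 : ∀ n : ℕ, inner ℝ (hN n) G = (l - n) * inner ℝ (hN n) W := by
    intro n
    rw [hN, hG, hW, toLp_inner, toLp_inner]
    have a1 : ∀ x, hNf n x * (w2 x - x * w1 x + l * w x) = (Real.sqrt n.factorial)⁻¹ *
      ((w2 x - x * w1 x) * (He n).eval x + l * (w x * (He n).eval x)) := fun x => by simp [hNf]; ring
    have a2 : ∀ x, hNf n x * w x = (Real.sqrt n.factorial)⁻¹ * (w x * (He n).eval x) := fun x => by simp [hNf]; ring
    simp_rw [a1, a2]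
    rw [integral_const_mul, integral_const_mul, integral_add, h.eig, integral_const_mul]
    · ring
    · exact gam_int_cs (by fun_prop) (C := C) fun x hx => by simp [h.s1 x hx, h.s2 x hx]
    · exact gam_int_cs (by fun_prop) (C := C) fun x hx => by simp [h.s0 x hx]
  set a := inner ℝ (hN j) W with ha
  have on := orthonormal_iff_ite.1 hN_orthonormal
  have e2 : ∀ n : ℕ, inner ℝ (hN n) (W - a • hN j) = if n = j then 0 else inner ℝ (hN n) W := by
    intro n
    rw [inner_sub_right, inner_smul_right, on]
    split_ifs with h
    · subst h; simp [ha]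
    · simp
  have e3 : ‖W - a • hN j‖^2 ≤ 4 * ‖G‖^2 := by
    refine hasSum_le (fun n => ?_) (hB_parseval _) ((hB_parseval G).mul_left 4)
    rw [e2, e1]
    split_ifs with h
    · rw [zero_pow two_ne_zero]; positivity
    · have := hj2 n h
      nlinarith [sq_nonneg (inner ℝ (hN n) W : ℝ)]
  have e4 : ‖W - a • hN j‖^2 = ‖W‖^2 - a^2 := by
    rw [norm_sub_sq_real, inner_smul_right, real_inner_comm, ← ha, norm_smul, hN_orthonormal.1]
    simp; ring
  have n1 : ‖W‖^2 = ∫ x, w x^2 ∂gam := toLp_normsq _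
  have n2 : ‖G‖^2 = ∫ x, (w2 x - x * w1 x + l * w x)^2 ∂gam := toLp_normsq _
  have n3 : ‖W - a • hN j‖^2 = ∫ x, (w x - a * hNf j x)^2 ∂gam := by
    have hm : MemLp (fun x => w x - a * hNf j x) 2 gam := h.mem0.sub ((hNf_mem j).const_mul a)
    rw [← toLp_normsq hm]
    congr 2
  refine ⟨j, hj1, a, ?_, ?_, ?_⟩
  · have := sq_nonneg ‖W - a • hN j‖
    rw [← n1]; linarith
  · rw [← n1, ← n2]; linarith
  · rw [← n3, ← n2]; exact e3

lemma gam_cs {f g : ℝ → ℝ} (hf : MemLp f 2 gam) (hg : MemLp g 2 gam) :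
    (∫ x, f x * g x ∂gam)^2 ≤ (∫ x, f x ^2 ∂gam) * ∫ x, g x ^2 ∂gam := by
  rw [← toLp_inner hf hg, ← toLp_normsq hf, ← toLp_normsq hg, ← mul_pow]
  exact sq_le_sq' (by linarith [neg_le_of_abs_le (abs_real_inner_le_norm (hf.toLp f) (hg.toLp g))])
    (real_inner_le_norm _ _)

lemma gam_memLp_exp' (η : ℝ) : MemLp (fun x => Real.exp (η * x)) 2 gam := by
  refine (memLp_two_iff_integrable_sq (by fun_prop)).2 ?_
  refine (gam_int_pow_exp 0 (2*η)).congr (ae_of_all _ fun x => ?_)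
  simp only [pow_zero, one_mul, ← Real.exp_nat_mul]; congr 1; push_cast; ring

lemma gam_exp_sq (η : ℝ) : ∫ x, Real.exp (η * x) ^ 2 ∂gam = Real.exp (2 * η^2) := by
  have := He_shift 0 (2*η)
  simp only [He, Polynomial.eval_one, one_mul, pow_zero] at this
  rw [show 2 * η^2 = (2*η)^2/2 by ring, ← this]
  congr 1; ext x; rw [← Real.exp_nat_mul]; congr 1; push_cast; ring

lemma herm_eval (Λ : ℝ) : ∃ c > 0, ∃ ε > 0, ∀ (w w1 w2 : ℝ → ℝ) (C l : ℝ), CS2 w w1 w2 C → |l| ≤ Λ →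
    ∫ x, (w2 x - x * w1 x + l * w x)^2 ∂gam ≤ ε^2 * ∫ x, w x^2 ∂gam →
    ∀ η : ℝ, 1 ≤ |η| → |η| ≤ 2 →
      c * Real.sqrt (∫ x, w x^2 ∂gam) ≤ |∫ x, w x * Real.exp (η * x) ∂gam| := by
  set k := ⌈Λ + 1⌉₊ with hk
  have hf : (1:ℝ) ≤ k.factorial := by exact_mod_cast k.factorial_pos
  set q := Real.sqrt k.factorial with hq
  have hq1 : 1 ≤ q := by rw [hq]; exact Real.one_le_sqrt.2 hf
  set c0 : ℝ := (2 * q)⁻¹ with hc0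
  have c0p : 0 < c0 := by positivity
  refine ⟨c0/2, by positivity, min (1/4) (c0 / (4 * Real.exp 4)), by positivity, ?_⟩
  intro w w1 w2 C l h hl hε η h1 h2
  set ε := min (1/4) (c0 / (4 * Real.exp 4)) with hεd
  have ε0 : 0 < ε := by positivity
  have ε1 : ε ≤ 1/4 := min_le_left _ _
  have ε2 : ε * (4 * Real.exp 4) ≤ c0 := by
    have := min_le_right (1/4) (c0 / (4 * Real.exp 4))
    rwa [← hεd, le_div_iff₀ (by positivity)] at this
  obtain ⟨j, hj, a, ha1, ha2, ha3⟩ := spectral h l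
  set H := ∫ x, w x^2 ∂gam with hH
  have H0 : 0 ≤ H := integral_nonneg fun x => by positivity
  have hjk : j ≤ k := by
    have : (j:ℝ) ≤ k := by
      refine le_trans ?_ (Nat.le_ceil _)
      linarith
    exact_mod_cast this
  set S := Real.sqrt H with hS
  have S0 : 0 ≤ S := Real.sqrt_nonneg _
  have SS : S^2 = H := Real.sq_sqrt H0
  have hv : MemLp (fun x => w x - a * hNf j x) 2 gam := h.mem0.sub ((hNf_mem j).const_mul a)
  have he := gam_memLp_exp' η
  have cs := gam_cs hv he
  rw [gam_exp_sq] at cs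
  set Q := ∫ x, (w x - a * hNf j x) * Real.exp (η * x) ∂gam with hQ
  have eq : ∫ x, w x * Real.exp (η * x) ∂gam = Q + a * ((Real.sqrt j.factorial)⁻¹ * (η^j * Real.exp (η^2/2))) := by
    have : ∀ x, w x * Real.exp (η * x) = (w x - a * hNf j x) * Real.exp (η * x) +
       (a * (Real.sqrt j.factorial)⁻¹) * ((He j).eval x * Real.exp (η * x)) := by
      intro x; simp [hNf]; ring
    simp_rw [this]
    have hvi : Integrable (fun x => (w x - a * hNf j x) * Real.exp (η * x)) gam := hv.integrable_mul he
    rw [integral_add hvi ((gam_int_poly_exp _ _).const_mul _), integral_const_mul, He_shift]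
    ring
  have Qb : |Q| ≤ 2 * ε * S * Real.exp 4 := by
    apply abs_le_of_sq_le_sq _ (by positivity)
    have h4 : Real.exp (2 * η^2) ≤ Real.exp 4 ^ 2 := by
      rw [← Real.exp_nat_mul]; apply Real.exp_le_exp.2
      have : η^2 ≤ 4 := by rw [← sq_abs]; nlinarith [abs_nonneg η]
      push_cast; linarith
    calc Q^2 ≤ _ := cs
      _ ≤ (4 * (ε^2 * H)) * Real.exp 4 ^ 2 := by gcongr; linarith
      _ = _ := by rw [← SS]; ring
  have ab : S / 2 ≤ |a| := by
    refine le_of_sq_le_sq ?_ (abs_nonneg _)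
    rw [sq_abs]
    have e7 : ε^2 ≤ 1/16 := by nlinarith
    have e8 : ε^2 * H ≤ 1/16 * H := mul_le_mul_of_nonneg_right e7 H0
    rw [div_pow, SS]; linarith
  have jf : (Real.sqrt j.factorial) ≤ q := by
    rw [hq]; apply Real.sqrt_le_sqrt; exact_mod_cast Nat.factorial_le hjk
  have jf0 : 0 < Real.sqrt j.factorial := Real.sqrt_pos.2 (by exact_mod_cast j.factorial_pos)
  have main : c0 * S ≤ |a * ((Real.sqrt j.factorial)⁻¹ * (η^j * Real.exp (η^2/2)))| := by
    rw [abs_mul, abs_mul, abs_mul, abs_pow, abs_of_pos (Real.exp_pos _), abs_of_pos (inv_pos.2 jf0)]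
    have i1 : 1 ≤ |η|^j := one_le_pow₀ h1
    have i2 : 1 ≤ Real.exp (η^2/2) := Real.one_le_exp (by positivity)
    have i3 : q⁻¹ ≤ (Real.sqrt j.factorial)⁻¹ := inv_anti₀ jf0 jf
    calc c0 * S = (S/2) * (q⁻¹ * (1 * 1)) := by rw [hc0, mul_inv]; ring
      _ ≤ _ := by gcongr
  rw [eq]
  have := abs_sub_abs_le_abs_sub (a * ((Real.sqrt j.factorial)⁻¹ * (η^j * Real.exp (η^2/2)))) (-Q)
  rw [abs_neg, sub_neg_eq_add, add_comm _ Q] at this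
  have e5 : 2 * ε * S * Real.exp 4 = (ε * (4 * Real.exp 4) * S) / 2 := by ring
  have e6 := mul_le_mul_of_nonneg_right ε2 S0
  linarith

structure HI (U Uy Uyy Uh : ℝ → ℝ → ℝ) (R K M ρ : ℝ) : Prop where
  Rp : 0 < R
  Kp : 0 < K
  Mp : 0 ≤ M
  ρp : 0 < ρ
  s0 : ∀ y h, |h| < ρ^2 → R ≤ |y| → U y h = 0
  s1 : ∀ y h, |h| < ρ^2 → R ≤ |y| → Uy y h = 0
  s2 : ∀ y h, |h| < ρ^2 → R ≤ |y| → Uyy y h = 0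
  d1 : ∀ y h, |h| < ρ^2 → HasDerivAt (fun z => U z h) (Uy y h) y
  d2 : ∀ y h, |h| < ρ^2 → HasDerivAt (fun z => Uy z h) (Uyy y h) y
  dh : ∀ y h, |h| < ρ^2 → HasDerivAt (fun k => U y k) (Uh y h) h
  c0 : ∀ y h, |h| < ρ^2 → ContinuousAt (fun p : ℝ × ℝ => U p.1 p.2) (y, h)
  c1 : ∀ y h, |h| < ρ^2 → ContinuousAt (fun p : ℝ × ℝ => Uy p.1 p.2) (y, h)
  c2 : ∀ y h, |h| < ρ^2 → ContinuousAt (fun p : ℝ × ℝ => Uyy p.1 p.2) (y, h)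
  ch : ∀ h, |h| < ρ^2 → Continuous (fun y => Uh y h)
  b0 : ∀ y h, |h| < ρ^2 → |U y h| ≤ K
  b1 : ∀ y h, |h| < ρ^2 → |Uy y h| ≤ K
  b2 : ∀ y h, |h| < ρ^2 → |Uyy y h| ≤ K
  bh : ∀ y h, |h| < ρ^2 → |Uh y h| ≤ K
  ineq : ∀ y h, |h| < ρ^2 → |y| < R / 2 → |Uh y h + Uyy y h| ≤ M * (|U y h| + |Uy y h|)
  ineq2 : ∀ y h, |h| < ρ^2 → |Uh y h + Uyy y h| ≤ M * (|U y h| + |Uy y h|) + K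

namespace HI
variable {U Uy Uyy Uh : ℝ → ℝ → ℝ} {R K M ρ : ℝ}

lemma cy0 (H : HI U Uy Uyy Uh R K M ρ) {h : ℝ} (hh : |h| < ρ^2) : Continuous (fun y => U y h) :=
  continuous_iff_continuousAt.2 fun y => (H.d1 y h hh).continuousAt
lemma cy1 (H : HI U Uy Uyy Uh R K M ρ) {h : ℝ} (hh : |h| < ρ^2) : Continuous (fun y => Uy y h) :=
  continuous_iff_continuousAt.2 fun y => (H.d2 y h hh).continuousAt
lemma cy2 (H : HI U Uy Uyy Uh R K M ρ) {h : ℝ} (hh : |h| < ρ^2) : Continuous (fun y => Uyy y h) :=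
  continuous_iff_continuousAt.2 fun y =>
    ContinuousAt.comp (f := fun y : ℝ => (y, h)) (H.c2 y h hh) (by fun_prop)

lemma cs2 (H : HI U Uy Uyy Uh R K M ρ) {h : ℝ} (hh : |h| < ρ^2) (x : ℝ) {σ : ℝ} (hσ : 0 < σ) :
    CS2 (fun ξ => U (x + σ * ξ) h) (fun ξ => σ * Uy (x + σ * ξ) h) (fun ξ => σ^2 * Uyy (x + σ * ξ) h)
      ((R + |x|) / σ) := by
  have hin : ∀ ξ : ℝ, HasDerivAt (fun ξ => x + σ * ξ) σ ξ := fun ξ => by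
    simpa using ((hasDerivAt_id ξ).const_mul σ).const_add x
  have hs : ∀ ξ : ℝ, (R + |x|) / σ ≤ |ξ| → R ≤ |x + σ * ξ| := fun ξ h => by
    rw [div_le_iff₀ hσ] at h
    have h3 : |σ * ξ| = |ξ| * σ := by rw [abs_mul, abs_of_pos hσ, mul_comm]
    have h4 := abs_sub_abs_le_abs_sub (σ * ξ) (-x)
    rw [abs_neg, sub_neg_eq_add, add_comm (σ * ξ)] at h4
    linarith
  have := H.cy2 hh
  refine ⟨fun ξ => ?_, fun ξ => ?_, by fun_prop, fun ξ h => H.s0 _ _ hh (hs ξ h), fun ξ h => ?_, fun ξ h => ?_⟩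
  · refine HasDerivAt.congr_deriv (f' := Uy (x + σ * ξ) h * σ) ?_ (by ring)
    exact (H.d1 (x + σ * ξ) h hh).comp ξ (hin ξ)
  · refine HasDerivAt.congr_deriv (f' := σ * (Uyy (x + σ * ξ) h * σ)) ?_ (by ring)
    exact ((H.d2 (x + σ * ξ) h hh).comp ξ (hin ξ)).const_mul σ
  · simp [H.s1 _ _ hh (hs ξ h)]
  · simp [H.s2 _ _ hh (hs ξ h)]

lemma ev (s : ℝ) {k : ℝ → ℝ} (hk : |k s| < ρ^2) (y : ℝ) : ∀ᶠ z : ℝ × ℝ in 𝓝 (y, k s), |z.2| < ρ^2 := by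
  have : ContinuousAt (fun z : ℝ × ℝ => |z.2|) (y, k s) := by fun_prop
  exact this.eventually_lt continuousAt_const hk

lemma curve (H : HI U Uy Uyy Uh R K M ρ) {σ k : ℝ → ℝ} {σ' k' s : ℝ} (x ξ : ℝ) (hk : |k s| < ρ^2)
    (dσ : HasDerivAt σ σ' s) (dk : HasDerivAt k k' s) :
    HasDerivAt (fun s => U (x + σ s * ξ) (k s))
      (Uy (x + σ s * ξ) (k s) * (σ' * ξ) + Uh (x + σ s * ξ) (k s) * k') s := by
  refine chain2 (f := U) (f1 := Uy) (p := fun s => x + σ s * ξ) ?_ (H.c1 _ _ hk) (H.dh _ _ hk) ?_ dk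
  · filter_upwards [ev s hk _] with z hz using H.d1 _ _ hz
  · exact (dσ.mul_const ξ).const_add x

lemma int_abs : Integrable (fun ξ : ℝ => |ξ|) gam := by
  simpa using gam_int_pow_exp 1 0

lemma deriv_int (H : HI U Uy Uyy Uh R K M ρ) {σ k σ' k' : ℝ → ℝ} {a b B s0 : ℝ} (x : ℝ)
    {φ φ' : ℝ → ℝ} (hφ : ∀ z, HasDerivAt φ (φ' z) z) (cφ : Continuous φ')
    (hs0 : s0 ∈ Ioo a b) (hk : ∀ s ∈ Ioo a b, |k s| < ρ^2)
    (dσ : ∀ s ∈ Ioo a b, HasDerivAt σ (σ' s) s) (dk : ∀ s ∈ Ioo a b, HasDerivAt k (k' s) s)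
    (bσ : ∀ s ∈ Ioo a b, |σ' s| ≤ B) (bk : ∀ s ∈ Ioo a b, |k' s| ≤ B) :
    HasDerivAt (fun s => ∫ ξ, φ (U (x + σ s * ξ) (k s)) ∂gam)
      (∫ ξ, φ' (U (x + σ s0 * ξ) (k s0)) *
        (Uy (x + σ s0 * ξ) (k s0) * (σ' s0 * ξ) + Uh (x + σ s0 * ξ) (k s0) * k' s0) ∂gam) s0 := by
  have cφ0 : Continuous φ := continuous_iff_continuousAt.2 fun x => (hφ x).continuousAt
  obtain ⟨C, hC⟩ := (isCompact_Icc (a := -K) (b := K)).exists_bound_of_continuousOn cφ.continuousOn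
  obtain ⟨C0, hC0⟩ := (isCompact_Icc (a := -K) (b := K)).exists_bound_of_continuousOn cφ0.continuousOn
  have cw : ∀ s ∈ Ioo a b, Continuous (fun ξ => U (x + σ s * ξ) (k s)) := fun s hs =>
    (H.cy0 (hk s hs)).comp (f := fun ξ => x + σ s * ξ) (by fun_prop)
  refine (hasDerivAt_integral_of_dominated_loc_of_deriv_le (μ := gam) (s := Ioo a b) (x₀ := s0)
    (F := fun s ξ => φ (U (x + σ s * ξ) (k s)))
    (F' := fun s ξ => φ' (U (x + σ s * ξ) (k s)) *
        (Uy (x + σ s * ξ) (k s) * (σ' s * ξ) + Uh (x + σ s * ξ) (k s) * k' s))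
    (bound := fun ξ => C * (K * B * |ξ| + K * B)) (Ioo_mem_nhds hs0.1 hs0.2) ?_ ?_ ?_ ?_ ?_ ?_).2
  · filter_upwards [Ioo_mem_nhds hs0.1 hs0.2] with s hs
    exact (cφ0.comp (cw s hs)).aestronglyMeasurable
  · refine gam_int_bdd (cφ0.comp (cw s0 hs0)) (C := C0) fun ξ => hC0 _ (abs_le.1 (H.b0 _ _ (hk s0 hs0)))
  · have h1 := (H.cy1 (hk s0 hs0)).comp (f := fun ξ => x + σ s0 * ξ) (by fun_prop)
    have h2 := (H.ch _ (hk s0 hs0)).comp (f := fun ξ => x + σ s0 * ξ) (by fun_prop)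
    refine ((cφ.comp (cw s0 hs0)).mul ((h1.mul (by fun_prop)).add (h2.mul continuous_const))).aestronglyMeasurable
  · refine ae_of_all _ fun ξ s hs => ?_
    rw [Real.norm_eq_abs, abs_mul]
    have e0 : |φ' (U (x + σ s * ξ) (k s))| ≤ C := hC _ (abs_le.1 (H.b0 _ _ (hk s hs)))
    have B0 : 0 ≤ B := (abs_nonneg _).trans (bσ s hs)
    have e1 := H.b1 (x + σ s * ξ) _ (hk s hs)
    have e2 := H.bh (x + σ s * ξ) _ (hk s hs)
    have C0 : 0 ≤ C := (abs_nonneg _).trans e0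
    have K0 := H.Kp.le
    refine mul_le_mul e0 ((abs_add_le _ _).trans ?_) (abs_nonneg _) C0
    rw [abs_mul, abs_mul, abs_mul]
    have e3 := bσ s hs
    have e4 := bk s hs
    calc |Uy (x + σ s * ξ) (k s)| * (|σ' s| * |ξ|) + |Uh (x + σ s * ξ) (k s)| * |k' s|
        ≤ K * (B * |ξ|) + K * B := by gcongr
      _ = _ := by ring
  · exact ((int_abs.const_mul _).add (integrable_const _)).const_mul _
  · refine ae_of_all _ fun ξ s hs => ?_
    exact (hφ _).comp s (H.curve x ξ (hk s hs) (dσ s hs) (dk s hs))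
end HI

lemma int_one_add_abs_sq : Integrable (fun ξ : ℝ => (1 + |ξ|)^2) gam := by
  have h1 : Integrable (fun ξ : ℝ => |ξ|) gam := HI.int_abs
  have h2 : Integrable (fun ξ : ℝ => ξ^2) gam := by
    refine (gam_int_poly (Polynomial.X^2)).congr (ae_of_all _ fun x => by simp)
  have h3 : Integrable (fun ξ : ℝ => 1 + 2 * |ξ| + ξ^2) gam :=
    ((integrable_const (1:ℝ)).add (h1.const_mul 2)).add h2
  refine h3.congr (ae_of_all _ fun x => ?_)
  simp only []
  rw [← sq_abs x]; ring

lemma D_deriv {w w1 w2 wr : ℝ → ℝ → ℝ} {C : ℝ → ℝ} {a b B r : ℝ} (hr : r ∈ Ioo a b)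
    (hcs : ∀ s ∈ Ioo a b, CS2 (w s) (w1 s) (w2 s) (C s))
    (hd : ∀ s ∈ Ioo a b, ∀ ξ, HasDerivAt (fun s => w s ξ) (wr s ξ) s)
    (hB : ∀ s ∈ Ioo a b, ∀ ξ, |wr s ξ| ≤ B * (1 + |ξ|))
    (hL : ∀ s ∈ Ioo a b, ∀ ξ, |w2 s ξ - ξ * w1 s ξ| ≤ B * (1 + |ξ|))
    (hc : ∀ ξ, ContinuousAt (fun s => w2 s ξ - ξ * w1 s ξ) r) :
    HasDerivAt (fun s => ∫ ξ, w1 s ξ^2 ∂gam) (-(2 * ∫ ξ, wr r ξ * (w2 r ξ - ξ * w1 r ξ) ∂gam)) r := by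
  have B0 : 0 ≤ B := by
    have := (abs_nonneg _).trans (hB r hr 0)
    simpa using this
  have hX : ∀ s ∈ Ioo a b, ∀ s' ∈ Ioo a b, ∫ ξ, (w2 s ξ - ξ * w1 s ξ) * w s' ξ ∂gam = - ∫ ξ, w1 s ξ * w1 s' ξ ∂gam :=
    fun s hs s' hs' => (hcs s hs).ibp (hcs s' hs').d1 (hcs s' hs').c1
  have hI : ∀ s ∈ Ioo a b, ∀ s' ∈ Ioo a b, Integrable (fun ξ => (w2 s ξ - ξ * w1 s ξ) * w s' ξ) gam := by
    intro s hs s' hs'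
    have := (hcs s hs).c1
    have := (hcs s hs).c2
    have := (hcs s' hs').c0
    exact gam_int_cs (C := C s) (by fun_prop) fun x hx => by simp [(hcs s hs).s1 x hx, (hcs s hs).s2 x hx]
  have hdiff : ∀ s ∈ Ioo a b, (∫ ξ, w1 s ξ^2 ∂gam) - (∫ ξ, w1 r ξ^2 ∂gam) =
      - ∫ ξ, (w s ξ - w r ξ) * ((w2 s ξ - ξ * w1 s ξ) + (w2 r ξ - ξ * w1 r ξ)) ∂gam := by
    intro s hs
    have e : ∀ ξ, (w s ξ - w r ξ) * ((w2 s ξ - ξ * w1 s ξ) + (w2 r ξ - ξ * w1 r ξ)) =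
      ((w2 s ξ - ξ * w1 s ξ) * w s ξ - (w2 s ξ - ξ * w1 s ξ) * w r ξ) +
      ((w2 r ξ - ξ * w1 r ξ) * w s ξ - (w2 r ξ - ξ * w1 r ξ) * w r ξ) := fun ξ => by ring
    simp_rw [e]
    have k1 : ∀ s' ∈ Ioo a b, Integrable (fun ξ => (w2 s' ξ - ξ * w1 s' ξ) * w s ξ - (w2 s' ξ - ξ * w1 s' ξ) * w r ξ) gam :=
      fun s' hs' => (hI s' hs' s hs).sub (hI s' hs' r hr)
    rw [integral_add (k1 s hs) (k1 r hr), integral_sub (hI s hs s hs) (hI s hs r hr), integral_sub (hI r hr s hs) (hI r hr r hr),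
      hX s hs s hs, hX s hs r hr, hX r hr s hs, hX r hr r hr]
    have e2 : ∫ ξ, w1 s ξ * w1 r ξ ∂gam = ∫ ξ, w1 r ξ * w1 s ξ ∂gam := by
      congr 1; ext ξ; ring
    rw [e2]; simp_rw [pow_two]; ring
  rw [hasDerivAt_iff_tendsto_slope]
  have hmem : ∀ᶠ s in 𝓝[≠] r, s ∈ Ioo a b := mem_nhdsWithin_of_mem_nhds (Ioo_mem_nhds hr.1 hr.2)
  have hT : Tendsto (fun s => ∫ ξ, slope (fun s => w s ξ) r s * ((w2 s ξ - ξ * w1 s ξ) + (w2 r ξ - ξ * w1 r ξ)) ∂gam)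
      (𝓝[≠] r) (𝓝 (∫ ξ, wr r ξ * ((w2 r ξ - ξ * w1 r ξ) + (w2 r ξ - ξ * w1 r ξ)) ∂gam)) := by
    refine tendsto_integral_filter_of_dominated_convergence (fun ξ => B * (2 * B) * (1 + |ξ|)^2) ?_ ?_ ?_ ?_
    · filter_upwards [hmem] with s hs
      have := (hcs s hs).c0
      have := (hcs s hs).c1
      have := (hcs s hs).c2
      have := (hcs r hr).c0
      have := (hcs r hr).c1
      have := (hcs r hr).c2
      simp_rw [slope_def_field]
      exact Continuous.aestronglyMeasurable (by fun_prop)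
    · filter_upwards [hmem] with s hs
      refine ae_of_all _ fun ξ => ?_
      have h1 : |slope (fun s => w s ξ) r s| ≤ B * (1 + |ξ|) := by
        have := (convex_Ioo a b).norm_image_sub_le_of_norm_hasDerivWithin_le (f := fun s => w s ξ) (f' := fun s => wr s ξ)
          (C := B * (1 + |ξ|)) (fun s hs => (hd s hs ξ).hasDerivWithinAt) (fun s hs => hB s hs ξ) hr hs
        rw [slope_def_field, abs_div]
        exact div_le_of_le_mul₀ (abs_nonneg _) (by positivity) this
      rw [Real.norm_eq_abs, abs_mul]
      calc _ ≤ (B * (1 + |ξ|)) * (B * (1 + |ξ|) + B * (1 + |ξ|)) :=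
            mul_le_mul h1 ((abs_add_le _ _).trans (add_le_add (hL s hs ξ) (hL r hr ξ))) (abs_nonneg _) (by positivity)
        _ = _ := by ring
    · exact int_one_add_abs_sq.const_mul _
    · refine ae_of_all _ fun ξ => ?_
      exact (hasDerivAt_iff_tendsto_slope.1 (hd r hr ξ)).mul
        (((hc ξ).tendsto.mono_left nhdsWithin_le_nhds).add tendsto_const_nhds)
  have e3 : -(2 * ∫ ξ, wr r ξ * (w2 r ξ - ξ * w1 r ξ) ∂gam) =
      -(∫ ξ, wr r ξ * ((w2 r ξ - ξ * w1 r ξ) + (w2 r ξ - ξ * w1 r ξ)) ∂gam) := by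
    rw [← integral_const_mul]; congr 2; ext ξ; ring
  rw [e3]
  refine hT.neg.congr' ?_
  filter_upwards [hmem] with s hs
  rw [slope_def_field, hdiff s hs, neg_div, ← integral_div]
  congr 2; ext ξ; rw [slope_def_field]; ring

lemma gam_int_exp (A : ℝ) : Integrable (fun ξ : ℝ => Real.exp (A * ξ)) gam := by
  simpa using gam_int_pow_exp 0 A
lemma gam_exp (A : ℝ) : ∫ ξ, Real.exp (A * ξ) ∂gam = Real.exp (A^2/2) := by
  simpa [He] using He_shift 0 A

namespace HI
variable {U Uy Uyy Uh : ℝ → ℝ → ℝ} {R K M ρ : ℝ}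

lemma F_sq (H : HI U Uy Uyy Uh R K M ρ) {h σ : ℝ} (hh : |h| < ρ^2) (hσ : 0 < σ) :
    Integrable (fun ξ => (Uh (σ * ξ) h + Uyy (σ * ξ) h)^2) gam ∧
    ∫ ξ, (Uh (σ * ξ) h + Uyy (σ * ξ) h)^2 ∂gam ≤
      3 * M^2 * (∫ ξ, U (σ * ξ) h^2 ∂gam + ∫ ξ, Uy (σ * ξ) h^2 ∂gam) + 6 * K^2 * Real.exp (-(R^2/(8*σ^2))) := by
  have c0 := H.cy0 hh
  have c1 := H.cy1 hh
  have c2 := H.cy2 hh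
  have c3 := H.ch _ hh
  have K0 := H.Kp
  have R0 := H.Rp
  have i1 : Integrable (fun ξ => U (σ * ξ) h^2) gam := gam_int_bdd (by fun_prop) (C := K^2) fun ξ => by
    rw [abs_pow]; have := H.b0 (σ * ξ) h hh; gcongr
  have i2 : Integrable (fun ξ => Uy (σ * ξ) h^2) gam := gam_int_bdd (by fun_prop) (C := K^2) fun ξ => by
    rw [abs_pow]; have := H.b1 (σ * ξ) h hh; gcongr
  have i3 : Integrable (fun ξ => (Uh (σ * ξ) h + Uyy (σ * ξ) h)^2) gam := gam_int_bdd (by fun_prop) (C := (K+K)^2) fun ξ => by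
    rw [abs_pow]; have := (abs_add_le _ _).trans (add_le_add (H.bh (σ * ξ) h hh) (H.b2 (σ * ξ) h hh)); gcongr
  refine ⟨i3, ?_⟩
  set A := R / (2 * σ) with hA
  have A0 : 0 < A := by positivity
  have i4 : Integrable (fun ξ => Real.exp (A * ξ) + Real.exp (-A * ξ)) gam := (gam_int_exp A).add (gam_int_exp (-A))
  have i5 : Integrable (fun ξ => 3 * M^2 * (U (σ * ξ) h^2 + Uy (σ * ξ) h^2)) gam := (i1.add i2).const_mul _
  have i6 : Integrable (fun ξ => 3 * K^2 * Real.exp (-A^2) * (Real.exp (A * ξ) + Real.exp (-A * ξ))) gam := i4.const_mul _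
  have key : ∀ ξ, (Uh (σ * ξ) h + Uyy (σ * ξ) h)^2 ≤ 3 * M^2 * (U (σ * ξ) h^2 + Uy (σ * ξ) h^2) +
      3 * K^2 * Real.exp (-A^2) * (Real.exp (A * ξ) + Real.exp (-A * ξ)) := by
    intro ξ
    have hpos : 0 ≤ 3 * K^2 * Real.exp (-A^2) * (Real.exp (A * ξ) + Real.exp (-A * ξ)) := by positivity
    have e1 := sq_abs (U (σ * ξ) h)
    have e2 := sq_abs (Uy (σ * ξ) h)
    have m0 := H.Mp
    by_cases hc : |σ * ξ| < R / 2
    · have := H.ineq _ _ hh hc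
      rw [← sq_abs (_ + _)]
      have h2 := pow_le_pow_left₀ (abs_nonneg _) this 2
      nlinarith [sq_nonneg (M * (|U (σ * ξ) h| - |Uy (σ * ξ) h|)), sq_nonneg (M * |U (σ * ξ) h|), sq_nonneg (M * |Uy (σ * ξ) h|)]
    · have hh2 := H.ineq2 (σ * ξ) _ hh
      rw [← sq_abs (_ + _)]
      have h2 := pow_le_pow_left₀ (abs_nonneg _) hh2 2
      have h3 : 1 ≤ Real.exp (-A^2) * (Real.exp (A * ξ) + Real.exp (-A * ξ)) := by
        have hx : A ≤ |ξ| := by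
          rw [hA, div_le_iff₀ (by positivity)]
          rw [abs_mul, abs_of_pos hσ] at hc; linarith
        rw [mul_add, ← Real.exp_add, ← Real.exp_add]
        rcases le_abs.1 hx with h5 | h5
        · have : 1 ≤ Real.exp (-A^2 + A * ξ) := Real.one_le_exp (by nlinarith)
          linarith [Real.exp_pos (-A^2 + -A * ξ)]
        · have : 1 ≤ Real.exp (-A^2 + -A * ξ) := Real.one_le_exp (by nlinarith)
          linarith [Real.exp_pos (-A^2 + A * ξ)]
      have h4 : 3 * K^2 * 1 ≤ 3 * K^2 * (Real.exp (-A^2) * (Real.exp (A * ξ) + Real.exp (-A * ξ))) := by gcongr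
      rw [← mul_assoc] at h4
      nlinarith [sq_nonneg (M * |U (σ * ξ) h| - M * |Uy (σ * ξ) h|), sq_nonneg (M * |U (σ * ξ) h| - K), sq_nonneg (M * |Uy (σ * ξ) h| - K)]
  refine (integral_mono i3 (i5.add i6) key).trans ?_
  simp only [Pi.add_apply]
  rw [integral_add i5 i6, integral_const_mul, integral_const_mul, integral_add i1 i2,
    integral_add (gam_int_exp A) (gam_int_exp (-A)), gam_exp, gam_exp]
  have e : Real.exp (-A^2) * Real.exp (A^2/2) = Real.exp (-(R^2/(8*σ^2))) := by
    rw [← Real.exp_add]; congr 1; rw [hA]; field_simp; ring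
  rw [neg_sq]
  apply le_of_eq
  linear_combination (6 * K^2) * e
end HI

lemma mono_arg {N N' q : ℝ → ℝ} {C r0 : ℝ} (hC : 0 ≤ C) (hr0 : 0 < r0)
    (h0 : ∀ r ∈ Ioo 0 r0, 0 ≤ N r) (hd : ∀ r ∈ Ioo 0 r0, HasDerivAt N (N' r) r)
    (hq : ∀ r ∈ Ioo 0 r0, 0 ≤ q r)
    (hi : ∀ r ∈ Ioo 0 r0, 2 / r * q r - C / 2 * r * (1 + N r) ≤ N' r) :
    (∃ Λ, ∀ r ∈ Ioo 0 (r0/2), N r ≤ Λ) ∧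
    ∀ ε > 0, ∃ δ > 0, δ ≤ r0 / 2 ∧ ∀ r1 ∈ Ioo 0 δ, ∃ r ∈ Icc (r1/2) r1, q r ≤ ε := by
  set G : ℝ → ℝ := fun r => Real.exp (C / 4 * r^2) * (1 + N r) with hG
  set G' : ℝ → ℝ := fun r => Real.exp (C / 4 * r^2) * (N' r + C / 2 * r * (1 + N r)) with hG'
  have dG : ∀ r ∈ Ioo 0 r0, HasDerivAt G (G' r) r := by
    intro r hr
    have e1 : HasDerivAt (fun r => Real.exp (C / 4 * r^2)) (Real.exp (C / 4 * r^2) * (C / 4 * (2 * r))) r := by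
      have := (((hasDerivAt_id r).pow 2).const_mul (C/4)).exp
      simpa using this
    have := e1.fun_mul ((hd r hr).const_add 1)
    refine this.congr_deriv ?_
    simp only [hG']; ring
  have hlow : ∀ r ∈ Ioo 0 r0, 2 / r * q r ≤ G' r := by
    intro r hr
    have h1 := hi r hr
    have h2 : 0 ≤ 2 / r * q r := mul_nonneg (div_nonneg zero_le_two hr.1.le) (hq r hr)
    have h3 : 1 ≤ Real.exp (C / 4 * r^2) := Real.one_le_exp (by positivity)
    have h4 : 2 / r * q r ≤ N' r + C / 2 * r * (1 + N r) := by linarith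
    simp only [hG']
    nlinarith
  have hmono : MonotoneOn G (Ioo 0 r0) := by
    refine monotoneOn_of_deriv_nonneg (convex_Ioo _ _) (fun r hr => (dG r hr).continuousAt.continuousWithinAt)
      (fun r hr => ?_) (fun r hr => ?_)
    · rw [interior_Ioo] at hr; exact (dG r hr).differentiableAt.differentiableWithinAt
    · rw [interior_Ioo] at hr; rw [(dG r hr).deriv]
      exact le_trans (mul_nonneg (div_nonneg zero_le_two hr.1.le) (hq r hr)) (hlow r hr)
  have hNG : ∀ r ∈ Ioo 0 r0, 1 + N r ≤ G r := by
    intro r hr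
    have h3 : 1 ≤ Real.exp (C / 4 * r^2) := Real.one_le_exp (by positivity)
    have := h0 r hr
    simp only [hG]; nlinarith
  constructor
  · refine ⟨G (r0/2), fun r hr => ?_⟩
    have hr' : r ∈ Ioo 0 r0 := ⟨hr.1, by linarith [hr.2]⟩
    have := hmono hr' (⟨by linarith, by linarith⟩ : r0/2 ∈ Ioo 0 r0) hr.2.le
    linarith [hNG r hr']
  · intro ε hε
    set m := sInf (G '' Ioo 0 r0) with hm
    have hbdd : BddBelow (G '' Ioo 0 r0) := ⟨0, by
      rintro _ ⟨r, hr, rfl⟩; linarith [hNG r hr, h0 r hr]⟩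
    have hne : (G '' Ioo 0 r0).Nonempty := ⟨_, r0/2, ⟨by linarith, by linarith⟩, rfl⟩
    obtain ⟨_, ⟨δ, hδ, rfl⟩, hlt⟩ := exists_lt_of_csInf_lt hne (show m < m + ε by linarith)
    refine ⟨min δ (r0/2), lt_min hδ.1 (by linarith), min_le_right _ _, fun r1 hr1 => ?_⟩
    have h1 : r1 < δ := lt_of_lt_of_le hr1.2 (min_le_left _ _)
    have hr1' : r1 ∈ Ioo 0 r0 := ⟨hr1.1, h1.trans hδ.2⟩
    have hr2' : r1/2 ∈ Ioo 0 r0 := ⟨by linarith [hr1.1], by linarith [hr1'.2, hr1.1]⟩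
    have hsub : ∀ r ∈ Icc (r1/2) r1, r ∈ Ioo 0 r0 := fun r hr => ⟨by linarith [hr.1, hr2'.1], by linarith [hr.2, hr1'.2]⟩
    obtain ⟨r, hr, he⟩ := exists_hasDerivAt_eq_slope G G' (show r1/2 < r1 by linarith [hr1.1])
      (fun r hr => (dG r (hsub r hr)).continuousAt.continuousWithinAt) (fun r hr => dG r (hsub r (Ioo_subset_Icc_self hr)))
    refine ⟨r, Ioo_subset_Icc_self hr, ?_⟩
    have hr' := hsub r (Ioo_subset_Icc_self hr)
    have h2 := hlow r hr'
    rw [he] at h2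
    have h3 : G r1 ≤ G δ := hmono hr1' hδ h1.le
    have h4 : m ≤ G (r1/2) := csInf_le hbdd ⟨_, hr2', rfl⟩
    have h5 : G r1 - G (r1/2) ≤ ε := by linarith
    have hr1p := hr1.1
    have e : r1 - r1/2 = r1/2 := by ring
    rw [e, le_div_iff₀ (by linarith)] at h2
    have e2 : 2 / r * q r * (r1/2) = q r * (r1 / r) := by field_simp
    rw [e2] at h2
    have h6 : 1 ≤ r1 / r := by rw [le_div_iff₀ hr'.1]; linarith [hr.2]
    have := hq r hr'
    nlinarith

lemma quad {f g h : ℝ → ℝ} (hf : MemLp f 2 gam) (hg : MemLp g 2 gam) (hh : MemLp h 2 gam) (α β : ℝ) :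
    ∫ x, (f x + α * g x + β * h x)^2 ∂gam = ∫ x, f x^2 ∂gam + α^2 * ∫ x, g x^2 ∂gam + β^2 * ∫ x, h x^2 ∂gam
      + 2 * α * ∫ x, g x * f x ∂gam + 2 * β * ∫ x, h x * f x ∂gam + 2 * α * β * ∫ x, h x * g x ∂gam := by
  have i1 : Integrable (fun x => f x^2) gam := hf.integrable_sq
  have i2 : Integrable (fun x => α^2 * g x^2) gam := hg.integrable_sq.const_mul _
  have i3 : Integrable (fun x => β^2 * h x^2) gam := hh.integrable_sq.const_mul _
  have i4 : Integrable (fun x => 2 * α * (g x * f x)) gam := (hg.integrable_mul hf).const_mul _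
  have i5 : Integrable (fun x => 2 * β * (h x * f x)) gam := (hh.integrable_mul hf).const_mul _
  have i6 : Integrable (fun x => 2 * α * β * (h x * g x)) gam := (hh.integrable_mul hg).const_mul _
  have j1 : Integrable (fun x => f x^2 + α^2 * g x^2) gam := i1.add i2
  have j2 : Integrable (fun x => f x^2 + α^2 * g x^2 + β^2 * h x^2) gam := j1.add i3
  have j3 : Integrable (fun x => f x^2 + α^2 * g x^2 + β^2 * h x^2 + 2 * α * (g x * f x)) gam := j2.add i4
  have j4 : Integrable (fun x => f x^2 + α^2 * g x^2 + β^2 * h x^2 + 2 * α * (g x * f x) + 2 * β * (h x * f x)) gam := j3.add i5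
  have e : ∀ x, (f x + α * g x + β * h x)^2 = f x^2 + α^2 * g x^2 + β^2 * h x^2 + 2 * α * (g x * f x) + 2 * β * (h x * f x)
    + 2 * α * β * (h x * g x) := fun x => by ring
  simp_rw [e]
  rw [integral_add j4 i6, integral_add j3 i5, integral_add j2 i4, integral_add j1 i3, integral_add i1 i2]
  simp only [integral_const_mul]

lemma freq_core {w w1 w2 f : ℝ → ℝ} {C : ℝ} (h : CS2 w w1 w2 C) (hf : MemLp f 2 gam)
    {Hh D ff Vw VL : ℝ} (eH : Hh = ∫ x, w x^2 ∂gam) (eD : D = ∫ x, w1 x^2 ∂gam) (eff : ff = ∫ x, f x^2 ∂gam)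
    (eVw : Vw = ∫ x, w x * (-(w2 x - x * w1 x) + f x) ∂gam)
    (eVL : VL = ∫ x, (-(w2 x - x * w1 x) + f x) * (w2 x - x * w1 x) ∂gam) (hH : 0 < Hh) :
    ∃ q l, 0 ≤ q ∧ ∫ x, (w2 x - x * w1 x + l * w x)^2 ∂gam ≤ 2 * q * Hh + ff / 2 ∧
      |l| ≤ D / Hh + (1 + ff / Hh) / 4 ∧
      q - ff / (4 * Hh) ≤ (- VL * Hh - D * Vw) / Hh^2 := by
  have hL : MemLp (fun x => w2 x - x * w1 x) 2 gam := by simpa using h.memL 0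
  have hw := h.mem0
  set L : ℝ → ℝ := fun x => w2 x - x * w1 x with hLd
  have hD : ∫ x, w x * L x ∂gam = - D := by
    have := h.ibp h.d1 h.c1
    rw [eD]; simp_rw [pow_two]; rw [← this]
    congr 1; ext x; simp only [hLd]; ring
  have k1 : Integrable (fun x => w x * L x) gam := hw.integrable_mul hL
  have k2 : Integrable (fun x => w x * f x) gam := hw.integrable_mul hf
  have k3 : Integrable (fun x => L x^2) gam := hL.integrable_sq
  have k4 : Integrable (fun x => f x * L x) gam := hf.integrable_mul hL
  set e := ∫ x, w x * f x ∂gam with he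
  set g := ∫ x, f x * L x ∂gam with hg
  set a := ∫ x, L x^2 ∂gam with ha
  have hVw : Vw = D + e := by
    have e1 : ∀ x, w x * (-(w2 x - x * w1 x) + f x) = w x * f x - w x * L x := fun x => by simp only [hLd]; ring
    rw [eVw]; simp_rw [e1]; rw [integral_sub k2 k1, hD]; ring
  have hVL : VL = g - a := by
    have e1 : ∀ x, (-(w2 x - x * w1 x) + f x) * (w2 x - x * w1 x) = f x * L x - L x^2 := fun x => by simp only [hLd]; ring
    rw [eVL]; simp_rw [e1]; rw [integral_sub k4 k3]
  have hq := fun α β => quad hL hf hw α β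
  rw [hD, ← he, ← hg, ← ha, ← eff, ← eH] at hq
  set l := (D + e / 2) / Hh with hl
  have hlH : l * Hh = D + e / 2 := by rw [hl]; field_simp
  have D0 : 0 ≤ D := by rw [eD]; exact integral_nonneg fun x => sq_nonneg _
  have f0 : 0 ≤ ff := by rw [eff]; exact integral_nonneg fun x => sq_nonneg _
  set q := ((a - g + ff / 4) - l^2 * Hh) / Hh with hqd
  have hqH : q * Hh = (a - g + ff / 4) - l^2 * Hh := by rw [hqd]; field_simp
  refine ⟨q, l, ?_, ?_, ?_, ?_⟩
  · have h1 := hq (-1/2) l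
    have h2 : 0 ≤ ∫ x, (L x + (-1/2) * f x + l * w x)^2 ∂gam := integral_nonneg fun x => sq_nonneg _
    refine div_nonneg ?_ hH.le
    rw [h1] at h2
    linear_combination h2 + 2 * l * hlH
  · have h1 := hq (-1) l
    have h2 : 0 ≤ ∫ x, (L x + (-1) * f x + l * w x)^2 ∂gam := integral_nonneg fun x => sq_nonneg _
    have h3 := hq 0 l
    simp only [zero_mul, add_zero] at h3
    rw [h3]
    rw [h1] at h2
    linear_combination h2 - 2 * hqH + 4 * l * hlH
  · have h1 := gam_cs hw hf
    rw [← he, ← eH, ← eff] at h1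
    have h2 : |e| ≤ (Hh + ff) / 2 := by
      refine abs_le_of_sq_le_sq ?_ (by positivity)
      nlinarith [sq_nonneg (Hh - ff)]
    rw [hl, abs_div, abs_of_pos hH, div_le_iff₀ hH]
    have : (D / Hh + (1 + ff / Hh) / 4) * Hh = D + (Hh + ff) / 4 := by field_simp
    rw [this]
    have h4 := abs_add_le D (e/2)
    rw [abs_div, abs_of_nonneg D0, abs_two] at h4
    linarith
  · rw [le_div_iff₀ (by positivity), hVw, hVL]
    have : (q - ff / (4 * Hh)) * Hh^2 = q * Hh * Hh - ff * Hh / 4 := by field_simp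
    rw [this, hqH]
    have e5 : (a - g + ff / 4 - l^2 * Hh) * Hh = (a - g + ff/4) * Hh - (l * Hh)^2 := by ring
    rw [e5, hlH]
    nlinarith [sq_nonneg e]

noncomputable def hH (U : ℝ → ℝ → ℝ) (r : ℝ) : ℝ := ∫ ξ, U (√2 * r * ξ) (r^2) ^ 2 ∂gam
noncomputable def hD (Uy : ℝ → ℝ → ℝ) (r : ℝ) : ℝ := ∫ ξ, (√2 * r * Uy (√2 * r * ξ) (r^2)) ^ 2 ∂gam

namespace HI
variable {U Uy Uyy Uh : ℝ → ℝ → ℝ} {R K M ρ : ℝ}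

lemma sq_lt {r : ℝ} (h : r ∈ Ioo 0 ρ) : |r^2| < ρ^2 := by
  rw [abs_of_nonneg (sq_nonneg r)]
  exact pow_lt_pow_left₀ h.2 h.1.le two_ne_zero

lemma cs (H : HI U Uy Uyy Uh R K M ρ) {r : ℝ} (hr : r ∈ Ioo 0 ρ) :
    CS2 (fun ξ => U (√2 * r * ξ) (r^2)) (fun ξ => √2 * r * Uy (√2 * r * ξ) (r^2))
      (fun ξ => 2 * r^2 * Uyy (√2 * r * ξ) (r^2)) (R / (√2 * r)) := by
  have r0 := hr.1
  have := H.cs2 (sq_lt hr) 0 (σ := √2 * r) (by positivity)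
  simpa [mul_pow] using this

lemma hd2 (s : ℝ) : HasDerivAt (fun s => √2 * s) √2 s := by simpa using (hasDerivAt_id s).const_mul √2
lemma hdk (s : ℝ) : HasDerivAt (fun s : ℝ => s^2) (2 * s) s := by simpa using hasDerivAt_pow 2 s

lemma V_eq (r ξ a b c : ℝ) : r * (a * (√2 * ξ) + b * (2 * r)) = -(2 * r^2 * c - ξ * (√2 * r * a)) + 2 * r^2 * (b + c) := by
  ring

lemma hH_deriv (H : HI U Uy Uyy Uh R K M ρ) {r : ℝ} (hr : r ∈ Ioo 0 ρ) :
    HasDerivAt (hH U) (2 / r * ∫ ξ, U (√2 * r * ξ) (r^2) *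
      (-(2 * r^2 * Uyy (√2 * r * ξ) (r^2) - ξ * (√2 * r * Uy (√2 * r * ξ) (r^2))) +
        2 * r^2 * (Uh (√2 * r * ξ) (r^2) + Uyy (√2 * r * ξ) (r^2))) ∂gam) r := by
  have h := H.deriv_int (σ := fun s => √2 * s) (k := fun s => s^2) (σ' := fun _ => √2) (k' := fun s => 2 * s)
    (a := 0) (b := ρ) (B := max √2 (2 * ρ)) (s0 := r) 0 (φ := fun z => z^2) (φ' := fun z => 2 * z) hdk (by fun_prop) hr
    (fun s hs => sq_lt hs) (fun s _ => hd2 s) (fun s _ => hdk s)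
    (fun s _ => by rw [abs_of_nonneg (by positivity)]; exact le_max_left _ _)
    (fun s hs => by rw [abs_of_nonneg (by linarith [hs.1])]; exact le_trans (by linarith [hs.2]) (le_max_right _ _))
  simp only [zero_add] at h
  refine h.congr_deriv ?_
  have r0 := hr.1
  rw [← integral_const_mul]
  congr 1; ext ξ
  rw [← V_eq]; field_simp

lemma hD_deriv (H : HI U Uy Uyy Uh R K M ρ) {r : ℝ} (hr : r ∈ Ioo 0 ρ) :
    HasDerivAt (hD Uy) (-(2 / r * ∫ ξ, (-(2 * r^2 * Uyy (√2 * r * ξ) (r^2) - ξ * (√2 * r * Uy (√2 * r * ξ) (r^2))) +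
        2 * r^2 * (Uh (√2 * r * ξ) (r^2) + Uyy (√2 * r * ξ) (r^2))) *
        (2 * r^2 * Uyy (√2 * r * ξ) (r^2) - ξ * (√2 * r * Uy (√2 * r * ξ) (r^2))) ∂gam)) r := by
  have K0 := H.Kp
  have ρ0 := H.ρp
  have s2 : √2 ≤ 2 := by
    rw [Real.sqrt_le_left (by norm_num)]; norm_num
  have h := D_deriv (w := fun r ξ => U (√2 * r * ξ) (r^2)) (w1 := fun r ξ => √2 * r * Uy (√2 * r * ξ) (r^2))
    (w2 := fun r ξ => 2 * r^2 * Uyy (√2 * r * ξ) (r^2)) (wr := fun r ξ => Uy (√2 * r * ξ) (r^2) * (√2 * ξ) + Uh (√2 * r * ξ) (r^2) * (2 * r))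
    (C := fun r => R / (√2 * r)) (a := 0) (b := ρ) (B := K * (2 + 2 * ρ + 2 * ρ^2)) (r := r) hr (fun s hs => H.cs hs) ?_ ?_ ?_ ?_
  · refine h.congr_deriv ?_
    have r0 := hr.1
    rw [← integral_const_mul, ← integral_const_mul]
    congr 2; ext ξ
    rw [← V_eq]; field_simp
  · intro s hs ξ
    have := H.curve (σ := fun s => √2 * s) (k := fun s => s^2) 0 ξ (sq_lt hs) (hd2 s) (hdk s)
    simpa only [zero_add] using this
  · intro s hs ξ
    have e1 := H.b1 (√2 * s * ξ) _ (sq_lt hs)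
    have e2 := H.bh (√2 * s * ξ) _ (sq_lt hs)
    have s0 := hs.1
    refine (abs_add_le _ _).trans ?_
    rw [abs_mul, abs_mul, abs_mul, abs_of_pos (show 0 < √2 by positivity), abs_of_pos (show 0 < 2 * s by positivity)]
    have hsρ := hs.2.le
    calc _ ≤ K * (2 * |ξ|) + K * (2 * ρ) := by gcongr
      _ ≤ _ := by nlinarith [abs_nonneg ξ, mul_nonneg K0.le (abs_nonneg ξ), mul_pos K0 ρ0, mul_nonneg (mul_pos K0 ρ0).le (abs_nonneg ξ),
                    mul_pos (mul_pos K0 ρ0) ρ0, mul_nonneg (mul_pos (mul_pos K0 ρ0) ρ0).le (abs_nonneg ξ)]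
  · intro s hs ξ
    have e1 := H.b1 (√2 * s * ξ) _ (sq_lt hs)
    have e2 := H.b2 (√2 * s * ξ) _ (sq_lt hs)
    have s0 := hs.1
    refine (abs_sub _ _).trans ?_
    rw [abs_mul, abs_mul ξ, abs_mul (√2 * s), abs_of_pos (show 0 < √2 * s by positivity), abs_of_pos (show 0 < 2 * s^2 by positivity)]
    have hsρ := hs.2.le
    calc _ ≤ (2 * ρ^2) * K + |ξ| * ((2 * ρ) * K) := by gcongr
      _ ≤ _ := by nlinarith [abs_nonneg ξ, mul_nonneg K0.le (abs_nonneg ξ), mul_pos K0 ρ0, mul_nonneg (mul_pos K0 ρ0).le (abs_nonneg ξ),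
                    mul_pos (mul_pos K0 ρ0) ρ0, mul_nonneg (mul_pos (mul_pos K0 ρ0) ρ0).le (abs_nonneg ξ)]
  · intro ξ
    have c1 : ContinuousAt (fun s => Uy (√2 * s * ξ) (s^2)) r :=
      ContinuousAt.comp (f := fun s : ℝ => (√2 * s * ξ, s^2)) (H.c1 _ _ (sq_lt hr)) (by fun_prop)
    have c2 : ContinuousAt (fun s => Uyy (√2 * s * ξ) (s^2)) r :=
      ContinuousAt.comp (f := fun s : ℝ => (√2 * s * ξ, s^2)) (H.c2 _ _ (sq_lt hr)) (by fun_prop)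
    exact ((by fun_prop : ContinuousAt (fun s : ℝ => 2 * s^2) r).mul c2).sub
      (continuousAt_const.mul ((by fun_prop : ContinuousAt (fun s : ℝ => √2 * s) r).mul c1))

lemma freq_step (H : HI U Uy Uyy Uh R K M ρ) {r : ℝ} (hr : r ∈ Ioo 0 ρ) (hr1 : r ≤ 1)
    (hlow : Real.exp (-(R^2/(16*r^2))) ≤ hH U r) :
    ∃ N' q l, HasDerivAt (fun r => hD Uy r / hH U r) N' r ∧ 0 ≤ q ∧
      2 / r * q - (12 * M^2 + 24 * K^2) / 2 * r * (1 + hD Uy r / hH U r) ≤ N' ∧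
      ∫ ξ, (2 * r^2 * Uyy (√2 * r * ξ) (r^2) - ξ * (√2 * r * Uy (√2 * r * ξ) (r^2)) + l * U (√2 * r * ξ) (r^2))^2 ∂gam ≤
        (2 * q + (12 * M^2 + 24 * K^2) / 2 * r^2 * (1 + hD Uy r / hH U r)) * hH U r ∧
      |l| ≤ hD Uy r / hH U r + (1 + (12 * M^2 + 24 * K^2) * (1 + hD Uy r / hH U r)) / 4 := by
  have r0 := hr.1
  have Hp : 0 < hH U r := lt_of_lt_of_le (Real.exp_pos _) hlow
  have D0 : 0 ≤ hD Uy r := integral_nonneg fun x => sq_nonneg _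
  have c2 := H.cy2 (sq_lt hr)
  have c3 := H.ch _ (sq_lt hr)
  obtain ⟨i1, i2⟩ := H.F_sq (sq_lt hr) (σ := √2 * r) (by positivity)
  have hf : MemLp (fun ξ => 2 * r^2 * (Uh (√2 * r * ξ) (r^2) + Uyy (√2 * r * ξ) (r^2))) 2 gam := by
    refine (memLp_two_iff_integrable_sq (by fun_prop)).2 ?_
    simp_rw [mul_pow (2 * r^2)]
    exact i1.const_mul _
  obtain ⟨q, l, q0, h1, h2, h3⟩ := freq_core (H.cs hr) hf (Hh := hH U r) (D := hD Uy r) rfl rfl rfl rfl rfl Hp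
  set ff := ∫ ξ, (2 * r^2 * (Uh (√2 * r * ξ) (r^2) + Uyy (√2 * r * ξ) (r^2)))^2 ∂gam with hff
  have hN : 0 ≤ hD Uy r / hH U r := by positivity
  set C0 := 12 * M^2 + 24 * K^2 with hC0
  have ffb : ff ≤ C0 * r^2 * (hH U r + hD Uy r) := by
    rw [hff]; simp_rw [mul_pow (2 * r^2)]; rw [integral_const_mul]
    have e1 : hD Uy r = 2 * r^2 * ∫ ξ, Uy (√2 * r * ξ) (r^2)^2 ∂gam := by
      unfold hD; simp_rw [mul_pow (√2 * r)]; rw [integral_const_mul, mul_pow, Real.sq_sqrt (by norm_num)]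
    have e2 : 8 * (√2 * r)^2 = 16 * r^2 := by rw [mul_pow, Real.sq_sqrt (by norm_num)]; ring
    rw [e2] at i2
    change _ ≤ 3 * M^2 * (hH U r + _) + _ at i2
    set Y := ∫ ξ, Uy (√2 * r * ξ) (r^2)^2 ∂gam with hY
    have Y0 : 0 ≤ Y := integral_nonneg fun x => sq_nonneg _
    have i3 := i2.trans (add_le_add le_rfl (mul_le_mul_of_nonneg_left hlow (by positivity : (0:ℝ) ≤ 6 * K^2)))
    have r2 : r^2 ≤ 1 := by nlinarith
    have hM := sq_nonneg M
    have hK := sq_nonneg K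
    calc (2 * r^2)^2 * _ ≤ (2 * r^2)^2 * (3 * M^2 * (hH U r + Y) + 6 * K^2 * hH U r) := by gcongr
      _ = r^2 * (r^2 * (12 * M^2 * hH U r + 24 * K^2 * hH U r)) + r^2 * (6 * M^2 * (2 * r^2 * Y)) := by ring
      _ ≤ r^2 * (1 * (12 * M^2 * hH U r + 24 * K^2 * hH U r)) + r^2 * ((12 * M^2 + 24 * K^2) * (2 * r^2 * Y)) := by
        gcongr
        nlinarith
      _ = _ := by rw [e1, hC0]; ring
  have ffb2 : ff / hH U r ≤ C0 * r^2 * (1 + hD Uy r / hH U r) := by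
    rw [div_le_iff₀ Hp]
    have : C0 * r^2 * (1 + hD Uy r / hH U r) * hH U r = C0 * r^2 * (hH U r + hD Uy r) := by field_simp
    rw [this]; exact ffb
  refine ⟨_, q, l, (H.hD_deriv hr).fun_div (H.hH_deriv hr) Hp.ne', q0, ?_, ?_, ?_⟩
  · set VL := ∫ ξ, (-(2 * r^2 * Uyy (√2 * r * ξ) (r^2) - ξ * (√2 * r * Uy (√2 * r * ξ) (r^2))) +
        2 * r^2 * (Uh (√2 * r * ξ) (r^2) + Uyy (√2 * r * ξ) (r^2))) *
        (2 * r^2 * Uyy (√2 * r * ξ) (r^2) - ξ * (√2 * r * Uy (√2 * r * ξ) (r^2))) ∂gam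
    set Vw := ∫ ξ, U (√2 * r * ξ) (r^2) *
      (-(2 * r^2 * Uyy (√2 * r * ξ) (r^2) - ξ * (√2 * r * Uy (√2 * r * ξ) (r^2))) +
        2 * r^2 * (Uh (√2 * r * ξ) (r^2) + Uyy (√2 * r * ξ) (r^2))) ∂gam
    have e : (-(2 / r * VL) * hH U r - hD Uy r * (2 / r * Vw)) / hH U r ^ 2 = 2 / r * ((-VL * hH U r - hD Uy r * Vw) / hH U r^2) := by
      ring
    rw [e]
    have h4 := mul_le_mul_of_nonneg_left h3 (by positivity : 0 ≤ 2 / r)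
    refine le_trans ?_ h4
    have e2 : 2 / r * (q - ff / (4 * hH U r)) = 2 / r * q - (ff / hH U r) / (2 * r) := by field_simp; ring
    rw [e2]
    have : (ff / hH U r) / (2 * r) ≤ C0 * r^2 * (1 + hD Uy r / hH U r) / (2 * r) := by gcongr
    have e3 : C0 * r^2 * (1 + hD Uy r / hH U r) / (2 * r) = C0 / 2 * r * (1 + hD Uy r / hH U r) := by field_simp
    linarith
  · refine h1.trans ?_
    have : ff = ff / hH U r * hH U r := by field_simp
    have h5 := mul_le_mul_of_nonneg_right ffb2 Hp.le
    rw [← this] at h5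
    linarith
  · refine h2.trans ?_
    have r2 : r^2 ≤ 1 := by nlinarith
    have : C0 * r^2 * (1 + hD Uy r / hH U r) ≤ C0 * 1 * (1 + hD Uy r / hH U r) := by gcongr
    linarith

/-- frequency conclusion -/
lemma freq (H : HI U Uy Uyy Uh R K M ρ) {r0 : ℝ} (hr0 : 0 < r0)
    (hlow : ∀ r ∈ Ioo 0 r0, Real.exp (-(R^2/(16*r^2))) ≤ hH U r) :
    ∃ Λ, ∀ ε > 0, ∃ δ > 0, δ ≤ r0 ∧ ∀ r1 ∈ Ioo 0 δ, ∃ r ∈ Icc (r1/2) r1, ∃ l, |l| ≤ Λ ∧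
      ∫ ξ, (2 * r^2 * Uyy (√2 * r * ξ) (r^2) - ξ * (√2 * r * Uy (√2 * r * ξ) (r^2)) + l * U (√2 * r * ξ) (r^2))^2 ∂gam ≤
        ε^2 * hH U r := by
  set r' := min r0 (min ρ 1) with hr'
  have r'0 : 0 < r' := lt_min hr0 (lt_min H.ρp one_pos)
  have m1 : ∀ r ∈ Ioo 0 r', r ∈ Ioo 0 r0 := fun r hr => ⟨hr.1, hr.2.trans_le (min_le_left _ _)⟩
  have m2 : ∀ r ∈ Ioo 0 r', r ∈ Ioo 0 ρ := fun r hr => ⟨hr.1, hr.2.trans_le ((min_le_right _ _).trans (min_le_left _ _))⟩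
  have m3 : ∀ r ∈ Ioo 0 r', r ≤ 1 := fun r hr => (hr.2.trans_le ((min_le_right _ _).trans (min_le_right _ _))).le
  have step := fun r hr => H.freq_step (m2 r hr) (m3 r hr) (hlow r (m1 r hr))
  choose! N' q l hd q0 hi h1 h2 using step
  set C0 := 12 * M^2 + 24 * K^2 with hC0
  have C00 : 0 ≤ C0 := by positivity
  have hN : ∀ r, 0 ≤ hD Uy r / hH U r := fun r =>
    div_nonneg (integral_nonneg fun x => sq_nonneg _) (integral_nonneg fun x => sq_nonneg _)
  obtain ⟨⟨Λ, hΛ⟩, hm⟩ := mono_arg (N := fun r => hD Uy r / hH U r) C00 r'0 (fun r _ => hN r) hd q0 hi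
  refine ⟨Λ + (1 + C0 * (1 + Λ)) / 4, fun ε hε => ?_⟩
  obtain ⟨δ, δ0, δ1, hδ⟩ := hm (ε^2/4) (by positivity)
  have Λ0 : 0 ≤ Λ := (hN (r'/4)).trans (hΛ (r'/4) ⟨by linarith, by linarith⟩)
  set d := ε / (C0 * (1 + Λ) + 1) with hd'
  have d0 : 0 < d := by positivity
  refine ⟨min δ (min d 1), lt_min δ0 (lt_min d0 one_pos), (min_le_left _ _).trans (δ1.trans (by linarith [min_le_left r0 (min ρ 1)])), ?_⟩
  intro r1 hr1
  have k1 : r1 < δ := hr1.2.trans_le (min_le_left _ _)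
  have k2 : r1 < d := hr1.2.trans_le ((min_le_right _ _).trans (min_le_left _ _))
  obtain ⟨r, hr, hq⟩ := hδ r1 ⟨hr1.1, k1⟩
  have r1p := hr1.1
  have hrp : 0 < r := by linarith [hr.1]
  have hrd : r < d := lt_of_le_of_lt hr.2 k2
  have hrr : r ∈ Ioo 0 (r'/2) := ⟨hrp, by linarith [hr.2]⟩
  have hr' : r ∈ Ioo 0 r' := ⟨hrp, by linarith [hrr.2]⟩
  have hNr := hΛ r hrr
  refine ⟨r, hr, l r, (h2 r hr').trans (by gcongr), (h1 r hr').trans ?_⟩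
  refine mul_le_mul_of_nonneg_right ?_ (integral_nonneg fun x => sq_nonneg _)
  have e1 : C0 / 2 * r^2 * (1 + hD Uy r / hH U r) ≤ C0 / 2 * r^2 * (1 + Λ) := by gcongr
  have e2 : C0 * (1 + Λ) * r^2 ≤ ε^2 := by
    have e3 : (C0 * (1 + Λ) + 1) * d = ε := by rw [hd']; field_simp
    set c := C0 * (1 + Λ) with hc
    have c0 : 0 ≤ c := by positivity
    have e4 : r^2 ≤ d^2 := by gcongr
    rw [← e3]
    calc c * r^2 ≤ c * d^2 := by gcongr
      _ ≤ (c+1)^2 * d^2 := by gcongr; nlinarith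
      _ = _ := by ring
  nlinarith
end HI

lemma gam_subst (f : ℝ → ℝ) (x : ℝ) {s σ : ℝ} (hs : 0 < s) (hσ : 0 < σ) :
    ∫ ξ, f (x + s * ξ) * ((s / σ) * Real.exp (ξ^2/2 - (x + s * ξ)^2/(2*σ^2))) ∂gam = ∫ ζ, f (σ * ζ) ∂gam := by
  rw [gam_integral, gam_integral]
  set g : ℝ → ℝ := fun ζ => gaussianPDFReal 0 1 ζ * f (σ * ζ) with hg
  have e : ∀ ξ, gaussianPDFReal 0 1 ξ * (f (x + s * ξ) * ((s / σ) * Real.exp (ξ^2/2 - (x + s * ξ)^2/(2*σ^2)))) =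
      (s / σ) * g (x / σ + (s / σ) * ξ) := by
    intro ξ
    have e1 : σ * (x / σ + s / σ * ξ) = x + s * ξ := by field_simp
    simp only [hg, e1, gam_pdf]
    have e2 : Real.exp (-(x / σ + s / σ * ξ)^2/2) = Real.exp (-ξ^2/2) * Real.exp (ξ^2/2 - (x + s * ξ)^2/(2*σ^2)) := by
      rw [← Real.exp_add]; congr 1; field_simp; ring
    rw [e2]; ring
  simp_rw [e]
  rw [integral_const_mul]
  have h1 := Measure.integral_comp_mul_left (fun z => g (x / σ + z)) (s / σ)
  rw [h1, integral_add_left_eq_self g (x/σ), abs_of_pos (by positivity), smul_eq_mul]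
  field_simp

lemma gam_shift (f : ℝ → ℝ) (x : ℝ) {s : ℝ} (hs : 0 < s) :
    ∫ ξ, f (x + s * ξ) ∂gam = Real.exp (-(x/s)^2/2) * ∫ ζ, f (s * ζ) * Real.exp (x / s * ζ) ∂gam := by
  have := gam_subst (fun y => f y * Real.exp (x / s * (y / s)) * Real.exp (-(x/s)^2/2)) x hs hs
  rw [← integral_const_mul]
  trans ∫ ξ, f (x + s * ξ) * Real.exp (x / s * ((x + s * ξ) / s)) * Real.exp (-(x/s)^2/2) * ((s / s) * Real.exp (ξ^2/2 - (x + s * ξ)^2/(2*s^2))) ∂gam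
  · congr 1; ext ξ
    rw [div_self hs.ne', one_mul, mul_assoc, mul_assoc, ← Real.exp_add, ← Real.exp_add]
    have : x / s * ((x + s * ξ) / s) + (-(x/s)^2/2 + (ξ^2/2 - (x + s * ξ)^2/(2*s^2))) = 0 := by
      field_simp; ring
    rw [this]; simp
  · rw [this]; congr 1; ext ζ
    rw [mul_div_cancel_left₀ _ hs.ne']; ring

lemma gam_int_quarter : Integrable (fun ξ : ℝ => Real.exp (ξ^2/4)) gam := by
  rw [gam, gaussianReal_of_var_ne_zero 0 one_ne_zero]
  rw [integrable_withDensity_iff (measurable_gaussianPDF 0 1) (ae_of_all _ fun x => gaussianPDF_lt_top)]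
  have h := (integrable_exp_neg_mul_sq (b := 1/4) (by norm_num)).const_mul ((Real.sqrt (2 * Real.pi))⁻¹)
  refine h.congr (ae_of_all _ fun x => ?_)
  simp only [toReal_gaussianPDF, gam_pdf]
  rw [mul_comm (Real.exp (x^2/4)), mul_assoc, ← Real.exp_add]
  congr 2; ring

lemma gam_lower {f : ℝ → ℝ} (hf : Integrable f gam) (h0 : ∀ x, 0 ≤ f x) {a b m A : ℝ} (hab : a ≤ b)
    (hm : 0 ≤ m) (hA : ∀ x ∈ Icc a b, x^2 ≤ A) (hfm : ∀ x ∈ Icc a b, m ≤ f x) :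
    (Real.sqrt (2 * Real.pi))⁻¹ * Real.exp (-A/2) * m * (b - a) ≤ ∫ x, f x ∂gam := by
  rw [gam_integral]
  have hi := gam_integrable hf
  have h1 : ∫ x in Icc a b, gaussianPDFReal 0 1 x * f x ≤ ∫ x, gaussianPDFReal 0 1 x * f x :=
    setIntegral_le_integral hi (ae_of_all _ fun x => mul_nonneg (gaussianPDFReal_nonneg 0 1 x) (h0 x))
  refine le_trans ?_ h1
  have h2 := setIntegral_ge_of_const_le_real (μ := volume) (s := Icc a b) (f := fun x => gaussianPDFReal 0 1 x * f x)
    (c := (Real.sqrt (2 * Real.pi))⁻¹ * Real.exp (-A/2) * m) measurableSet_Icc (by simp) (fun x hx => ?_) hi.integrableOn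
  · simpa [hab] using h2
  · rw [gam_pdf]
    have := hA x hx
    have := hfm x hx
    gcongr

namespace HI
variable {U Uy Uyy Uh : ℝ → ℝ → ℝ} {R K M ρ : ℝ}

/-- if the energy is super-exponentially small along a sequence, then `U(.,0)` vanishes near zero -/
lemma vanish (H : HI U Uy Uyy Uh R K M ρ)
    (hs : ∀ r0 > 0, ∃ r ∈ Ioo 0 r0, hH U r < Real.exp (-(R^2/(16*r^2)))) :
    ∀ y, |y| < R / 4 → U y 0 = 0 := by
  intro y0 hy0
  by_contra hne
  have ρ0 := H.ρp
  have hρ : |(0:ℝ)| < ρ^2 := by simp; positivity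
  set m := |U y0 0| / 2 with hm
  have m0 : 0 < m := by have := abs_pos.2 hne; positivity
  have hc := H.c0 y0 0 hρ
  have hev : ∀ᶠ z : ℝ × ℝ in 𝓝 (y0, 0), m < |U z.1 z.2| :=
    hc.abs.eventually (lt_mem_nhds (by simp only [hm]; linarith [abs_pos.2 hne]))
  obtain ⟨d, d0, hd⟩ := Metric.eventually_nhds_iff.1 hev
  set d' := min (d/2) (R/4 - |y0|) with hd'
  have d'0 : 0 < d' := lt_min (by linarith) (by linarith)
  set c := (Real.sqrt (2 * Real.pi))⁻¹ with hcc
  have c0 : 0 < c := by positivity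
  obtain ⟨r, hr, hlt⟩ := hs (min ρ (min (min 1 d) (c * m^2 * d'))) (lt_min ρ0 (lt_min (lt_min one_pos d0) (by positivity)))
  have r0 := hr.1
  have hr1 : r < ρ := hr.2.trans_le (min_le_left _ _)
  have hr2 : r < 1 := hr.2.trans_le ((min_le_right _ _).trans ((min_le_left _ _).trans (min_le_left _ _)))
  have hr3 : r < d := hr.2.trans_le ((min_le_right _ _).trans ((min_le_left _ _).trans (min_le_right _ _)))
  have hr4 : r < c * m^2 * d' := hr.2.trans_le ((min_le_right _ _).trans (min_le_right _ _))
  set s := √2 * r with hsd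
  have s0 : 0 < s := by positivity
  have s2 : s^2 = 2 * r^2 := by rw [hsd, mul_pow, Real.sq_sqrt (by norm_num)]
  have hcont := (H.cs ⟨r0, hr1⟩).mem0.integrable_sq
  have hb : ∀ x ∈ Icc ((y0 - d')/s) ((y0 + d')/s), |s * x - y0| ≤ d' := by
    intro x hx
    have h1 := hx.1
    have h2 := hx.2
    rw [div_le_iff₀ s0] at h1
    rw [le_div_iff₀ s0] at h2
    rw [abs_le]; constructor <;> linarith
  have hd1 : d' ≤ d/2 := min_le_left _ _
  have hd2 : d' ≤ R/4 - |y0| := min_le_right _ _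
  have hR := H.Rp
  have h := gam_lower hcont (fun x => sq_nonneg _) (a := (y0 - d')/s) (b := (y0 + d')/s) (m := m^2) (A := (R/4)^2/s^2)
    (by gcongr; linarith) (by positivity) (fun x hx => by
      rw [le_div_iff₀ (by positivity), ← mul_pow, ← sq_abs]
      have h1 := hb x hx
      have h2 := abs_sub_abs_le_abs_sub (s * x) y0
      rw [mul_comm x s]
      gcongr; linarith) (fun x hx => by
      have h1 := hb x hx
      have : m < |U (s * x) (r^2)| := hd (y := (s * x, r^2)) (by
        rw [Prod.dist_eq]; simp only [Real.dist_eq]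
        apply max_lt
        · linarith
        · rw [sub_zero, abs_of_pos (by positivity)]; nlinarith)
      show m^2 ≤ (U (s * x) (r^2))^2
      rw [← sq_abs (U _ _)]; gcongr)
  have h3 := lt_of_le_of_lt h hlt
  have e1 : (y0 + d')/s - (y0 - d')/s = 2 * d' / s := by field_simp; ring
  rw [e1, ← hcc, s2] at h3
  have e2 : Real.exp (-(R^2/(16*r^2))) ≤ Real.exp (-((R/4)^2/(2*r^2))/2) := by
    apply Real.exp_le_exp.2
    have : -((R/4)^2/(2*r^2))/2 = -(R^2/(64*r^2)) := by field_simp; ring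
    rw [this, neg_le_neg_iff]
    gcongr; norm_num
  have h4 := lt_of_lt_of_le h3 e2
  have e3 : c * Real.exp (-((R/4)^2/(2*r^2))/2) * m^2 * (2 * d' / s) = Real.exp (-((R/4)^2/(2*r^2))/2) * (c * m^2 * d' * (2 / s)) := by ring
  rw [e3] at h4
  have h5 : 1 ≤ c * m^2 * d' * (2 / s) := by
    have : √2 ≤ 2 := by rw [Real.sqrt_le_left (by norm_num)]; norm_num
    have h6 : s ≤ 2 * r := by rw [hsd]; gcongr
    have : c * m^2 * d' * (2 / s) = 2 * (c * m^2 * d') / s := by ring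
    rw [this, le_div_iff₀ s0]; linarith
  have := Real.exp_pos (-((R/4)^2/(2*r^2))/2)
  nlinarith
end HI

namespace HI
variable {U Uy Uyy Uh : ℝ → ℝ → ℝ} {R K M ρ : ℝ}

lemma sh (H : HI U Uy Uyy Uh R K M ρ) {y h : ℝ} (hh : |h| < ρ^2) (hy : R ≤ |y|) : Uh y h = 0 := by
  have h1 := H.dh y h hh
  have h2 : HasDerivAt (fun k => U y k) 0 h := by
    refine (hasDerivAt_const h (0:ℝ)).congr_of_eventuallyEq ?_
    have : ContinuousAt (fun z : ℝ => |z|) h := by fun_prop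
    filter_upwards [this.eventually_lt continuousAt_const hh] with k hk
    exact H.s0 y k hk hy
  exact h1.unique h2

/-- energy quantities -/
noncomputable def sg (b r : ℝ) : ℝ := √((b^2 + 3 * r^2) / 2)
noncomputable def eE (U : ℝ → ℝ → ℝ) (b r : ℝ) : ℝ := ∫ ξ, U (sg b r * ξ) (r^2) ^ 2 ∂gam
noncomputable def jJ (U : ℝ → ℝ → ℝ) (x r : ℝ) : ℝ := ∫ ξ, U (x + √2 * r * ξ) (r^2) ∂gam

lemma sg_pos {b r : ℝ} (hb : 0 < b) : 0 < sg b r := Real.sqrt_pos.2 (by positivity)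
lemma sg_sq {b r : ℝ} : sg b r^2 = (b^2 + 3 * r^2)/2 := Real.sq_sqrt (by positivity)
lemma sg_self {b : ℝ} (hb : 0 < b) : sg b b = √2 * b := by
  rw [sg, show (b^2 + 3 * b^2)/2 = 2 * b^2 by ring, Real.sqrt_mul (by norm_num), Real.sqrt_sq hb.le]
lemma sg_le {b r : ℝ} (hb : 0 < b) (hr : 0 < r) (hrb : r ≤ b) : sg b r ≤ √2 * b := by
  rw [← sg_self hb]; unfold sg
  apply Real.sqrt_le_sqrt; gcongr
lemma sg_ge {b r : ℝ} : r ≤ sg b r := by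
  rw [sg]; apply Real.le_sqrt_of_sq_le; nlinarith [sq_nonneg b, sq_nonneg r]
lemma sg_deriv {b : ℝ} (hb : 0 < b) (r : ℝ) : HasDerivAt (sg b) (3 * r / (2 * sg b r)) r := by
  have h1 : HasDerivAt (fun r : ℝ => (b^2 + 3 * r^2)/2) (3 * r) r := by
    have := (((hdk r).const_mul 3).const_add (b^2)).div_const 2
    refine this.congr_deriv (by ring)
  exact h1.sqrt (by positivity)

lemma hardy {w w1 w2 : ℝ → ℝ} {C : ℝ} (h : CS2 w w1 w2 C) :
    (∫ x, w1 x^2 ∂gam) / 2 - (∫ x, w x^2 ∂gam) / 8 ≤ (∫ x, w1 x^2 ∂gam) - (∫ x, x * w x * w1 x ∂gam) / 4 := by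
  have c0 := h.c0
  have c1 := h.c1
  have i0 : Integrable (fun x => w x^2) gam := gam_int_cs (by fun_prop) (C := C) fun x hx => by simp [h.s0 x hx]
  have i1 : Integrable (fun x => w1 x^2) gam := gam_int_cs (by fun_prop) (C := C) fun x hx => by simp [h.s1 x hx]
  have i2 : Integrable (fun x => x * w x * w1 x) gam := gam_int_cs (by fun_prop) (C := C) fun x hx => by simp [h.s1 x hx]
  have i3 : Integrable (fun x => x * (x * w x^2)) gam := gam_int_cs (by fun_prop) (C := C) fun x hx => by simp [h.s0 x hx]
  have i4 : Integrable (fun x => x * w x^2) gam := gam_int_cs (by fun_prop) (C := C) fun x hx => by simp [h.s0 x hx]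
  have i2' := i2.const_mul 2
  have st := gam_stein (φ := fun x => x * w x^2) (φ' := fun x => w x^2 + 2 * (x * w x * w1 x))
    (fun x => by
      have := (hasDerivAt_id x).fun_mul ((h.d1 x).fun_pow 2)
      refine this.congr_deriv ?_
      simp; ring) i4 (i0.add i2') i3
  rw [integral_add i0 i2', integral_const_mul] at st
  have k1 : 0 ≤ ∫ x, (1/8 * (x * (x * w x^2)) - 1/2 * (x * w x * w1 x) + 1/2 * w1 x^2) ∂gam :=
    integral_nonneg fun x => by
      show 0 ≤ 1/8 * (x * (x * w x^2)) - 1/2 * (x * w x * w1 x) + 1/2 * w1 x^2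
      nlinarith [sq_nonneg (x * w x - 2 * w1 x)]
  have i5 : Integrable (fun x => 1/8 * (x * (x * w x^2)) - 1/2 * (x * w x * w1 x)) gam := (i3.const_mul _).sub (i2.const_mul _)
  rw [integral_add i5 (i1.const_mul _), integral_sub (i3.const_mul _) (i2.const_mul _)] at k1
  simp only [integral_const_mul] at k1
  linarith

set_option maxHeartbeats 1000000 in
lemma eE_deriv (H : HI U Uy Uyy Uh R K M ρ) {b r : ℝ} (hb : 0 < b) (hr : r ∈ Ioo 0 ρ) (hrb : r ≤ b) (hb1 : b ≤ 1)
    (hlow : Real.exp (-(R^2/(16*b^2))) ≤ hH U b) :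
    ∃ E' Y, HasDerivAt (eE U b) E' r ∧ 0 ≤ Y ∧
      (∫ ξ, (Uh (sg b r * ξ) (r^2) + Uyy (sg b r * ξ) (r^2))^2 ∂gam ≤ 3 * M^2 * (eE U b r + Y) + 6 * K^2 * hH U b) ∧
      r * Y - (12 * M^2 + 6) * r / b^2 * eE U b r - 6 * K^2 * r * hH U b ≤ E' := by
  have r0 := hr.1
  have hk := sq_lt hr
  set σ := sg b r with hσ
  have σ0 : 0 < σ := sg_pos hb
  have h := H.deriv_int (σ := sg b) (k := fun s => s^2) (σ' := fun s => 3 * s / (2 * sg b s)) (k' := fun s => 2 * s)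
    (a := 0) (b := ρ) (B := max (3/2) (2 * ρ)) (s0 := r) 0 (φ := fun z => z^2) (φ' := fun z => 2 * z) hdk (by fun_prop) hr
    (fun s hs => sq_lt hs) (fun s _ => sg_deriv hb s) (fun s _ => hdk s)
    (fun s hs => by
      have s0 := hs.1
      have := sg_pos (r := s) hb
      have := sg_ge (b := b) (r := s)
      rw [abs_of_nonneg (by positivity)]
      refine le_trans ?_ (le_max_left _ _)
      rw [div_le_iff₀ (by positivity)]; linarith)
    (fun s hs => by rw [abs_of_nonneg (by linarith [hs.1])]; exact le_trans (by linarith [hs.2]) (le_max_right _ _))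
  simp only [zero_add, ← hσ] at h
  set Y := ∫ ξ, Uy (σ * ξ) (r^2)^2 ∂gam with hY
  have Y0 : 0 ≤ Y := integral_nonneg fun x => sq_nonneg _
  obtain ⟨f1, f2⟩ := H.F_sq hk σ0
  have hE : eE U b r = ∫ ξ, U (σ * ξ) (r^2)^2 ∂gam := rfl
  have E0 : 0 ≤ eE U b r := integral_nonneg fun x => sq_nonneg _
  rw [← hY, ← hE] at f2
  have hσ1 : σ^2 ≤ 2 * b^2 := by
    rw [hσ, sg_sq]; nlinarith
  have hσ2 : b^2 / 2 ≤ σ^2 := by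
    rw [hσ, sg_sq]; nlinarith
  have tau : Real.exp (-(R^2/(8*σ^2))) ≤ hH U b := by
    refine le_trans ?_ hlow
    apply Real.exp_le_exp.2
    rw [neg_le_neg_iff]
    exact div_le_div_of_nonneg_left (by positivity) (by positivity) (by linarith)
  have f3 : ∫ ξ, (Uh (σ * ξ) (r^2) + Uyy (σ * ξ) (r^2))^2 ∂gam ≤ 3 * M^2 * (eE U b r + Y) + 6 * K^2 * hH U b := by
    refine f2.trans ?_
    gcongr
  refine ⟨_, Y, h, Y0, f3, ?_⟩
  set FF := ∫ ξ, (Uh (σ * ξ) (r^2) + Uyy (σ * ξ) (r^2))^2 ∂gam with hFF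
  have cs := H.cs2 hk 0 σ0
  simp only [zero_add] at cs
  have c0 := H.cy0 hk
  have c1 := H.cy1 hk
  have c2 := H.cy2 hk
  have c3 := H.ch _ hk
  have ib := cs.ibp cs.d1 cs.c1
  have hd := hardy cs
  have e1 : ∫ ξ, (σ * Uy (σ * ξ) (r^2))^2 ∂gam = σ^2 * Y := by
    simp_rw [mul_pow]; rw [integral_const_mul]
  have e2 : ∫ ξ, σ * Uy (σ * ξ) (r^2) * (σ * Uy (σ * ξ) (r^2)) ∂gam = σ^2 * Y := by
    rw [← e1]; congr 1; ext ξ; ring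
  set Q := ∫ ξ, ξ * U (σ * ξ) (r^2) * (σ * Uy (σ * ξ) (r^2)) ∂gam with hQ
  rw [e1, ← hE] at hd
  rw [e2] at ib
  set S := ∫ ξ, U (σ * ξ) (r^2) * (Uh (σ * ξ) (r^2) + Uyy (σ * ξ) (r^2)) ∂gam with hS
  have C := (R + |(0:ℝ)|) / σ
  have i1 : Integrable (fun ξ => ξ * U (σ * ξ) (r^2) * (σ * Uy (σ * ξ) (r^2))) gam :=
    gam_int_cs (by fun_prop) (C := (R + |(0:ℝ)|) / σ) fun x hx => by
      have := cs.s0 x hx; simp [this]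
  have i2 : Integrable (fun ξ => (σ^2 * Uyy (σ * ξ) (r^2) - ξ * (σ * Uy (σ * ξ) (r^2))) * U (σ * ξ) (r^2)) gam :=
    gam_int_cs (by fun_prop) (C := (R + |(0:ℝ)|) / σ) fun x hx => by
      have := cs.s0 x hx; simp [this]
  have i3 : Integrable (fun ξ => U (σ * ξ) (r^2) * (Uh (σ * ξ) (r^2) + Uyy (σ * ξ) (r^2))) gam :=
    gam_int_cs (by fun_prop) (C := (R + |(0:ℝ)|) / σ) fun x hx => by
      have := cs.s0 x hx; simp [this]
  have i4 : Integrable (fun ξ => U (σ * ξ) (r^2)^2) gam :=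
    gam_int_cs (by fun_prop) (C := (R + |(0:ℝ)|) / σ) fun x hx => by
      have := cs.s0 x hx; simp [this]
  have eq : ∫ ξ, 2 * U (σ * ξ) (r^2) * (Uy (σ * ξ) (r^2) * (3 * r / (2 * σ) * ξ) + Uh (σ * ξ) (r^2) * (2 * r)) ∂gam =
      4 * r / σ^2 * (σ^2 * Y - Q / 4) + 4 * r * S := by
    have e : ∀ ξ, 2 * U (σ * ξ) (r^2) * (Uy (σ * ξ) (r^2) * (3 * r / (2 * σ) * ξ) + Uh (σ * ξ) (r^2) * (2 * r)) =
      -(4 * r / σ^2) * ((σ^2 * Uyy (σ * ξ) (r^2) - ξ * (σ * Uy (σ * ξ) (r^2))) * U (σ * ξ) (r^2)) +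
      -(r / σ^2) * (ξ * U (σ * ξ) (r^2) * (σ * Uy (σ * ξ) (r^2))) +
      4 * r * (U (σ * ξ) (r^2) * (Uh (σ * ξ) (r^2) + Uyy (σ * ξ) (r^2))) := by
      intro ξ; field_simp; ring
    simp_rw [e]
    have i5 : Integrable (fun ξ => -(4 * r / σ^2) * ((σ^2 * Uyy (σ * ξ) (r^2) - ξ * (σ * Uy (σ * ξ) (r^2))) * U (σ * ξ) (r^2)) +
      -(r / σ^2) * (ξ * U (σ * ξ) (r^2) * (σ * Uy (σ * ξ) (r^2)))) gam := (i2.const_mul _).add (i1.const_mul _)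
    rw [integral_add i5 (i3.const_mul _), integral_add (i2.const_mul _) (i1.const_mul _)]
    simp only [integral_const_mul]
    rw [ib, ← hQ, ← hS]; field_simp; ring
  rw [eq]
  -- bound on S
  set c := 3 * M^2 + 1 with hc
  have cp : 0 < c := by positivity
  have hSb : - (4 * S) ≤ (1 / c) * FF + 4 * c * eE U b r := by
    have k : 0 ≤ ∫ ξ, ((1 / c) * (Uh (σ * ξ) (r^2) + Uyy (σ * ξ) (r^2))^2 + 4 * (U (σ * ξ) (r^2) * (Uh (σ * ξ) (r^2) + Uyy (σ * ξ) (r^2)))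
        + 4 * c * U (σ * ξ) (r^2)^2) ∂gam := by
      refine integral_nonneg fun ξ => ?_
      show 0 ≤ (1 / c) * (Uh (σ * ξ) (r^2) + Uyy (σ * ξ) (r^2))^2 + 4 * (U (σ * ξ) (r^2) * (Uh (σ * ξ) (r^2) + Uyy (σ * ξ) (r^2)))
        + 4 * c * U (σ * ξ) (r^2)^2
      have : (1 / c) * (Uh (σ * ξ) (r^2) + Uyy (σ * ξ) (r^2))^2 + 4 * (U (σ * ξ) (r^2) * (Uh (σ * ξ) (r^2) + Uyy (σ * ξ) (r^2)))
        + 4 * c * U (σ * ξ) (r^2)^2 = (1 / c) * ((Uh (σ * ξ) (r^2) + Uyy (σ * ξ) (r^2)) + 2 * c * U (σ * ξ) (r^2))^2 := by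
        field_simp; ring
      rw [this]; positivity
    have i6 : Integrable (fun ξ => (1 / c) * (Uh (σ * ξ) (r^2) + Uyy (σ * ξ) (r^2))^2 + 4 * (U (σ * ξ) (r^2) * (Uh (σ * ξ) (r^2) + Uyy (σ * ξ) (r^2)))) gam :=
      (f1.const_mul _).add (i3.const_mul _)
    rw [integral_add i6 (i4.const_mul _), integral_add (f1.const_mul _) (i3.const_mul _)] at k
    simp only [integral_const_mul] at k
    rw [← hFF, ← hS, ← hE] at k
    linarith
  have hFb : (1 / c) * FF ≤ eE U b r + Y + 6 * K^2 * hH U b := by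
    have hHn : 0 ≤ hH U b := integral_nonneg fun x => sq_nonneg _
    rw [one_div, inv_mul_le_iff₀ cp]
    refine f3.trans ?_
    rw [hc]
    have : 0 ≤ 6 * K^2 * hH U b := by positivity
    nlinarith [mul_nonneg (sq_nonneg M) this, sq_nonneg M]
  have h1 : 4 * r / σ^2 * (σ^2 * Y / 2 - eE U b r / 8) ≤ 4 * r / σ^2 * (σ^2 * Y - Q/4) := by gcongr
  have e3 : 4 * r / σ^2 * (σ^2 * Y / 2 - eE U b r / 8) = 2 * r * Y - r / (2 * σ^2) * eE U b r := by field_simp; ring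
  have h2 : r / (2 * σ^2) * eE U b r ≤ r / b^2 * eE U b r := by
    gcongr; linarith
  have h3 : (4 * c + 1) * r * eE U b r ≤ (4 * c + 1) * r / b^2 * eE U b r := by
    have hb2 : b^2 ≤ 1 := pow_le_one₀ hb.le hb1
    have : (4 * c + 1) * r ≤ (4 * c + 1) * r / b^2 :=
      le_div_self (by positivity) (by positivity) hb2
    exact mul_le_mul_of_nonneg_right this E0
  have h4 : r * (- (4 * S)) ≤ r * (eE U b r + Y + 6 * K^2 * hH U b + 4 * c * eE U b r) := by
    apply mul_le_mul_of_nonneg_left _ r0.le; linarith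
  have e4 : (12 * M^2 + 6) * r / b^2 * eE U b r = (4 * c + 1) * r / b^2 * eE U b r + r / b^2 * eE U b r := by
    rw [hc]; ring
  rw [e4]
  linarith
end HI

namespace HI
variable {U Uy Uyy Uh : ℝ → ℝ → ℝ} {R K M ρ : ℝ}

lemma jJ_deriv (H : HI U Uy Uyy Uh R K M ρ) {r : ℝ} (hr : r ∈ Ioo 0 ρ) (x : ℝ) :
    HasDerivAt (jJ U x) (2 * r * ∫ ξ, (Uh (x + √2 * r * ξ) (r^2) + Uyy (x + √2 * r * ξ) (r^2)) ∂gam) r := by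
  have r0 := hr.1
  have hk := sq_lt hr
  have h := H.deriv_int (σ := fun s => √2 * s) (k := fun s => s^2) (σ' := fun _ => √2) (k' := fun s => 2 * s)
    (a := 0) (b := ρ) (B := max √2 (2 * ρ)) (s0 := r) x (φ := fun z => z) (φ' := fun _ => 1) hasDerivAt_id' (by fun_prop) hr
    (fun s hs => sq_lt hs) (fun s _ => hd2 s) (fun s _ => hdk s)
    (fun s _ => by rw [abs_of_nonneg (by positivity)]; exact le_max_left _ _)
    (fun s hs => by rw [abs_of_nonneg (by linarith [hs.1])]; exact le_trans (by linarith [hs.2]) (le_max_right _ _))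
  refine h.congr_deriv ?_
  have cs := H.cs2 hk x (σ := √2 * r) (by positivity)
  have ib := cs.ibp (q := fun _ => 1) (q1 := fun _ => 0) (fun y => hasDerivAt_const y 1) continuous_const
  simp only [mul_one, mul_zero, integral_zero, neg_zero] at ib
  have c1 := H.cy1 hk
  have c2 := H.cy2 hk
  have c3 := H.ch _ hk
  have i1 : Integrable (fun ξ => (√2 * r)^2 * Uyy (x + √2 * r * ξ) (r^2) - ξ * (√2 * r * Uy (x + √2 * r * ξ) (r^2))) gam :=
    gam_int_cs (by fun_prop) (C := (R + |x|) / (√2 * r)) fun y hy => by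
      have := cs.s1 y hy
      have h2 := cs.s2 y hy
      simp only [this, h2]; simp
  have i2 : Integrable (fun ξ => Uh (x + √2 * r * ξ) (r^2) + Uyy (x + √2 * r * ξ) (r^2)) gam :=
    gam_int_bdd (by fun_prop) (C := K + K) fun ξ => (abs_add_le _ _).trans (add_le_add (H.bh _ _ hk) (H.b2 _ _ hk))
  have e : ∀ ξ, 1 * (Uy (x + √2 * r * ξ) (r^2) * (√2 * ξ) + Uh (x + √2 * r * ξ) (r^2) * (2 * r)) =
    2 * r * (Uh (x + √2 * r * ξ) (r^2) + Uyy (x + √2 * r * ξ) (r^2)) - 1 / r * ((√2 * r)^2 * Uyy (x + √2 * r * ξ) (r^2) - ξ * (√2 * r * Uy (x + √2 * r * ξ) (r^2))) := by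
    intro ξ
    rw [mul_pow √2 r, Real.sq_sqrt (by norm_num)]
    field_simp; ring
  simp_rw [e]
  rw [integral_sub (i2.const_mul _) (i1.const_mul _), integral_const_mul, integral_const_mul, ib]
  ring

lemma jJ_bound (H : HI U Uy Uyy Uh R K M ρ) {b r : ℝ} (hb : 0 < b) (hr : r ∈ Ioo 0 ρ) (hrb : r ≤ b) {x : ℝ}
    (hx : x^2 ≤ 8 * b^2) {k : ℝ} (hk0 : 0 < k) :
    |2 * r * ∫ ξ, (Uh (x + √2 * r * ξ) (r^2) + Uyy (x + √2 * r * ξ) (r^2)) ∂gam| ≤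
      r * k * (∫ ξ, (Uh (sg b r * ξ) (r^2) + Uyy (sg b r * ξ) (r^2))^2 ∂gam) +
      b / k * (Real.exp 24 * ∫ ξ, Real.exp (ξ^2/4) ∂gam) := by
  have r0 := hr.1
  have hk := sq_lt hr
  set σ := sg b r with hσ
  have σ0 : 0 < σ := sg_pos hb
  set s := √2 * r with hs
  have s0 : 0 < s := by positivity
  have s2 : s^2 = 2 * r^2 := by rw [hs, mul_pow, Real.sq_sqrt (by norm_num)]
  have c2 := H.cy2 hk
  have c3 := H.ch _ hk
  have sub := gam_subst (fun y => (Uh y (r^2) + Uyy y (r^2))^2) x s0 σ0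
  rw [← sub]
  set F : ℝ → ℝ := fun y => Uh y (r^2) + Uyy y (r^2) with hF
  have cF : Continuous F := by fun_prop
  have sF : ∀ y, R ≤ |y| → F y = 0 := fun y hy => by simp [hF, H.sh hk hy, H.s2 _ _ hk hy]
  set g : ℝ → ℝ := fun ξ => (s / σ) * Real.exp (ξ^2/2 - (x + s * ξ)^2/(2*σ^2)) with hg
  have cg : Continuous g := by fun_prop
  have gp : ∀ ξ, 0 < g ξ := fun ξ => by simp only [hg]; positivity
  have hsup : ∀ ξ : ℝ, (R + |x|) / s ≤ |ξ| → R ≤ |x + s * ξ| := fun ξ h => by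
    rw [div_le_iff₀ s0] at h
    have h3 : |s * ξ| = |ξ| * s := by rw [abs_mul, abs_of_pos s0, mul_comm]
    have h4 := abs_sub_abs_le_abs_sub (s * ξ) (-x)
    rw [abs_neg, sub_neg_eq_add, add_comm (s * ξ)] at h4
    linarith
  have i1 : Integrable (fun ξ => F (x + s * ξ)^2 * g ξ) gam :=
    gam_int_cs (by fun_prop) (C := (R + |x|) / s) fun ξ h => by simp [sF _ (hsup ξ h)]
  have i2 : Integrable (fun ξ => |F (x + s * ξ)|) gam :=
    gam_int_cs (by fun_prop) (C := (R + |x|) / s) fun ξ h => by simp [sF _ (hsup ξ h)]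
  have ginv : ∀ ξ, (g ξ)⁻¹ ≤ (b / r * Real.exp 24) * Real.exp (ξ^2/4) := by
    intro ξ
    have e1 : (g ξ)⁻¹ = (σ / s) * Real.exp (-(ξ^2/2 - (x + s * ξ)^2/(2*σ^2))) := by
      simp only [hg]; rw [mul_inv, Real.exp_neg, inv_div]
    rw [e1, mul_assoc (b / r), ← Real.exp_add]
    have h1 : σ / s ≤ b / r := by
      rw [div_le_div_iff₀ s0 r0, hs]
      have := sg_le hb r0 hrb
      nlinarith
    have h2 : -(ξ^2/2 - (x + s * ξ)^2/(2*σ^2)) ≤ 24 + ξ^2/4 := by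
      have h3 : (x + s * ξ)^2/(2*σ^2) ≤ 24 + 3/4 * ξ^2 := by
        rw [div_le_iff₀ (by positivity), hσ, sg_sq]
        have h4 : (x + s * ξ)^2 ≤ 3/2 * s^2 * ξ^2 + 3 * x^2 := by nlinarith [sq_nonneg (s * ξ - 2 * x)]
        rw [s2] at h4
        have h5 : r^2 ≤ b^2 := by gcongr
        nlinarith [mul_nonneg (sub_nonneg.2 h5) (sq_nonneg ξ), sq_nonneg r]
      linarith
    gcongr
  have i3 : Integrable (fun ξ => (b / r * Real.exp 24) * Real.exp (ξ^2/4)) gam := gam_int_quarter.const_mul _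
  have key : ∀ ξ, |F (x + s * ξ)| ≤ k / 2 * (F (x + s * ξ)^2 * g ξ) + 1 / (2 * k) * ((b / r * Real.exp 24) * Real.exp (ξ^2/4)) := by
    intro ξ
    have h1 : 1 / (2 * k) * (g ξ)⁻¹ ≤ 1 / (2 * k) * ((b / r * Real.exp 24) * Real.exp (ξ^2/4)) := by
      have := ginv ξ; gcongr
    refine le_trans ?_ (add_le_add le_rfl h1)
    rw [← sq_abs (F _)]
    set A := |F (x + s * ξ)|
    have gp := gp ξ
    have : k / 2 * (A^2 * g ξ) + 1 / (2 * k) * (g ξ)⁻¹ - A = (k * g ξ * A - 1)^2 / (2 * k * g ξ) := by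
      field_simp; ring
    have h2 : 0 ≤ (k * g ξ * A - 1)^2 / (2 * k * g ξ) := by positivity
    linarith
  have h1 := integral_mono i2 ((i1.const_mul (k/2)).add (i3.const_mul (1/(2*k)))) key
  simp only [Pi.add_apply] at h1
  rw [integral_add (i1.const_mul _) (i3.const_mul _)] at h1
  simp only [integral_const_mul] at h1
  have h2 : |∫ ξ, F (x + s * ξ) ∂gam| ≤ ∫ ξ, |F (x + s * ξ)| ∂gam := abs_integral_le_integral_abs
  rw [abs_mul, abs_of_pos (show 0 < 2 * r by positivity)]
  have h3 := mul_le_mul_of_nonneg_left (h2.trans h1) (show 0 ≤ 2 * r by positivity)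
  refine h3.trans (le_of_eq ?_)
  change _ = r * k * (∫ ξ, F (x + s * ξ)^2 * g ξ ∂gam) + _
  generalize (∫ ξ, F (x + s * ξ)^2 * g ξ ∂gam) = A
  field_simp

lemma jJ_tendsto (H : HI U Uy Uyy Uh R K M ρ) (x : ℝ) : Tendsto (jJ U x) (𝓝[>] 0) (𝓝 (U x 0)) := by
  have ρ0 := H.ρp
  have h0 : |(0:ℝ)| < ρ^2 := by simp; positivity
  have hm : ∀ᶠ r in 𝓝[>] (0:ℝ), r ∈ Ioo 0 ρ := Ioo_mem_nhdsGT ρ0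
  have : Tendsto (jJ U x) (𝓝[>] 0) (𝓝 (∫ _, U x 0 ∂gam)) := by
    refine tendsto_integral_filter_of_dominated_convergence (fun _ => K) ?_ ?_ (integrable_const _) ?_
    · filter_upwards [hm] with r hr
      have := H.cy0 (sq_lt hr)
      exact Continuous.aestronglyMeasurable (by fun_prop)
    · filter_upwards [hm] with r hr
      exact ae_of_all _ fun ξ => H.b0 _ _ (sq_lt hr)
    · refine ae_of_all _ fun ξ => ?_
      have hc := H.c0 x 0 h0
      have h1 : Tendsto (fun r : ℝ => (x + √2 * r * ξ, r^2)) (𝓝[>] 0) (𝓝 (x, 0)) := by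
        have : ContinuousAt (fun r : ℝ => (x + √2 * r * ξ, r^2)) 0 := by fun_prop
        have h2 := this.tendsto
        simp at h2
        exact h2.mono_left nhdsWithin_le_nhds
      exact hc.tendsto.comp h1
  simpa using this

lemma eval (H : HI U Uy Uyy Uh R K M ρ) : ∃ C, 0 ≤ C ∧ ∀ b ∈ Ioo 0 ρ, b ≤ 1 → Real.exp (-(R^2/(16*b^2))) ≤ hH U b →
    ∀ x, x^2 ≤ 8 * b^2 → |U x 0 - jJ U x b| ≤ C * b * √(hH U b) := by
  set C2 := 12 * M^2 + 6 with hC2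
  set m0 := Real.exp (C2/2) with hm0
  set C3 := m0 * (1 + 3 * K^2) with hC3
  set C4 := 3 * M^2 * C3 + 6 * K^2 with hC4
  set Cρ := Real.exp 24 * ∫ ξ, Real.exp (ξ^2/4) ∂gam with hCρ
  have Cρ0 : 0 ≤ Cρ := mul_nonneg (Real.exp_pos _).le (integral_nonneg fun ξ => (Real.exp_pos _).le)
  refine ⟨3 * M^2 * C3 + C4 / 2 + Cρ, by positivity, fun b hbρ hb1 hlow x hx => ?_⟩
  have hb := hbρ.1
  set Hb := hH U b with hHb
  have Hp : 0 < Hb := lt_of_lt_of_le (Real.exp_pos _) hlow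
  set k := b / √Hb with hk
  have kp : 0 < k := div_pos hb (Real.sqrt_pos.2 Hp)
  have mem : ∀ r ∈ Ioc 0 b, r ∈ Ioo 0 ρ := fun r hr => ⟨hr.1, hr.2.trans_lt hbρ.2⟩
  have st := fun r (hr : r ∈ Ioc 0 b) => H.eE_deriv hb (mem r hr) hr.2 hb1 hlow
  choose! E' Y dE Y0 hF hE' using st
  have E0 : ∀ r, 0 ≤ eE U b r := fun r => integral_nonneg fun x => sq_nonneg _
  set m : ℝ → ℝ := fun r => Real.exp (C2 * r^2/(2 * b^2)) with hm
  have m1 : ∀ r, 1 ≤ m r := fun r => Real.one_le_exp (by positivity)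
  have m2 : ∀ r ∈ Ioc 0 b, m r ≤ m0 := fun r hr => by
    apply Real.exp_le_exp.2
    have : r^2 ≤ b^2 := by have := hr.1; have := hr.2; gcongr
    rw [div_le_div_iff₀ (by positivity) (by norm_num)]
    have : 0 ≤ C2 := by positivity
    nlinarith
  have dm : ∀ r, HasDerivAt m (m r * (C2 * r / b^2)) r := fun r => by
    have := (((hdk r).const_mul C2).div_const (2 * b^2)).exp
    refine this.congr_deriv ?_
    simp only [hm]; field_simp
  set Φ : ℝ → ℝ := fun r => m r * eE U b r + m0 * 3 * K^2 * Hb * r^2 with hΦ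
  set Φ' : ℝ → ℝ := fun r => (m r * (C2 * r / b^2)) * eE U b r + m r * E' r + m0 * 3 * K^2 * Hb * (2 * r) with hΦ'
  have dΦ : ∀ r ∈ Ioc 0 b, HasDerivAt Φ (Φ' r) r := fun r hr =>
    ((dm r).fun_mul (dE r hr)).fun_add ((hdk r).const_mul _)
  have hΦl : ∀ r ∈ Ioc 0 b, r * Y r ≤ Φ' r := fun r hr => by
    have h1 := hE' r hr
    have h2 := mul_le_mul_of_nonneg_left h1 (zero_le_one.trans (m1 r))
    have r0 := hr.1
    have h3 : m r * (6 * K^2 * r * Hb) ≤ m0 * (6 * K^2 * r * Hb) :=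
      mul_le_mul_of_nonneg_right (m2 r hr) (by positivity)
    have h4 : r * Y r ≤ m r * (r * Y r) := le_mul_of_one_le_left (mul_nonneg r0.le (Y0 r hr)) (m1 r)
    have e : m r * (C2 * r / b^2 * eE U b r) = (m r * (C2 * r / b^2)) * eE U b r := by ring
    simp only [hΦ']
    rw [mul_sub, mul_sub, e] at h2
    linarith
  have mono : ∀ f f' : ℝ → ℝ, (∀ r ∈ Ioc 0 b, HasDerivAt f (f' r) r) → (∀ r ∈ Ioc 0 b, 0 ≤ f' r) → MonotoneOn f (Ioc 0 b) := by
    intro f f' h1 h2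
    refine monotoneOn_of_deriv_nonneg (convex_Ioc _ _) (fun r hr => (h1 r hr).continuousAt.continuousWithinAt)
      (fun r hr => ?_) (fun r hr => ?_)
    · rw [interior_Ioc] at hr; exact (h1 r (Ioo_subset_Ioc_self hr)).differentiableAt.differentiableWithinAt
    · rw [interior_Ioc] at hr; rw [(h1 r (Ioo_subset_Ioc_self hr)).deriv]; exact h2 r (Ioo_subset_Ioc_self hr)
  have bm : b ∈ Ioc 0 b := ⟨hb, le_rfl⟩
  have Φmono := mono Φ Φ' dΦ fun r hr => (mul_nonneg hr.1.le (Y0 r hr)).trans (hΦl r hr)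
  have Φb : Φ b ≤ C3 * Hb := by
    have e1 : eE U b b = Hb := by
      rw [hHb]; unfold eE hH; rw [sg_self hb]
    simp only [hΦ]
    rw [e1]
    have h1 := m2 b bm
    have h2 : b^2 ≤ 1 := pow_le_one₀ hb.le hb1
    have h3 : m b * Hb ≤ m0 * Hb := by gcongr
    have h4 : m0 * 3 * K^2 * Hb * b^2 ≤ m0 * 3 * K^2 * Hb * 1 := by gcongr
    rw [hC3]; linarith
  have Φ0 : ∀ r, 0 ≤ Φ r := fun r => by
    simp only [hΦ]
    have := E0 r
    have := (zero_le_one.trans (m1 r))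
    positivity
  have EΦ : ∀ r ∈ Ioc 0 b, eE U b r ≤ C3 * Hb := fun r hr => by
    have h1 := Φmono hr bm hr.2
    have h2 : eE U b r ≤ m r * eE U b r := le_mul_of_one_le_left (E0 r) (m1 r)
    have h3 : 0 ≤ m0 * 3 * K^2 * Hb * r^2 := by positivity
    simp only [hΦ] at h1 Φb
    linarith
  set J' : ℝ → ℝ := fun r => 2 * r * ∫ ξ, (Uh (x + √2 * r * ξ) (r^2) + Uyy (x + √2 * r * ξ) (r^2)) ∂gam with hJ'
  have Jb : ∀ r ∈ Ioc 0 b, |J' r| ≤ 3 * M^2 * k * Φ' r + (k * C4 * Hb) * r + b / k * Cρ := fun r hr => by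
    have h1 := H.jJ_bound hb (mem r hr) hr.2 hx kp
    refine h1.trans ?_
    have r0 := hr.1
    have h2 := mul_le_mul_of_nonneg_left (hF r hr) (show 0 ≤ r * k by positivity)
    have h3 := mul_le_mul_of_nonneg_left (hΦl r hr) (show 0 ≤ 3 * M^2 * k by positivity)
    have h4 := mul_le_mul_of_nonneg_left (EΦ r hr) (show 0 ≤ 3 * M^2 * k * r by positivity)
    rw [hC4]
    linarith
  set Ψ : ℝ → ℝ := fun r => 3 * M^2 * k * Φ r + (k * C4 * Hb / 2) * r^2 + b / k * Cρ * r with hΨ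
  have dΨ : ∀ r ∈ Ioc 0 b, HasDerivAt Ψ (3 * M^2 * k * Φ' r + (k * C4 * Hb) * r + b / k * Cρ) r := fun r hr => by
    have := (((dΦ r hr).const_mul (3 * M^2 * k)).fun_add ((hdk r).const_mul (k * C4 * Hb / 2))).fun_add
      ((hasDerivAt_id' r).const_mul (b / k * Cρ))
    refine this.congr_deriv (by ring)
  have dJ : ∀ r ∈ Ioc 0 b, HasDerivAt (jJ U x) (J' r) r := fun r hr => H.jJ_deriv (mem r hr) x
  have M1 := mono _ _ (fun r hr => (dΨ r hr).fun_add (dJ r hr)) fun r hr => by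
    have := neg_le_of_abs_le (Jb r hr); linarith
  have M2 := mono _ _ (fun r hr => (dΨ r hr).fun_sub (dJ r hr)) fun r hr => by
    have := le_of_abs_le (Jb r hr); linarith
  have Ψ0 : ∀ r ∈ Ioc 0 b, 0 ≤ Ψ r := fun r hr => by
    have := Φ0 r
    have r0 := hr.1
    simp only [hΨ]; positivity
  have Ψb : Ψ b ≤ (3 * M^2 * C3 + C4 / 2 + Cρ) * b * √Hb := by
    have e0 : √Hb * √Hb = Hb := Real.mul_self_sqrt Hp.le
    have sp := Real.sqrt_pos.2 Hp
    have e1 : k * Hb = b * √Hb := by rw [hk]; nth_rewrite 2 [← e0]; field_simp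
    have e2 : b / k = √Hb := by rw [hk]; field_simp
    simp only [hΨ]
    rw [e2]
    have h1 : 3 * M^2 * k * Φ b ≤ 3 * M^2 * k * (C3 * Hb) := by gcongr
    have h2 : b^2 ≤ 1 := pow_le_one₀ hb.le hb1
    have h3 : k * C4 * Hb / 2 * b^2 ≤ k * C4 * Hb / 2 * 1 := by gcongr
    have e3 : 3 * M^2 * k * (C3 * Hb) = 3 * M^2 * C3 * (k * Hb) := by ring
    have e4 : k * C4 * Hb / 2 * 1 = C4 / 2 * (k * Hb) := by ring
    rw [e3, e1] at h1
    rw [e4, e1] at h3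
    linarith
  have hall : ∀ r ∈ Ioc 0 b, |jJ U x r - jJ U x b| ≤ (3 * M^2 * C3 + C4 / 2 + Cρ) * b * √Hb := fun r hr => by
    have a1 := M1 hr bm hr.2
    have a2 := M2 hr bm hr.2
    have a3 := Ψ0 r hr
    rw [abs_le]; constructor <;> linarith
  refine le_of_tendsto ((H.jJ_tendsto x).sub_const (jJ U x b)).abs ?_
  filter_upwards [Ioc_mem_nhdsGT hb] with r hr using hall r hr

theorem local_dichotomy (H : HI U Uy Uyy Uh R K M ρ) :
    (∃ δ > 0, ∀ y, |y| < δ → U y 0 = 0) ∨ (∃ δ > 0, ∀ y, 0 < |y| → |y| < δ → U y 0 ≠ 0) := by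
  by_cases hs : ∀ r0 > 0, ∃ r ∈ Ioo 0 r0, hH U r < Real.exp (-(R^2/(16*r^2)))
  · exact Or.inl ⟨R/4, by linarith [H.Rp], H.vanish hs⟩
  right
  push Not at hs
  obtain ⟨r0, hr0, hlow⟩ := hs
  obtain ⟨Λ, hΛ⟩ := H.freq hr0 hlow
  obtain ⟨c, c0, ε, ε0, hh⟩ := herm_eval Λ
  obtain ⟨δ, δ0, δ1, hδ⟩ := hΛ ε ε0
  obtain ⟨C, C0, hC⟩ := H.eval
  set d := min δ (min ρ (min 1 (Real.exp (-2) * c / (C + 1)))) with hd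
  have d0 : 0 < d := lt_min δ0 (lt_min H.ρp (lt_min one_pos (by positivity)))
  refine ⟨d, d0, fun y hy0 hyd hU => ?_⟩
  have q2 : 1 < √2 := by
    rw [Real.lt_sqrt (by norm_num)]; norm_num
  have sq2 : √2 * √2 = 2 := Real.mul_self_sqrt (by norm_num)
  set r1 := |y| / √2 with hr1
  have r1p : 0 < r1 := by positivity
  have r1y : √2 * r1 = |y| := by rw [hr1]; field_simp
  have r1d : r1 < d := by
    have : r1 ≤ |y| := by rw [← r1y]; nlinarith
    linarith
  obtain ⟨r, hr, l, hl, hI⟩ := hδ r1 ⟨r1p, r1d.trans_le (min_le_left _ _)⟩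
  have rp : 0 < r := by linarith [hr.1]
  have rd : r < d := lt_of_le_of_lt hr.2 r1d
  have rρ : r < ρ := rd.trans_le ((min_le_right _ _).trans (min_le_left _ _))
  have rone : r < 1 := rd.trans_le ((min_le_right _ _).trans ((min_le_right _ _).trans (min_le_left _ _)))
  have rC : r < Real.exp (-2) * c / (C + 1) := rd.trans_le ((min_le_right _ _).trans ((min_le_right _ _).trans (min_le_right _ _)))
  have rδ : r < δ := rd.trans_le (min_le_left _ _)
  have hlr := hlow r ⟨rp, rδ.trans_le δ1⟩
  have Hp : 0 < hH U r := lt_of_lt_of_le (Real.exp_pos _) hlr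
  have sp : 0 < √2 * r := by positivity
  set η := y / (√2 * r) with hη
  have habs : |η| = r1 / r := by
    rw [hη, abs_div, abs_of_pos sp, ← r1y]; field_simp
  have η1 : 1 ≤ |η| := by rw [habs, le_div_iff₀ rp]; linarith [hr.2]
  have η2 : |η| ≤ 2 := by rw [habs, div_le_iff₀ rp]; linarith [hr.1]
  have h1 := hh _ _ _ _ l (H.cs ⟨rp, rρ⟩) hl hI η η1 η2
  have hy2 : y^2 ≤ 8 * r^2 := by
    have e1 : y^2 = 2 * r1^2 := by rw [← sq_abs, ← r1y, mul_pow, Real.sq_sqrt (by norm_num)]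
    have : r1^2 ≤ (2 * r)^2 := by
      have := hr.1
      gcongr; linarith
    rw [e1]; nlinarith
  have h2 := hC r ⟨rp, rρ⟩ rone.le hlr y hy2
  have h3 : jJ U y r = Real.exp (-η^2/2) * ∫ ζ, U (√2 * r * ζ) (r^2) * Real.exp (η * ζ) ∂gam :=
    gam_shift (fun z => U z (r^2)) y sp
  rw [hU, zero_sub, abs_neg, h3, abs_mul, abs_of_pos (Real.exp_pos _)] at h2
  have h4 : Real.exp (-2) ≤ Real.exp (-η^2/2) := by
    apply Real.exp_le_exp.2
    rw [← sq_abs]; nlinarith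
  have h5 : Real.exp (-2) * (c * √(hH U r)) ≤ C * r * √(hH U r) := by
    refine le_trans ?_ h2
    have : 0 ≤ c * √(hH U r) := by positivity
    exact mul_le_mul h4 h1 this (Real.exp_pos _).le
  have sH := Real.sqrt_pos.2 Hp
  rw [← mul_assoc] at h5
  have h6 := le_of_mul_le_mul_right h5 sH
  rw [lt_div_iff₀ (by positivity)] at rC
  nlinarith
end HI

structure Loc (a ax axx ah u ux uxx uh : ℝ → ℝ → ℝ) (d M : ℝ) : Prop where
  dp : 0 < d
  Mp : 1 ≤ M
  alo : ∀ x h, |x| < d → |h| < d → M⁻¹ ≤ a x h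
  ahi : ∀ x h, |x| < d → |h| < d → a x h ≤ M
  dax : ∀ x h, |x| < d → |h| < d → HasDerivAt (fun z => a z h) (ax x h) x
  daxx : ∀ x h, |x| < d → |h| < d → HasDerivAt (fun z => ax z h) (axx x h) x
  dah : ∀ x h, |x| < d → |h| < d → HasDerivAt (fun k => a x k) (ah x h) h
  bax : ∀ x h, |x| < d → |h| < d → |ax x h| ≤ M
  baxx : ∀ x h, |x| < d → |h| < d → |axx x h| ≤ M
  bah : ∀ x h, |x| < d → |h| < d → |ah x h| ≤ M
  dux : ∀ x h, |x| < d → |h| < d → HasDerivAt (fun z => u z h) (ux x h) x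
  duxx : ∀ x h, |x| < d → |h| < d → HasDerivAt (fun z => ux z h) (uxx x h) x
  duh : ∀ x h, |x| < d → |h| < d → HasDerivAt (fun k => u x k) (uh x h) h
  c0 : ∀ x h, |x| < d → |h| < d → ContinuousAt (fun p : ℝ × ℝ => u p.1 p.2) (x, h)
  c1 : ∀ x h, |x| < d → |h| < d → ContinuousAt (fun p : ℝ × ℝ => ux p.1 p.2) (x, h)
  c2 : ∀ x h, |x| < d → |h| < d → ContinuousAt (fun p : ℝ × ℝ => uxx p.1 p.2) (x, h)
  ch : ∀ x h, |x| < d → |h| < d → ContinuousAt (fun p : ℝ × ℝ => uh p.1 p.2) (x, h)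
  ineq : ∀ x h, |x| < d → |h| < d → |uh x h + a x h * uxx x h| ≤ M * (|u x h| + |ux x h|)

lemma lip_of {f f' : ℝ → ℝ} {d C : ℝ} (hf : ∀ x, |x| < d → HasDerivAt f (f' x) x)
    (hb : ∀ x, |x| < d → |f' x| ≤ C) {x y : ℝ} (hx : |x| < d) (hy : |y| < d) :
    |f y - f x| ≤ C * |y - x| := by
  have := Convex.norm_image_sub_le_of_norm_hasDerivWithin_le (s := Ioo (-d) d) (f := f) (f' := f') (C := C)
    (fun x hx => (hf x (abs_lt.2 hx)).hasDerivWithinAt) (fun x hx => hb x (abs_lt.2 hx))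
    (convex_Ioo _ _) (abs_lt.1 hx) (abs_lt.1 hy)
  simpa using this

lemma ev2 {d : ℝ} {x h : ℝ} (hx : |x| < d) (hh : |h| < d) :
    ∀ᶠ p : ℝ × ℝ in 𝓝 (x, h), |p.1| < d ∧ |p.2| < d := by
  have h1 : ContinuousAt (fun z : ℝ × ℝ => |z.1|) (x, h) := by fun_prop
  have h2 : ContinuousAt (fun z : ℝ × ℝ => |z.2|) (x, h) := by fun_prop
  exact (h1.eventually_lt continuousAt_const hx).and (h2.eventually_lt continuousAt_const hh)

lemma impl {F Fx : ℝ → ℝ → ℝ} {g : ℝ → ℝ} {t Ft y : ℝ}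
    (hx : ∀ᶠ p : ℝ × ℝ in 𝓝 (g t, t), HasDerivAt (fun z => F z p.2) (Fx p.1 p.2) p.1)
    (cx : ContinuousAt (fun p : ℝ × ℝ => Fx p.1 p.2) (g t, t))
    (ht : HasDerivAt (fun k => F (g t) k) Ft t) (hp : 0 < Fx (g t) t)
    (cg : ContinuousAt g t) (hg : ∀ k, F (g k) k = y) : HasDerivAt g (-Ft / Fx (g t) t) t := by
  obtain ⟨ε, ε0, hε⟩ := Metric.eventually_nhds_iff.1 hx
  have key : ∀ᶠ k in 𝓝 t, ∃ z, |z - g t| ≤ |g k - g t| ∧ F (g k) k - F (g t) k = Fx z k * (g k - g t) := by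
    have h1 : ∀ᶠ k in 𝓝 t, |g k - g t| < ε := by
      have := cg.eventually (Metric.ball_mem_nhds _ ε0)
      simpa [Real.dist_eq] using this
    have h2 : ∀ᶠ k in 𝓝 t, |k - t| < ε := by
      have : ∀ᶠ k in 𝓝 t, k ∈ Metric.ball t ε := Metric.ball_mem_nhds t ε0
      simpa [Real.dist_eq] using this
    filter_upwards [h1, h2] with k h1 h2
    have hd : ∀ z, |z - g t| ≤ |g k - g t| → HasDerivAt (fun z => F z k) (Fx z k) z := fun z hz => by
      refine hε (y := (z, k)) ?_
      rw [Prod.dist_eq]; simp only [Real.dist_eq]; exact max_lt (by linarith) h2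
    rcases lt_trichotomy (g k) (g t) with h | h | h
    · obtain ⟨z, hz, e⟩ := exists_hasDerivAt_eq_slope (fun z => F z k) (fun z => Fx z k) h
        (fun z hz => (hd z (by rw [abs_of_nonpos (by linarith [hz.2]), abs_of_neg (by linarith)]; linarith [hz.1])).continuousAt.continuousWithinAt)
        (fun z hz => hd z (by rw [abs_of_nonpos (by linarith [hz.2]), abs_of_neg (by linarith)]; linarith [hz.1]))
      refine ⟨z, by rw [abs_of_nonpos (by linarith [hz.2]), abs_of_neg (by linarith)]; linarith [hz.1], ?_⟩
      have : g t - g k ≠ 0 := by linarith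
      rw [e]; field_simp; ring
    · exact ⟨g t, by simp, by rw [h]; ring⟩
    · obtain ⟨z, hz, e⟩ := exists_hasDerivAt_eq_slope (fun z => F z k) (fun z => Fx z k) h
        (fun z hz => (hd z (by rw [abs_of_nonneg (by linarith [hz.1]), abs_of_pos (by linarith)]; linarith [hz.2])).continuousAt.continuousWithinAt)
        (fun z hz => hd z (by rw [abs_of_nonneg (by linarith [hz.1]), abs_of_pos (by linarith)]; linarith [hz.2.le]))
      refine ⟨z, by rw [abs_of_nonneg (by linarith [hz.1]), abs_of_pos (by linarith)]; linarith [hz.2], ?_⟩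
      have : g k - g t ≠ 0 := by linarith
      rw [e]; field_simp
  obtain ⟨z, hz⟩ := (key.choice : ∃ z : ℝ → ℝ, ∀ᶠ k in 𝓝 t, |z k - g t| ≤ |g k - g t| ∧ F (g k) k - F (g t) k = Fx (z k) k * (g k - g t))
  have cz : Tendsto z (𝓝 t) (𝓝 (g t)) := by
    rw [tendsto_iff_norm_sub_tendsto_zero]
    refine squeeze_zero' (Eventually.of_forall fun _ => norm_nonneg _) (hz.mono fun k hk => hk.1) ?_
    have := tendsto_iff_norm_sub_tendsto_zero.1 cg.tendsto
    exact this
  have cf : Tendsto (fun k => Fx (z k) k) (𝓝 t) (𝓝 (Fx (g t) t)) :=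
    Tendsto.comp (f := fun k => (z k, k)) cx (cz.prodMk_nhds tendsto_id)
  rw [hasDerivAt_iff_tendsto_slope] at ht ⊢
  refine ((ht.neg).div (cf.mono_left nhdsWithin_le_nhds) hp.ne').congr' ?_
  filter_upwards [nhdsWithin_le_nhds hz, nhdsWithin_le_nhds (cf.eventually_const_lt hp), self_mem_nhdsWithin] with k hk hk2 hk3
  have h1 := hk.2
  rw [hg k, ← hg t] at h1
  have hk3 : k - t ≠ 0 := sub_ne_zero.2 hk3
  simp only [slope_def_field, Pi.div_apply]
  field_simp
  linarith

namespace Loc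
variable {a ax axx ah u ux uxx uh : ℝ → ℝ → ℝ} {d M : ℝ}

lemma ca (H : Loc a ax axx ah u ux uxx uh d M) {x h : ℝ} (hx : |x| < d) (hh : |h| < d) :
    ContinuousAt (fun p : ℝ × ℝ => a p.1 p.2) (x, h) := by
  rw [ContinuousAt, tendsto_iff_norm_sub_tendsto_zero]
  have h1 : Tendsto (fun p : ℝ × ℝ => M * |p.1 - x| + M * |p.2 - h|) (𝓝 (x, h)) (𝓝 0) := by
    have : Continuous (fun p : ℝ × ℝ => M * |p.1 - x| + M * |p.2 - h|) := by fun_prop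
    simpa using this.tendsto (x, h)
  refine squeeze_zero' (Eventually.of_forall fun _ => norm_nonneg _) ?_ h1
  filter_upwards [ev2 hx hh] with p hp
  have e1 := lip_of (f := fun z => a z p.2) (fun z hz => H.dax z _ hz hp.2) (fun z hz => H.bax z _ hz hp.2) hx hp.1
  have e2 := lip_of (f := fun z => a x z) (fun z hz => H.dah x z hx hz) (fun z hz => H.bah x z hx hz) hh hp.2
  rw [Real.norm_eq_abs]
  have := abs_add_le (a p.1 p.2 - a x p.2) (a x p.2 - a x h)
  simp only [sub_add_sub_cancel] at this
  linarith

lemma cax (H : Loc a ax axx ah u ux uxx uh d M) {x h : ℝ} (hx : |x| < d) (hh : |h| < d) :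
    ContinuousAt (fun p : ℝ × ℝ => ax p.1 p.2) (x, h) := by
  have M1 := H.Mp
  rw [ContinuousAt, tendsto_iff_norm_sub_tendsto_zero]
  have h1 : Tendsto (fun p : ℝ × ℝ => M * |p.1 - x| + 4 * M * √|p.2 - h|) (𝓝 (x, h)) (𝓝 0) := by
    have : Continuous (fun p : ℝ × ℝ => M * |p.1 - x| + 4 * M * √|p.2 - h|) := by fun_prop
    simpa using this.tendsto (x, h)
  refine squeeze_zero' (Eventually.of_forall fun _ => norm_nonneg _) ?_ h1
  have h2 : ∀ᶠ p : ℝ × ℝ in 𝓝 (x, h), √|p.2 - h| < d - |x| := by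
    have : ContinuousAt (fun p : ℝ × ℝ => √|p.2 - h|) (x, h) := by fun_prop
    exact this.eventually_lt continuousAt_const (by simpa using hx)
  filter_upwards [ev2 hx hh, h2] with p hp h2
  have e1 := lip_of (f := fun z => ax z p.2) (fun z hz => H.daxx z _ hz hp.2) (fun z hz => H.baxx z _ hz hp.2) hx hp.1
  suffices e2 : |ax x p.2 - ax x h| ≤ 4 * M * √|p.2 - h| by
    rw [Real.norm_eq_abs]
    have := abs_add_le (ax p.1 p.2 - ax x p.2) (ax x p.2 - ax x h)
    simp only [sub_add_sub_cancel] at this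
    linarith
  set η := √|p.2 - h| with hη
  rcases (Real.sqrt_nonneg |p.2 - h|).eq_or_lt with h0 | h0
  · rw [eq_comm, Real.sqrt_eq_zero (abs_nonneg _), abs_eq_zero, sub_eq_zero] at h0
    rw [h0, sub_self, abs_zero]; positivity
  have η0 : 0 < η := h0
  have hη2 : η^2 = |p.2 - h| := Real.sq_sqrt (abs_nonneg _)
  have hb : ∀ z, x ≤ z → z ≤ x + η → |z| < d := fun z h1 h2 => by
    rw [abs_lt] at *
    have := abs_le.1 (le_refl |x|)
    constructor <;> linarith
  have mv : ∀ k, |k| < d → |a (x + η) k - a x k - ax x k * η| ≤ M * η^2 := fun k hk => by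
    obtain ⟨z, hz, e⟩ := exists_hasDerivAt_eq_slope (fun z => a z k) (fun z => ax z k) (show x < x + η by linarith)
        (fun z hz => (H.dax z k (hb z hz.1 hz.2) hk).continuousAt.continuousWithinAt)
        (fun z hz => H.dax z k (hb z hz.1.le hz.2.le) hk)
    have e1 := lip_of (f := fun z => ax z k) (fun z hz => H.daxx z _ hz hk) (fun z hz => H.baxx z _ hz hk) hx (hb z hz.1.le hz.2.le)
    have e3 : a (x + η) k - a x k = ax z k * η := by rw [e, add_sub_cancel_left, div_mul_cancel₀ _ η0.ne']
    rw [e3, ← sub_mul, abs_mul, abs_of_pos η0, pow_two, ← mul_assoc]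
    refine mul_le_mul_of_nonneg_right (e1.trans ?_) η0.le
    rw [abs_of_pos (by linarith [hz.1])]
    exact mul_le_mul_of_nonneg_left (by linarith [hz.2]) (by linarith)
  have e2 : ∀ z, |z| < d → |a z p.2 - a z h| ≤ M * η^2 := fun z hz => by
    rw [hη2]
    exact lip_of (f := fun k => a z k) (fun k hk => H.dah z k hz hk) (fun k hk => H.bah z k hz hk) hh hp.2
  have A := abs_le.1 (mv _ hh)
  have B := abs_le.1 (mv _ hp.2)
  have C := abs_le.1 (e2 _ hx)
  have D := abs_le.1 (e2 _ (hb (x + η) (by linarith) le_rfl))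
  rw [abs_le]
  constructor
  · refine le_of_mul_le_mul_right ?_ η0; nlinarith
  · refine le_of_mul_le_mul_right ?_ η0; nlinarith

end Loc

namespace Loc
variable {a ax axx ah u ux uxx uh : ℝ → ℝ → ℝ} {d M : ℝ}

noncomputable def kap (d x : ℝ) : ℝ := max (-(d/2)) (min (d/2) x)
noncomputable def al (a : ℝ → ℝ → ℝ) (d x h : ℝ) : ℝ := (√(a (kap d x) (kap d h)))⁻¹
noncomputable def Yf (a : ℝ → ℝ → ℝ) (d x h : ℝ) : ℝ := ∫ z in (0:ℝ)..x, al a d z h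

lemma kap_eq {x : ℝ} (hx : |x| ≤ d/2) : kap d x = x := by
  rw [abs_le] at hx
  rw [kap, min_eq_right hx.2, max_eq_right hx.1]

lemma kap_lt (hd : 0 < d) (x : ℝ) : |kap d x| < d := by
  rw [abs_lt, kap]
  constructor
  · exact lt_of_lt_of_le (by linarith) (le_max_left _ _)
  · exact max_lt (by linarith) (lt_of_le_of_lt (min_le_left _ _) (by linarith))

lemma kap_cont : Continuous (kap d) := by unfold kap; fun_prop

lemma a_pos (H : Loc a ax axx ah u ux uxx uh d M) {x h : ℝ} (hx : |x| < d) (hh : |h| < d) : 0 < a x h :=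
  lt_of_lt_of_le (by have := H.Mp; positivity) (H.alo x h hx hh)

lemma al_cont (H : Loc a ax axx ah u ux uxx uh d M) : Continuous (fun p : ℝ × ℝ => al a d p.1 p.2) := by
  refine continuous_iff_continuousAt.2 fun p => ?_
  have h1 : ContinuousAt (fun p : ℝ × ℝ => a (kap d p.1) (kap d p.2)) p :=
    ContinuousAt.comp (f := fun p : ℝ × ℝ => (kap d p.1, kap d p.2)) (H.ca (kap_lt H.dp _) (kap_lt H.dp _))
      (by have := kap_cont (d := d); fun_prop)
  exact (Real.continuous_sqrt.continuousAt.comp h1).inv₀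
    (Real.sqrt_pos.2 (H.a_pos (kap_lt H.dp _) (kap_lt H.dp _))).ne'

lemma sq_bd (H : Loc a ax axx ah u ux uxx uh d M) {x h : ℝ} (hx : |x| < d) (hh : |h| < d) :
    (√M)⁻¹ ≤ √(a x h) ∧ √(a x h) ≤ √M ∧ (√(a x h))⁻¹ ≤ √M ∧ (√M)⁻¹ ≤ (√(a x h))⁻¹ := by
  have := H.Mp
  have h1 : (√M)⁻¹ ≤ √(a x h) := by rw [← Real.sqrt_inv]; exact Real.sqrt_le_sqrt (H.alo _ _ hx hh)
  have h2 : √(a x h) ≤ √M := Real.sqrt_le_sqrt (H.ahi _ _ hx hh)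
  have h3 : 0 < √(a x h) := Real.sqrt_pos.2 (H.a_pos hx hh)
  have h4 : 0 < √M := by positivity
  exact ⟨h1, h2, inv_le_of_inv_le₀ h4 h1, (inv_le_inv₀ h4 h3).2 h2⟩

lemma al_dh (H : Loc a ax axx ah u ux uxx uh d M) (x : ℝ) {h : ℝ} (hh : |h| < d/2) :
    HasDerivAt (fun k => al a d x k) (deriv (al a d x) h) h ∧ |deriv (al a d x) h| ≤ M^3 := by
  have hd := H.dp
  have M1 := H.Mp
  have hx := kap_lt hd x
  have hh' : |h| < d := by linarith
  have h1 := (H.dah _ h hx hh').sqrt (H.a_pos hx hh').ne'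
  have h2 := h1.inv (Real.sqrt_pos.2 (H.a_pos hx hh')).ne'
  have h3 : HasDerivAt (al a d x) (-(ah (kap d x) h / (2 * √(a (kap d x) h))) / √(a (kap d x) h) ^ 2) h := by
    refine h2.congr_of_eventuallyEq ?_
    filter_upwards [(continuous_abs.tendsto h).eventually_lt_const hh] with k hk
    simp only [al, kap_eq hk.le, Pi.inv_apply]
  refine ⟨h3.deriv ▸ h3, ?_⟩
  rw [h3.deriv]
  set q := √(a (kap d x) h)
  have q0 : 0 < q := Real.sqrt_pos.2 (H.a_pos hx hh')
  have b := (H.sq_bd hx hh').2.2.1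
  have e : -(ah (kap d x) h / (2 * q)) / q^2 = - (ah (kap d x) h / 2 * (q⁻¹)^3) := by field_simp
  rw [e, abs_neg, abs_mul, abs_div, abs_of_pos (show (0:ℝ) < 2 by norm_num), abs_of_pos (show 0 < (q⁻¹)^3 by positivity)]
  have h5 : (q⁻¹)^3 ≤ (√M)^3 := by gcongr
  have h6 : (√M)^3 ≤ M^2 := by
    have h7 : √M ≤ M := Real.sqrt_le_iff.2 ⟨by linarith, by nlinarith⟩
    have h8 : (√M)^2 = M := Real.sq_sqrt (by linarith)
    nlinarith
  have h9 := H.bah _ h hx hh'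
  calc |ah (kap d x) h| / 2 * (q⁻¹)^3 ≤ M * M^2 := by
        refine mul_le_mul (by linarith [abs_nonneg (ah (kap d x) h)]) (h5.trans h6) (by positivity) (by linarith)
    _ = M^3 := by ring

lemma al_c1 (H : Loc a ax axx ah u ux uxx uh d M) (h : ℝ) : Continuous (fun x => al a d x h) :=
  H.al_cont.comp (f := fun x => (x, h)) (by fun_prop)

lemma Y_dx (H : Loc a ax axx ah u ux uxx uh d M) (x h : ℝ) :
    HasDerivAt (fun z => Yf a d z h) (al a d x h) x :=
  intervalIntegral.integral_hasDerivAt_right ((H.al_c1 h).intervalIntegrable _ _)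
    ((H.al_c1 h).stronglyMeasurableAtFilter _ _) (H.al_c1 h).continuousAt

lemma Y_mono (H : Loc a ax axx ah u ux uxx uh d M) {x x' : ℝ} (h : ℝ) (hx : x ≤ x') :
    (√M)⁻¹ * (x' - x) ≤ Yf a d x' h - Yf a d x h ∧ Yf a d x' h - Yf a d x h ≤ √M * (x' - x) := by
  have e : Yf a d x' h - Yf a d x h = ∫ z in x..x', al a d z h :=
    intervalIntegral.integral_interval_sub_left ((H.al_c1 h).intervalIntegrable _ _) ((H.al_c1 h).intervalIntegrable _ _)
  have b := fun z => H.sq_bd (kap_lt H.dp z) (kap_lt H.dp h)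
  have i := (H.al_c1 h).intervalIntegrable (μ := volume) x x'
  have h1 := intervalIntegral.integral_mono_on hx intervalIntegrable_const i (fun z _ => (b z).2.2.2)
  have h2 := intervalIntegral.integral_mono_on hx i intervalIntegrable_const (fun z _ => (b z).2.2.1)
  rw [intervalIntegral.integral_const, smul_eq_mul] at h1 h2
  rw [e]
  constructor <;> linarith

lemma Y_zero (h : ℝ) : Yf a d 0 h = 0 := by simp [Yf]

lemma Y_strict (H : Loc a ax axx ah u ux uxx uh d M) (h : ℝ) : StrictMono (fun x => Yf a d x h) := by
  intro x x' hx
  have h1 := (H.Y_mono h hx.le).1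
  have : 0 < (√M)⁻¹ * (x' - x) := by
    have := H.Mp
    have := sub_pos.2 hx
    positivity
  simp only; linarith

lemma Y_dh (H : Loc a ax axx ah u ux uxx uh d M) (x : ℝ) {h : ℝ} (hh : |h| < d/2) :
    IntervalIntegrable (fun z => deriv (al a d z) h) volume 0 x ∧
    HasDerivAt (fun k => Yf a d x k) (∫ z in (0:ℝ)..x, deriv (al a d z) h) h := by
  refine intervalIntegral.hasDerivAt_integral_of_dominated_loc_of_deriv_le (F := fun k z => al a d z k)
    (F' := fun k z => deriv (al a d z) k) (s := {k | |k| < d/2}) (bound := fun _ => M^3)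
    ((continuous_abs.tendsto h).eventually_lt_const hh) ?_ ((H.al_c1 h).intervalIntegrable _ _) ?_ ?_
    intervalIntegrable_const ?_
  · exact Eventually.of_forall fun k => (H.al_c1 k).aestronglyMeasurable
  · have := stronglyMeasurable_deriv_with_param (f := al a d) H.al_cont
    exact (this.comp_measurable (g := fun z => (z, h)) (by fun_prop)).aestronglyMeasurable
  · exact ae_of_all _ fun z _ k hk => (H.al_dh z hk).2
  · exact ae_of_all _ fun z _ k hk => (H.al_dh z hk).1

lemma Y_surj (H : Loc a ax axx ah u ux uxx uh d M) (h y : ℝ) : ∃ x, Yf a d x h = y := by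
  have M0 : 0 < √M := by have := H.Mp; positivity
  have hc : Continuous (fun x => Yf a d x h) := continuous_iff_continuousAt.2 fun x => (H.Y_dx x h).continuousAt
  have hp : 0 ≤ √M * |y| := by positivity
  have e1 := (H.Y_mono h hp).1
  have e2 := (H.Y_mono h (x := -(√M * |y|)) (x' := 0) (by linarith)).1
  rw [Y_zero] at e1 e2
  have e3 : (√M)⁻¹ * (√M * |y|) = |y| := by field_simp
  have := abs_le.1 (le_refl |y|)
  obtain ⟨x, -, hx⟩ := intermediate_value_Icc (show -(√M * |y|) ≤ √M * |y| by linarith) hc.continuousOn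
    (show y ∈ Icc _ _ from ⟨by linarith, by linarith⟩)
  exact ⟨x, hx⟩

lemma X_exists (H : Loc a ax axx ah u ux uxx uh d M) : ∃ Xf : ℝ → ℝ → ℝ, ∀ y h, Yf a d (Xf y h) h = y :=
  ⟨fun y h => (H.Y_surj h y).choose, fun y h => (H.Y_surj h y).choose_spec⟩

lemma Y_abs (H : Loc a ax axx ah u ux uxx uh d M) (x h : ℝ) :
    |x| ≤ √M * |Yf a d x h| ∧ |Yf a d x h| ≤ √M * |x| := by
  have M0 : 0 < √M := by have := H.Mp; positivity
  rcases le_total 0 x with hx | hx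
  · have e := H.Y_mono h hx
    rw [Y_zero, sub_zero, sub_zero] at e
    have h0 : 0 ≤ Yf a d x h := le_trans (by positivity) e.1
    rw [abs_of_nonneg hx, abs_of_nonneg h0]
    exact ⟨by have := e.1; rwa [inv_mul_le_iff₀ M0] at this, e.2⟩
  · have e := H.Y_mono h hx
    rw [Y_zero, zero_sub, zero_sub] at e
    have h0 : 0 ≤ -Yf a d x h := le_trans (mul_nonneg (by positivity) (by linarith)) e.1
    rw [abs_of_nonpos hx, abs_of_nonpos (by linarith)]
    exact ⟨by have := e.1; rwa [inv_mul_le_iff₀ M0] at this, e.2⟩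

lemma X_cont (H : Loc a ax axx ah u ux uxx uh d M) {Xf : ℝ → ℝ → ℝ} (hX : ∀ y h, Yf a d (Xf y h) h = y)
    (y : ℝ) {h : ℝ} (hh : |h| < d/2) : ContinuousAt (fun p : ℝ × ℝ => Xf p.1 p.2) (y, h) := by
  refine (nhds_basis_Ioo_pos _).tendsto_right_iff.2 fun ε ε0 => ?_
  have lo : Yf a d (Xf y h - ε) h < y := by
    have := H.Y_strict h (show Xf y h - ε < Xf y h by linarith)
    simpa only [hX] using this
  have hi : y < Yf a d (Xf y h + ε) h := by
    have := H.Y_strict h (show Xf y h < Xf y h + ε by linarith)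
    simpa only [hX] using this
  have cY : ∀ x, ContinuousAt (fun p : ℝ × ℝ => Yf a d x p.2) (y, h) := fun x =>
    ContinuousAt.comp (f := fun p : ℝ × ℝ => p.2) (g := fun k => Yf a d x k) (H.Y_dh x hh).2.continuousAt continuousAt_snd
  filter_upwards [(cY (Xf y h - ε)).eventually_lt continuousAt_fst lo,
    continuousAt_fst.eventually_lt (cY (Xf y h + ε)) hi] with p h1 h2
  rw [← hX p.1 p.2] at h1 h2
  have m := H.Y_strict p.2
  have h1' : Xf y h - ε < Xf p.1 p.2 := m.lt_iff_lt.1 (by simpa only [hX] using h1)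
  have h2' : Xf p.1 p.2 < Xf y h + ε := m.lt_iff_lt.1 (by simpa only [hX] using h2)
  exact ⟨h1', h2'⟩

lemma al_eq {x h : ℝ} (hx : |x| ≤ d/2) (hh : |h| ≤ d/2) : al a d x h = (√(a x h))⁻¹ := by
  rw [al, kap_eq hx, kap_eq hh]

lemma X_dy (H : Loc a ax axx ah u ux uxx uh d M) {Xf : ℝ → ℝ → ℝ} (hX : ∀ y h, Yf a d (Xf y h) h = y)
    {y h : ℝ} (hh : |h| < d/2) (hy : |Xf y h| < d/2) : HasDerivAt (fun y => Xf y h) (√(a (Xf y h) h)) y := by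
  have hd := H.dp
  have := HasDerivAt.of_local_left_inverse (f := fun z => Yf a d z h) (g := fun y => Xf y h) (a := y)
    (ContinuousAt.comp (f := fun y : ℝ => (y, h)) (H.X_cont hX y hh) (by fun_prop)) (H.Y_dx (Xf y h) h)
    (by rw [al_eq hy.le hh.le]; exact (inv_pos.2 (Real.sqrt_pos.2 (H.a_pos (by linarith) (by linarith)))).ne')
    (Eventually.of_forall fun y => hX y h)
  rwa [al_eq hy.le hh.le, inv_inv] at this

lemma X_dh (H : Loc a ax axx ah u ux uxx uh d M) {Xf : ℝ → ℝ → ℝ} (hX : ∀ y h, Yf a d (Xf y h) h = y)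
    {y h : ℝ} (hh : |h| < d/2) :
    HasDerivAt (fun k => Xf y k) (-(∫ z in (0:ℝ)..Xf y h, deriv (al a d z) h) / al a d (Xf y h) h) h := by
  have hd := H.dp
  refine impl (F := Yf a d) (Fx := al a d) (g := fun k => Xf y k) (Eventually.of_forall fun p => H.Y_dx _ _)
    H.al_cont.continuousAt (H.Y_dh _ hh).2 ?_
    (ContinuousAt.comp (f := fun k : ℝ => (y, k)) (H.X_cont hX y hh) (by fun_prop)) (fun k => hX y k)
  exact inv_pos.2 (Real.sqrt_pos.2 (H.a_pos (kap_lt hd _) (kap_lt hd _)))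

end Loc

lemma chi_exists {R : ℝ} (hR : 0 < R) : ∃ f f1 f2 : ℝ → ℝ, ∃ C : ℝ, 1 ≤ C ∧ (∀ y, HasDerivAt f (f1 y) y) ∧
    (∀ y, HasDerivAt f1 (f2 y) y) ∧ Continuous f2 ∧ (∀ y, |f y| ≤ C ∧ |f1 y| ≤ C ∧ |f2 y| ≤ C) ∧
    (∀ y, |y| < R/2 → f y = 1 ∧ f1 y = 0 ∧ f2 y = 0) ∧ (∀ y, 3*R/4 < |y| → f y = 0 ∧ f1 y = 0 ∧ f2 y = 0) := by
  let B : ContDiffBump (0:ℝ) := ⟨R/2, 3*R/4, by linarith, by linarith⟩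
  have h0 : ContDiff ℝ 2 B := B.contDiff
  have h1 : ContDiff ℝ 1 (deriv B) := h0.deriv'
  have h2 : ContDiff ℝ 0 (deriv (deriv B)) := h1.deriv'
  have cs : HasCompactSupport (B : ℝ → ℝ) := B.hasCompactSupport
  obtain ⟨C0, hC0⟩ := cs.exists_bound_of_continuous h0.continuous
  obtain ⟨C1, hC1⟩ := cs.deriv.exists_bound_of_continuous h1.continuous
  obtain ⟨C2, hC2⟩ := cs.deriv.deriv.exists_bound_of_continuous h2.continuous
  have loc : ∀ (k : ℝ) (y : ℝ), (B : ℝ → ℝ) =ᶠ[𝓝 y] (fun _ => k) → B y = k ∧ deriv B y = 0 ∧ deriv (deriv B) y = 0 := by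
    intro k y h
    have h' : deriv B =ᶠ[𝓝 y] fun _ => 0 := by
      have := h.deriv
      simpa using this
    refine ⟨h.self_of_nhds, h'.self_of_nhds, ?_⟩
    rw [h'.deriv_eq]; simp
  refine ⟨B, deriv B, deriv (deriv B), max 1 (max C0 (max C1 C2)), le_max_left _ _,
    fun y => (h0.differentiable (by norm_num) y).hasDerivAt, fun y => (h1.differentiable (by norm_num) y).hasDerivAt,
    h2.continuous, fun y => ⟨?_, ?_, ?_⟩, fun y hy => loc 1 y ?_, fun y hy => loc 0 y ?_⟩
  · exact (hC0 y).trans (by simp)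
  · exact (hC1 y).trans (by simp)
  · exact (hC2 y).trans (by simp)
  · filter_upwards [(continuous_abs.tendsto y).eventually_lt_const hy] with z hz
    exact B.one_of_mem_closedBall (by simpa [Real.dist_eq] using hz.le)
  · filter_upwards [(continuous_abs.tendsto y).eventually_const_lt hy] with z hz
    exact B.zero_of_le_dist (by simpa [Real.dist_eq] using hz.le)

lemma HI_of_cut {v v1 v2 vh : ℝ → ℝ → ℝ} {R K0 M r : ℝ} (hR : 0 < R) (hK : 0 < K0) (hM : 0 ≤ M) (hr : 0 < r)
    (d1 : ∀ y h, |y| < R → |h| < r → HasDerivAt (fun z => v z h) (v1 y h) y)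
    (d2 : ∀ y h, |y| < R → |h| < r → HasDerivAt (fun z => v1 z h) (v2 y h) y)
    (dh : ∀ y h, |y| < R → |h| < r → HasDerivAt (fun k => v y k) (vh y h) h)
    (c0 : ∀ y h, |y| < R → |h| < r → ContinuousAt (fun p : ℝ × ℝ => v p.1 p.2) (y, h))
    (c1 : ∀ y h, |y| < R → |h| < r → ContinuousAt (fun p : ℝ × ℝ => v1 p.1 p.2) (y, h))
    (c2 : ∀ y h, |y| < R → |h| < r → ContinuousAt (fun p : ℝ × ℝ => v2 p.1 p.2) (y, h))
    (ch : ∀ y h, |y| < R → |h| < r → ContinuousAt (fun y => vh y h) y)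
    (b0 : ∀ y h, |y| < R → |h| < r → |v y h| ≤ K0) (b1 : ∀ y h, |y| < R → |h| < r → |v1 y h| ≤ K0)
    (b2 : ∀ y h, |y| < R → |h| < r → |v2 y h| ≤ K0) (bh : ∀ y h, |y| < R → |h| < r → |vh y h| ≤ K0)
    (ineq : ∀ y h, |y| < R → |h| < r → |vh y h + v2 y h| ≤ M * (|v y h| + |v1 y h|)) :
    (∃ δ > 0, ∀ y, |y| < δ → v y 0 = 0) ∨ (∃ δ > 0, ∀ y, 0 < |y| → |y| < δ → v y 0 ≠ 0) := by
  obtain ⟨f, f1, f2, C, C1, hf, hf1, cf2, fb, fi, fo⟩ := chi_exists hR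
  have cf : Continuous f := continuous_iff_continuousAt.2 fun y => (hf y).continuousAt
  have cf1 : Continuous f1 := continuous_iff_continuousAt.2 fun y => (hf1 y).continuousAt
  set U : ℝ → ℝ → ℝ := fun y h => f y * v y h with hU
  set Uy : ℝ → ℝ → ℝ := fun y h => f1 y * v y h + f y * v1 y h with hUy
  set Uyy : ℝ → ℝ → ℝ := fun y h => f2 y * v y h + 2 * (f1 y * v1 y h) + f y * v2 y h with hUyy
  set Uh : ℝ → ℝ → ℝ := fun y h => f y * vh y h with hUh
  have z0 : ∀ y h, 3*R/4 < |y| → U y h = 0 ∧ Uy y h = 0 ∧ Uyy y h = 0 ∧ Uh y h = 0 := fun y h hy => by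
    obtain ⟨h0, h1, h2⟩ := fo y hy
    simp [hU, hUy, hUyy, hUh, h0, h1, h2]
  have out : ∀ y, R ≤ |y| → 3*R/4 < |y| := fun y hy => by linarith
  have ev : ∀ y, R ≤ |y| → ∀ᶠ z in 𝓝 y, 3*R/4 < |z| := fun y hy =>
    (continuous_abs.tendsto y).eventually_const_lt (out y hy)
  have ev' : ∀ y h, R ≤ |y| → ∀ᶠ p : ℝ × ℝ in 𝓝 (y, h), 3*R/4 < |p.1| := fun y h hy =>
    (continuousAt_fst (p := (y, h))).eventually (ev y hy)
  have bd : ∀ y h, |h| < r → |U y h| ≤ 8*C*K0 ∧ |Uy y h| ≤ 8*C*K0 ∧ |Uyy y h| ≤ 4*C*K0 ∧ |Uh y h| ≤ 4*C*K0 := fun y h hh => by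
    have p : 0 < C * K0 := by positivity
    rcases lt_or_ge |y| R with hy | hy
    · have m : ∀ g w : ℝ, |g| ≤ C → |w| ≤ K0 → |g * w| ≤ C * K0 := fun g w hg hw => by
        rw [abs_mul]; exact mul_le_mul hg hw (abs_nonneg _) (by linarith)
      obtain ⟨q0, q1, q2⟩ := fb y
      have e1 := m _ _ q0 (b0 y h hy hh)
      have e2 := m _ _ q1 (b0 y h hy hh)
      have e3 := m _ _ q2 (b0 y h hy hh)
      have e4 := m _ _ q0 (b1 y h hy hh)
      have e5 := m _ _ q1 (b1 y h hy hh)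
      have e6 := m _ _ q0 (b2 y h hy hh)
      have e7 := m _ _ q0 (bh y h hy hh)
      simp only [hU, hUy, hUyy, hUh]
      rw [abs_le] at *
      rw [abs_le, abs_le, abs_le]
      refine ⟨⟨?_, ?_⟩, ⟨?_, ?_⟩, ⟨?_, ?_⟩, ⟨?_, ?_⟩⟩ <;> linarith
    · obtain ⟨h0, h1, h2, h3⟩ := z0 y h (out y hy)
      simp only [h0, h1, h2, h3, abs_zero]
      refine ⟨?_, ?_, ?_, ?_⟩ <;> nlinarith
  have HH : HI U Uy Uyy Uh R (8*C*K0) M (√r) := by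
    have e : (√r)^2 = r := Real.sq_sqrt hr.le
    constructor <;> try rw [e]
    · exact hR
    · positivity
    · exact hM
    · positivity
    · exact fun y h _ hy => (z0 y h (out y hy)).1
    · exact fun y h _ hy => (z0 y h (out y hy)).2.1
    · exact fun y h _ hy => (z0 y h (out y hy)).2.2.1
    · intro y h hh
      rcases lt_or_ge |y| R with hy | hy
      · exact (hf y).fun_mul (d1 y h hy hh)
      · rw [(z0 y h (out y hy)).2.1]
        exact (hasDerivAt_const y 0).congr_of_eventuallyEq ((ev y hy).mono fun z hz => (z0 z h hz).1)
    · intro y h hh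
      rcases lt_or_ge |y| R with hy | hy
      · exact (((hf1 y).fun_mul (d1 y h hy hh)).fun_add ((hf y).fun_mul (d2 y h hy hh))).congr_deriv (by ring)
      · rw [(z0 y h (out y hy)).2.2.1]
        exact (hasDerivAt_const y 0).congr_of_eventuallyEq ((ev y hy).mono fun z hz => (z0 z h hz).2.1)
    · intro y h hh
      rcases lt_or_ge |y| R with hy | hy
      · exact (dh y h hy hh).const_mul (f y)
      · rw [(z0 y h (out y hy)).2.2.2]
        exact (hasDerivAt_const h 0).congr_of_eventuallyEq (Eventually.of_forall fun k => (z0 y k (out y hy)).1)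
    · intro y h hh
      rcases lt_or_ge |y| R with hy | hy
      · exact (cf.comp continuous_fst).continuousAt.mul (c0 y h hy hh)
      · exact continuousAt_const.congr ((ev' y h hy).mono fun p hp => (z0 p.1 p.2 hp).1.symm)
    · intro y h hh
      rcases lt_or_ge |y| R with hy | hy
      · exact ((cf1.comp continuous_fst).continuousAt.mul (c0 y h hy hh)).add
          ((cf.comp continuous_fst).continuousAt.mul (c1 y h hy hh))
      · exact continuousAt_const.congr ((ev' y h hy).mono fun p hp => (z0 p.1 p.2 hp).2.1.symm)
    · intro y h hh
      rcases lt_or_ge |y| R with hy | hy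
      · exact (((cf2.comp continuous_fst).continuousAt.mul (c0 y h hy hh)).add
          (continuousAt_const.mul ((cf1.comp continuous_fst).continuousAt.mul (c1 y h hy hh)))).add
          ((cf.comp continuous_fst).continuousAt.mul (c2 y h hy hh))
      · exact continuousAt_const.congr ((ev' y h hy).mono fun p hp => (z0 p.1 p.2 hp).2.2.1.symm)
    · intro h hh
      refine continuous_iff_continuousAt.2 fun y => ?_
      rcases lt_or_ge |y| R with hy | hy
      · exact cf.continuousAt.mul (ch y h hy hh)
      · exact continuousAt_const.congr ((ev y hy).mono fun z hz => (z0 z h hz).2.2.2.symm)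
    · exact fun y h hh => (bd y h hh).1
    · exact fun y h hh => (bd y h hh).2.1
    · exact fun y h hh => (bd y h hh).2.2.1.trans (by have : 0 < C * K0 := by positivity
                                                      linarith)
    · exact fun y h hh => (bd y h hh).2.2.2.trans (by have : 0 < C * K0 := by positivity
                                                      linarith)
    · intro y h hh hy
      obtain ⟨h0, h1, h2⟩ := fi y hy
      have := ineq y h (by linarith) hh
      simpa [hU, hUy, hUyy, hUh, h0, h1, h2] using this
    · intro y h hh
      obtain ⟨-, -, h1, h2⟩ := bd y h hh
      have h3 := abs_add_le (Uh y h) (Uyy y h)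
      have h4 : 0 ≤ M * (|U y h| + |Uy y h|) := by positivity
      linarith
  have R2 : 0 < R/2 := by linarith
  rcases HH.local_dichotomy with ⟨δ, δ0, h⟩ | ⟨δ, δ0, h⟩
  · refine Or.inl ⟨min δ (R/2), lt_min δ0 R2, fun y hy => ?_⟩
    have := h y (lt_of_lt_of_le hy (min_le_left _ _))
    simpa [hU, (fi y (lt_of_lt_of_le hy (min_le_right _ _))).1] using this
  · refine Or.inr ⟨min δ (R/2), lt_min δ0 R2, fun y h0 hy => ?_⟩
    have := h y h0 (lt_of_lt_of_le hy (min_le_left _ _))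
    simpa [hU, (fi y (lt_of_lt_of_le hy (min_le_right _ _))).1] using this

namespace Loc
variable {a ax axx ah u ux uxx uh : ℝ → ℝ → ℝ} {d M : ℝ}

lemma bd_of {f : ℝ → ℝ → ℝ} {d : ℝ} (hd : 0 < d)
    (hc : ∀ x h, |x| < d → |h| < d → ContinuousAt (fun p : ℝ × ℝ => f p.1 p.2) (x, h)) :
    ∃ B > 0, ∀ x h, |x| < d/2 → |h| < d/2 → |f x h| ≤ B := by
  have hk : IsCompact (Icc (-(d/2)) (d/2) ×ˢ Icc (-(d/2)) (d/2)) := isCompact_Icc.prod isCompact_Icc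
  obtain ⟨B, hB⟩ := hk.exists_bound_of_continuousOn (f := fun p : ℝ × ℝ => f p.1 p.2) fun p hp =>
    (hc p.1 p.2 (by have := abs_le.2 hp.1; linarith) (by have := abs_le.2 hp.2; linarith)).continuousWithinAt
  refine ⟨max B 1, by positivity, fun x h hx hh => le_trans ?_ (le_max_left _ _)⟩
  exact hB (x, h) ⟨abs_le.1 hx.le, abs_le.1 hh.le⟩

lemma dichotomy (H : Loc a ax axx ah u ux uxx uh d M) :
    (∃ δ > 0, ∀ x, |x| < δ → u x 0 = 0) ∨ (∃ δ > 0, ∀ x, 0 < |x| → |x| < δ → u x 0 ≠ 0) := by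
  have hd := H.dp
  have M1 := H.Mp
  have sM : 0 < √M := by positivity
  have sM2 : √M * √M = M := Real.mul_self_sqrt (by linarith)
  obtain ⟨B0, B0p, hB0⟩ := bd_of hd H.c0
  obtain ⟨B1, B1p, hB1⟩ := bd_of hd H.c1
  obtain ⟨B2, B2p, hB2⟩ := bd_of hd H.c2
  obtain ⟨B3, B3p, hB3⟩ := bd_of hd H.ch
  obtain ⟨Xf, hX⟩ := H.X_exists
  set R := d/2/√M with hR
  have R0 : 0 < R := by positivity
  have Xb : ∀ y h, |y| < R → |Xf y h| < d/2 := fun y h hy => by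
    have := (H.Y_abs (Xf y h) h).1
    rw [hX] at this
    rw [hR, lt_div_iff₀ sM] at hy
    linarith
  have lt' : ∀ {z : ℝ}, |z| < d/2 → |z| < d := fun h => by linarith
  have evX : ∀ y h, |y| < R → |h| < d/2 → ∀ᶠ z in 𝓝 y, |Xf z h| < d/2 := fun y h hy _ =>
    ((continuous_abs.tendsto y).eventually_lt_const hy).mono fun z hz => Xb z h hz
  set Yh : ℝ → ℝ → ℝ := fun x h => ∫ z in (0:ℝ)..x, deriv (al a d z) h with hYh
  set Xh : ℝ → ℝ → ℝ := fun y h => -(Yh (Xf y h) h) / al a d (Xf y h) h with hXh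
  have comp : ∀ {f : ℝ → ℝ → ℝ}, (∀ x h, |x| < d → |h| < d → ContinuousAt (fun p : ℝ × ℝ => f p.1 p.2) (x, h)) →
      ∀ y h, |y| < R → |h| < d/2 → ContinuousAt (fun p : ℝ × ℝ => f (Xf p.1 p.2) p.2) (y, h) := fun {f} hf y h hy hh =>
    ContinuousAt.comp (f := fun p : ℝ × ℝ => (Xf p.1 p.2, p.2)) (hf _ _ (lt' (Xb y h hy)) (lt' hh))
      ((H.X_cont hX y hh).prodMk continuousAt_snd)
  have ca := comp (f := a) (fun x h hx hh => H.ca hx hh)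
  have cax := comp (f := ax) (fun x h hx hh => H.cax hx hh)
  have c0 := comp H.c0
  have c1 := comp H.c1
  have c2 := comp H.c2
  have ch := comp H.ch
  have slc : ∀ {f : ℝ → ℝ → ℝ} {y h : ℝ}, ContinuousAt (fun p : ℝ × ℝ => f p.1 p.2) (y, h) → ContinuousAt (fun z => f z h) y :=
    fun {f y h} hf => ContinuousAt.comp (f := fun z : ℝ => (z, h)) hf (by fun_prop)
  have Yhb : ∀ x h, |h| < d/2 → |Yh x h| ≤ M^3 * |x| := fun x h hh => by
    have := intervalIntegral.norm_integral_le_of_norm_le_const (a := 0) (b := x) (f := fun z => deriv (al a d z) h)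
      (C := M^3) (fun z _ => (H.al_dh z hh).2)
    simpa using this
  have Xhb : ∀ y h, |y| < R → |h| < d/2 → |Xh y h| ≤ M^3 * d * √M := fun y h hy hh => by
    have hx := Xb y h hy
    have b := H.sq_bd (lt' hx) (lt' hh)
    have q0 : 0 < √(a (Xf y h) h) := Real.sqrt_pos.2 (H.a_pos (lt' hx) (lt' hh))
    simp only [hXh]
    rw [al_eq hx.le hh.le, div_inv_eq_mul, abs_mul, abs_neg, abs_of_pos q0]
    refine mul_le_mul ((Yhb _ h hh).trans ?_) b.2.1 q0.le (by positivity)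
    gcongr
    linarith
  have main := HI_of_cut (v := fun y h => u (Xf y h) h) (v1 := fun y h => √(a (Xf y h) h) * ux (Xf y h) h)
    (v2 := fun y h => a (Xf y h) h * uxx (Xf y h) h + 1/2 * (ax (Xf y h) h * ux (Xf y h) h))
    (vh := fun y h => ux (Xf y h) h * Xh y h + uh (Xf y h) h) (R := R) (r := d/2)
    (K0 := B0 + √M * B1 + (M * B2 + 1/2 * (M * B1)) + (B1 * (M^3 * d * √M) + B3))
    (M := M + √M * (2 * M + M^3 * d * √M)) R0 (by positivity) (by positivity) (by linarith)
    ?_ ?_ ?_ c0 ?_ ?_ ?_ ?_ ?_ ?_ ?_ ?_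
  · have X0 : ∀ x, |x| < d/2 → Xf (Yf a d x 0) 0 = x := fun x _ => (H.Y_strict 0).injective (hX _ 0)
    have p : ∀ δ > 0, 0 < min (d/2) (δ/√M) := fun δ h => lt_min (by linarith) (by positivity)
    have q : ∀ δ > 0, ∀ x, |x| < min (d/2) (δ/√M) → |x| < d/2 ∧ |Yf a d x 0| < δ := fun δ _ x hx => by
      refine ⟨lt_of_lt_of_le hx (min_le_left _ _), ?_⟩
      have h1 := lt_of_lt_of_le hx (min_le_right _ _)
      rw [lt_div_iff₀ sM] at h1
      have := (H.Y_abs x 0).2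
      linarith
    rcases main with ⟨δ, δ0, h⟩ | ⟨δ, δ0, h⟩
    · refine Or.inl ⟨_, p δ δ0, fun x hx => ?_⟩
      obtain ⟨h1, h2⟩ := q δ δ0 x hx
      have := h _ h2
      rwa [X0 x h1] at this
    · refine Or.inr ⟨_, p δ δ0, fun x h0 hx => ?_⟩
      obtain ⟨h1, h2⟩ := q δ δ0 x hx
      have h3 : 0 < |Yf a d x 0| := by
        have := (H.Y_abs x 0).1
        by_contra h4
        have h5 : |Yf a d x 0| = 0 := le_antisymm (not_lt.1 h4) (abs_nonneg _)
        rw [h5] at this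
        linarith
      have := h _ h3 h2
      rwa [X0 x h1] at this
  · intro y h hy hh
    have hx := Xb y h hy
    exact ((H.dux _ _ (lt' hx) (lt' hh)).comp y (H.X_dy hX hh hx)).congr_deriv (mul_comm _ _)
  · intro y h hy hh
    have hx := Xb y h hy
    have ap := H.a_pos (lt' hx) (lt' hh)
    have q0 := Real.sqrt_pos.2 ap
    have q2 := Real.mul_self_sqrt ap.le
    have e1 := (((H.dax _ _ (lt' hx) (lt' hh)).sqrt ap.ne').fun_mul (H.duxx _ _ (lt' hx) (lt' hh))).comp y (H.X_dy hX hh hx)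
    refine e1.congr_deriv ?_
    set q := √(a (Xf y h) h)
    rw [← q2]
    field_simp
    ring
  · intro y h hy hh
    have hx := Xb y h hy
    have := chain2 (f := u) (f1 := ux) (p := fun k => Xf y k) (q := fun k => k) (r := h)
      ((ev2 (lt' hx) (lt' hh)).mono fun p hp => H.dux _ _ hp.1 hp.2) (H.c1 _ _ (lt' hx) (lt' hh))
      (H.duh _ _ (lt' hx) (lt' hh)) (H.X_dh hX hh) (hasDerivAt_id h)
    exact this.congr_deriv (by simp only [hXh, hYh]; ring)
  · intro y h hy hh
    exact (Real.continuous_sqrt.continuousAt.comp (ca y h hy hh)).mul (c1 y h hy hh)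
  · intro y h hy hh
    exact ((ca y h hy hh).mul (c2 y h hy hh)).add (continuousAt_const.mul ((cax y h hy hh).mul (c1 y h hy hh)))
  · intro y h hy hh
    have hx := Xb y h hy
    have cX := slc (f := Xf) (H.X_cont hX y hh)
    have cY : Continuous (fun x => Yh x h) := by
      refine intervalIntegral.continuous_primitive (fun p q => ?_) 0
      exact (H.Y_dh p hh).1.symm.trans (H.Y_dh q hh).1
    have cXh : ContinuousAt (fun z => Xh z h) y := by
      refine ((cY.continuousAt.comp cX).neg).div ((H.al_c1 h).continuousAt.comp cX) ?_
      exact (inv_pos.2 (Real.sqrt_pos.2 (H.a_pos (kap_lt hd _) (kap_lt hd _)))).ne'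
    exact ((slc (f := fun z k => ux (Xf z k) k) (c1 y h hy hh)).mul cXh).add (slc (f := fun z k => uh (Xf z k) k) (ch y h hy hh))
  · intro y h hy hh
    refine (hB0 _ _ (Xb y h hy) hh).trans ?_
    rw [add_assoc, add_assoc]
    exact le_add_of_nonneg_right (by positivity)
  · intro y h hy hh
    have hx := Xb y h hy
    have e : |√(a (Xf y h) h) * ux (Xf y h) h| ≤ √M * B1 := by
      rw [abs_mul, abs_of_nonneg (Real.sqrt_nonneg _)]
      exact mul_le_mul (H.sq_bd (lt' hx) (lt' hh)).2.1 (hB1 _ _ hx hh) (abs_nonneg _) sM.le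
    have : 0 ≤ B0 + ((M * B2 + 1/2 * (M * B1)) + (B1 * (M^3 * d * √M) + B3)) := by positivity
    linarith
  · intro y h hy hh
    have hx := Xb y h hy
    have e1 : |a (Xf y h) h * uxx (Xf y h) h| ≤ M * B2 := by
      rw [abs_mul, abs_of_pos (H.a_pos (lt' hx) (lt' hh))]
      exact mul_le_mul (H.ahi _ _ (lt' hx) (lt' hh)) (hB2 _ _ hx hh) (abs_nonneg _) (by linarith)
    have e2 : |ax (Xf y h) h * ux (Xf y h) h| ≤ M * B1 := by
      rw [abs_mul]
      exact mul_le_mul (H.bax _ _ (lt' hx) (lt' hh)) (hB1 _ _ hx hh) (abs_nonneg _) (by linarith)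
    have : 0 ≤ B0 + √M * B1 + (B1 * (M^3 * d * √M) + B3) := by positivity
    have e3 := abs_add_le (a (Xf y h) h * uxx (Xf y h) h) (1/2 * (ax (Xf y h) h * ux (Xf y h) h))
    rw [abs_mul (1/2 : ℝ), abs_of_pos (show (0:ℝ) < 1/2 by norm_num)] at e3
    linarith
  · intro y h hy hh
    have hx := Xb y h hy
    have e1 : |ux (Xf y h) h * Xh y h| ≤ B1 * (M^3 * d * √M) := by
      rw [abs_mul]
      exact mul_le_mul (hB1 _ _ hx hh) (Xhb y h hy hh) (abs_nonneg _) B1p.le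
    have : 0 ≤ B0 + √M * B1 + (M * B2 + 1/2 * (M * B1)) := by positivity
    have e3 := abs_add_le (ux (Xf y h) h * Xh y h) (uh (Xf y h) h)
    have := hB3 _ _ hx hh
    linarith
  · intro y h hy hh
    have hx := Xb y h hy
    have e0 := H.ineq _ _ (lt' hx) (lt' hh)
    have e1 := Xhb y h hy hh
    have e2 := H.bax _ _ (lt' hx) (lt' hh)
    have b := (H.sq_bd (lt' hx) (lt' hh)).2.2.1
    have q0 := Real.sqrt_pos.2 (H.a_pos (lt' hx) (lt' hh))
    set q := √(a (Xf y h) h)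
    set w := ux (Xf y h) h
    set x := Xf y h
    have e3 : |w| ≤ √M * |q * w| := by
      rw [abs_mul, abs_of_pos q0, ← mul_assoc]
      have : 1 ≤ √M * q := by rw [inv_le_iff_one_le_mul₀ q0] at b; exact b
      exact le_mul_of_one_le_left (abs_nonneg _) this
    have e4 : |w * (Xh y h + 1/2 * ax x h)| ≤ (√M * |q * w|) * (M + M^3 * d * √M) := by
      rw [abs_mul]
      refine mul_le_mul e3 ?_ (abs_nonneg _) (by positivity)
      have := abs_add_le (Xh y h) (1/2 * ax x h)
      rw [abs_mul (1/2 : ℝ), abs_of_pos (show (0:ℝ) < 1/2 by norm_num)] at this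
      linarith [abs_nonneg (ax x h)]
    have e5 := abs_add_le (uh x h + a x h * uxx x h) (w * (Xh y h + 1/2 * ax x h))
    have e6 : w * Xh y h + uh x h + (a x h * uxx x h + 1/2 * (ax x h * w)) =
      (uh x h + a x h * uxx x h) + (w * (Xh y h + 1/2 * ax x h)) := by ring
    rw [e6]
    have e7 : M * |w| ≤ √M * M * |q * w| := by nlinarith
    have e8 : 0 ≤ √M * (2 * M + M^3 * d * √M) * |u x h| := by positivity
    have e9 : 0 ≤ M * |q * w| := by positivity
    linarith

end Loc

structure SP (T X : ℝ) (xi : ℝ → ℝ) (a b c u : ℝ → ℝ → ℝ) (M : ℝ) : Prop where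
  xc : ContinuousOn xi (Icc 0 T)
  xlt : ∀ t ∈ Icc (0:ℝ) T, xi t < X
  sol : IsClassicalSolution a b c xi (fun _ => X) T u
  M1 : 1 ≤ M
  reg : ∀ p ∈ domLat xi (fun _ => X) T,
    0 < a p.1 p.2 ∧
    DifferentiableAt ℝ (fun y => a y p.2) p.1 ∧
    DifferentiableAt ℝ (fun y => pdx a y p.2) p.1 ∧
    DifferentiableAt ℝ (fun s => a p.1 s) p.2 ∧
    |a p.1 p.2| ≤ M ∧ |(a p.1 p.2)⁻¹| ≤ M ∧ |pdt a p.1 p.2| ≤ M ∧ |pdx a p.1 p.2| ≤ M ∧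
    |pdxx a p.1 p.2| ≤ M ∧ |b p.1 p.2| ≤ M ∧ |c p.1 p.2| ≤ M
  hX : ∀ t ∈ Icc (0:ℝ) T, u X t ≠ 0

lemma SP.of {T X : ℝ} {xi : ℝ → ℝ} {a b c u : ℝ → ℝ → ℝ}
    (hxc : ContinuousOn xi (Icc 0 T)) (hxlt : ∀ t ∈ Icc (0:ℝ) T, xi t < X)
    (hsol : IsClassicalSolution a b c xi (fun _ => X) T u)
    (hreg : Reg12 a b c xi (fun _ => X) T) (hX : ∀ t ∈ Icc (0:ℝ) T, u X t ≠ 0) :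
    ∃ M, SP T X xi a b c u M := by
  obtain ⟨M, hM⟩ := hreg
  have m := le_max_left M 1
  refine ⟨max M 1, hxc, hxlt, hsol, le_max_right _ _, fun p hp => ?_, hX⟩
  obtain ⟨h1, h2, h3, h4, -, -, h5, h6, h7, h8, h9, h10, -, -, h11⟩ := hM p hp
  exact ⟨h1, h2, h3, h4, h5.trans m, h6.trans m, h7.trans m, h8.trans m, h9.trans m, h10.trans m, h11.trans m⟩

namespace SP
variable {T X : ℝ} {xi : ℝ → ℝ} {a b c u : ℝ → ℝ → ℝ} {M : ℝ}

lemma neg (H : SP T X xi a b c u M) : SP T X xi a b c (fun x t => -u x t) M := by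
  have e1 : ∀ x t, pdx (fun x t => -u x t) x t = -pdx u x t := fun x t => by simp [pdx]
  have e2 : ∀ x t, pdxx (fun x t => -u x t) x t = -pdxx u x t := fun x t => by simp [pdxx, e1]
  have e3 : ∀ x t, pdt (fun x t => -u x t) x t = -pdt u x t := fun x t => by simp [pdt]
  refine ⟨H.xc, H.xlt, ⟨H.sol.cont.neg, fun p hp => (H.sol.diff_x p hp).fun_neg, fun p hp => ?_,
    fun p hp => (H.sol.diff_t p hp).fun_neg, ?_, ?_, ?_, fun p hp => ?_⟩, H.M1, H.reg, fun t ht => neg_ne_zero.2 (H.hX t ht)⟩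
  · simp only [e1]; exact (H.sol.diff_xx p hp).fun_neg
  · simp only [e1]; exact H.sol.cont_x.neg
  · simp only [e2]; exact H.sol.cont_xx.neg
  · simp only [e3]; exact H.sol.cont_t.neg
  · rw [e1, e2, e3, H.sol.eqn p hp]; ring

lemma xi_at (H : SP T X xi a b c u M) {t : ℝ} (ht : t ∈ Ioo 0 T) : ContinuousAt xi t :=
  H.xc.continuousAt (Icc_mem_nhds ht.1 ht.2)

lemma nh (H : SP T X xi a b c u M) {x t : ℝ} (ht : t ∈ Ioo 0 T) (hx : x ∈ Ioo (xi t) X) :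
    ∀ᶠ p : ℝ × ℝ in 𝓝 (x, t), p.2 ∈ Ioo 0 T ∧ p.1 ∈ Ioo (xi p.2) X := by
  have h1 : ∀ᶠ p : ℝ × ℝ in 𝓝 (x, t), p.2 ∈ Ioo 0 T := continuousAt_snd.eventually (Ioo_mem_nhds ht.1 ht.2)
  have h2 : ∀ᶠ p : ℝ × ℝ in 𝓝 (x, t), xi p.2 < p.1 :=
    ContinuousAt.eventually_lt (ContinuousAt.comp (f := fun p : ℝ × ℝ => p.2) (H.xi_at ht) continuousAt_snd) continuousAt_fst hx.1
  have h3 : ∀ᶠ p : ℝ × ℝ in 𝓝 (x, t), p.1 < X := continuousAt_fst.eventually_lt continuousAt_const hx.2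
  filter_upwards [h1, h2, h3] with p h1 h2 h3 using ⟨h1, h2, h3⟩

lemma lat {x t : ℝ} (ht : t ∈ Ioo 0 T) (hx : x ∈ Ioo (xi t) X) : (x, t) ∈ domLat xi (fun _ => X) T :=
  ⟨⟨ht.1, ht.2.le⟩, hx.1.le, hx.2.le⟩

lemma latn (H : SP T X xi a b c u M) {x t : ℝ} (ht : t ∈ Ioo 0 T) (hx : x ∈ Ioo (xi t) X) :
    domLat xi (fun _ => X) T ∈ 𝓝 (x, t) := by
  filter_upwards [H.nh ht hx] with p hp using lat hp.1 hp.2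

lemma uc (H : SP T X xi a b c u M) {x t : ℝ} (ht : t ∈ Ioo 0 T) (hx : x ∈ Ioo (xi t) X) :
    ContinuousAt (fun p : ℝ × ℝ => u p.1 p.2) (x, t) :=
  H.sol.cont.continuousAt (mem_of_superset (H.latn ht hx) fun _ hp => ⟨⟨hp.1.1.le, hp.1.2⟩, hp.2⟩)

lemma loc (H : SP T X xi a b c u M) {x t : ℝ} (ht : t ∈ Ioo 0 T) (hx : x ∈ Ioo (xi t) X) :
    (∀ᶠ z in 𝓝 x, u z t = 0) ∨ (∀ᶠ z in 𝓝[≠] x, u z t ≠ 0) := by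
  obtain ⟨d, d0, hd⟩ := Metric.eventually_nhds_iff.1 (H.nh ht hx)
  have Q : ∀ y h, |y| < d → |h| < d → t - h ∈ Ioo 0 T ∧ x + y ∈ Ioo (xi (t - h)) X := fun y h hy hh => by
    refine hd (y := (x + y, t - h)) ?_
    rw [Prod.dist_eq]; simp [hy, hh]
  have D : ∀ y h, |y| < d → |h| < d → (x + y, t - h) ∈ domLat xi (fun _ => X) T := fun y h hy hh =>
    lat (Q y h hy hh).1 (Q y h hy hh).2
  have sx : ∀ {f : ℝ → ℝ} {y : ℝ}, DifferentiableAt ℝ f (x + y) → HasDerivAt (fun z => f (x + z)) (deriv f (x + y)) y :=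
    fun {f y} hf => HasDerivAt.comp_const_add x y hf.hasDerivAt
  have st : ∀ {f : ℝ → ℝ} {h : ℝ}, DifferentiableAt ℝ f (t - h) → HasDerivAt (fun k => f (t - k)) (-deriv f (t - h)) h :=
    fun {f h} hf => HasDerivAt.comp_const_sub t h hf.hasDerivAt
  have sc : ∀ {f : ℝ → ℝ → ℝ}, ContinuousOn (fun p : ℝ × ℝ => f p.1 p.2) (domLat xi (fun _ => X) T) →
      ∀ y h, |y| < d → |h| < d → ContinuousAt (fun p : ℝ × ℝ => f (x + p.1) (t - p.2)) (y, h) := fun {f} hf y h hy hh =>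
    ContinuousAt.comp (f := fun p : ℝ × ℝ => (x + p.1, t - p.2))
      (hf.continuousAt (H.latn (Q y h hy hh).1 (Q y h hy hh).2)) (by fun_prop)
  have L : Loc (fun y h => a (x + y) (t - h)) (fun y h => pdx a (x + y) (t - h)) (fun y h => pdxx a (x + y) (t - h))
      (fun y h => -pdt a (x + y) (t - h)) (fun y h => u (x + y) (t - h)) (fun y h => pdx u (x + y) (t - h))
      (fun y h => pdxx u (x + y) (t - h)) (fun y h => -pdt u (x + y) (t - h)) d M := by
    have M1 := H.M1
    refine ⟨d0, M1, fun y h hy hh => ?_, fun y h hy hh => ?_, fun y h hy hh => sx (H.reg _ (D y h hy hh)).2.1,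
      fun y h hy hh => sx (H.reg _ (D y h hy hh)).2.2.1, fun y h hy hh => st (H.reg _ (D y h hy hh)).2.2.2.1,
      fun y h hy hh => (H.reg _ (D y h hy hh)).2.2.2.2.2.2.2.1, fun y h hy hh => (H.reg _ (D y h hy hh)).2.2.2.2.2.2.2.2.1,
      fun y h hy hh => (abs_neg _).trans_le (H.reg _ (D y h hy hh)).2.2.2.2.2.2.1,
      fun y h hy hh => sx (H.sol.diff_x _ (D y h hy hh)), fun y h hy hh => sx (H.sol.diff_xx _ (D y h hy hh)),
      fun y h hy hh => st (H.sol.diff_t _ (D y h hy hh)),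
      sc (H.sol.cont.mono fun _ hp => ⟨⟨hp.1.1.le, hp.1.2⟩, hp.2⟩), sc H.sol.cont_x, sc H.sol.cont_xx,
      fun y h hy hh => (sc H.sol.cont_t y h hy hh).neg, fun y h hy hh => ?_⟩
    · have r := H.reg _ (D y h hy hh)
      exact inv_le_of_inv_le₀ r.1 ((le_abs_self _).trans r.2.2.2.2.2.1)
    · exact (le_abs_self _).trans (H.reg _ (D y h hy hh)).2.2.2.2.1
    · have r := H.reg _ (D y h hy hh)
      have e := H.sol.eqn _ (D y h hy hh)
      simp only at e r ⊢
      rw [e]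
      have h1 : |b (x + y) (t - h) * pdx u (x + y) (t - h)| ≤ M * |pdx u (x + y) (t - h)| := by
        rw [abs_mul]; exact mul_le_mul_of_nonneg_right r.2.2.2.2.2.2.2.2.2.1 (abs_nonneg _)
      have h2 : |c (x + y) (t - h) * u (x + y) (t - h)| ≤ M * |u (x + y) (t - h)| := by
        rw [abs_mul]; exact mul_le_mul_of_nonneg_right r.2.2.2.2.2.2.2.2.2.2 (abs_nonneg _)
      rw [abs_le] at *
      constructor <;> linarith
  rcases L.dichotomy with ⟨δ, δ0, h⟩ | ⟨δ, δ0, h⟩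
  · refine Or.inl (Metric.eventually_nhds_iff.2 ⟨δ, δ0, fun z hz => ?_⟩)
    have := h (z - x) hz
    simpa using this
  · refine Or.inr (eventually_nhdsWithin_iff.2 (Metric.eventually_nhds_iff.2 ⟨δ, δ0, fun z hz hne => ?_⟩))
    have := h (z - x) (abs_pos.2 (sub_ne_zero.2 hne)) hz
    simpa using this

lemma cx (H : SP T X xi a b c u M) {t : ℝ} (ht : t ∈ Icc 0 T) : ContinuousOn (fun x => u x t) (Icc (xi t) X) :=
  H.sol.cont.comp (f := fun x => (x, t)) (by fun_prop) fun _ hx => ⟨ht, hx⟩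

lemma iso (H : SP T X xi a b c u M) {x t : ℝ} (ht : t ∈ Ioo 0 T) (hx : x ∈ Ioo (xi t) X) :
    ∀ᶠ z in 𝓝[≠] x, u z t ≠ 0 := by
  set A := {x : ℝ | ∀ᶠ z in 𝓝 x, u z t = 0} with hA
  set B := {x : ℝ | ∀ᶠ z in 𝓝[≠] x, u z t ≠ 0} with hB
  have tc : t ∈ Icc 0 T := ⟨ht.1.le, ht.2.le⟩
  have oB : IsOpen B := by
    rw [isOpen_iff_mem_nhds]
    intro z hz
    obtain ⟨V, hV, hV2, hV3⟩ := eventually_nhds_iff.1 (eventually_nhdsWithin_iff.1 hz)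
    filter_upwards [hV2.mem_nhds hV3] with w hw
    rcases eq_or_ne w z with rfl | hne
    · exact hz
    · refine eventually_nhdsWithin_iff.2 ?_
      filter_upwards [hV2.mem_nhds hw, isOpen_ne.mem_nhds hne] with v h1 h2 _ using hV v h1 h2
  have disj : Disjoint A B := Set.disjoint_left.2 fun z h1 h2 => by
    have h1n : ∀ᶠ w in 𝓝[≠] z, u w t = 0 := nhdsWithin_le_nhds h1
    obtain ⟨w, h3, h4⟩ := (h1n.and h2).exists
    exact h4 h3
  rcases H.loc ht hx with h | h
  · have sub := isPreconnected_Ioo.subset_left_of_subset_union isOpen_setOfPred_eventually_nhds oB disj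
      (fun z hz => H.loc ht hz) ⟨x, hx, h⟩
    exfalso
    have h1 : Tendsto (fun z => u z t) (𝓝[Ioo (xi t) X] X) (𝓝 (u X t)) :=
      ((H.cx tc) X (right_mem_Icc.2 (H.xlt t tc).le)).mono Ioo_subset_Icc_self
    have h2 : Tendsto (fun z => u z t) (𝓝[Ioo (xi t) X] X) (𝓝 0) :=
      tendsto_const_nhds.congr' (eventually_nhdsWithin_of_forall fun z hz => ((sub hz : ∀ᶠ z in 𝓝 z, u z t = 0).self_of_nhds).symm)
    have : (𝓝[Ioo (xi t) X] X).NeBot := by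
      rw [← mem_closure_iff_nhdsWithin_neBot, closure_Ioo (H.xlt t tc).ne]
      exact right_mem_Icc.2 (H.xlt t tc).le
    exact H.hX t tc (tendsto_nhds_unique h1 h2)
  · exact h

lemma fin (H : SP T X xi a b c u M) {t : ℝ} (ht : t ∈ Ioo 0 T) (h0 : u (xi t) t ≠ 0) :
    (zeroSet u xi (fun _ => X) t).Finite := by
  have tc : t ∈ Icc 0 T := ⟨ht.1.le, ht.2.le⟩
  by_contra hinf
  obtain ⟨x, hx, hacc⟩ := Set.Infinite.exists_accPt_of_subset_isCompact hinf (isCompact_Icc (a := xi t) (b := X)) (fun z hz => hz.1)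
  have fr : ∃ᶠ z in 𝓝[≠] x, z ∈ zeroSet u xi (fun _ => X) t := accPt_iff_frequently_nhdsNE.1 hacc
  have ux : u x t = 0 := by
    have h1 : Tendsto (fun z => u z t) (𝓝[Icc (xi t) X] x) (𝓝 (u x t)) := H.cx tc x hx
    by_contra hne
    have h2 := eventually_nhdsWithin_iff.1 (h1.eventually_ne hne)
    obtain ⟨z, h3, h4⟩ := (fr.and_eventually (nhdsWithin_le_nhds h2)).exists
    exact h4 h3.1 h3.2
  have hxo : x ∈ Ioo (xi t) X := by
    refine ⟨lt_of_le_of_ne hx.1 ?_, lt_of_le_of_ne hx.2 ?_⟩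
    · rintro rfl; exact h0 ux
    · rintro rfl; exact H.hX t tc ux
  obtain ⟨z, h3, h4⟩ := (fr.and_eventually (H.iso ht hxo)).exists
  exact h4 h3.2

end SP

lemma d2_max {f f' : ℝ → ℝ} {x f'' : ℝ} (h : ∀ᶠ z in 𝓝 x, HasDerivAt f (f' z) z)
    (h2 : HasDerivAt f' f'' x) (hm : IsLocalMax f x) : f' x = 0 ∧ f'' ≤ 0 := by
  have h0 : f' x = 0 := hm.hasDerivAt_eq_zero h.self_of_nhds
  refine ⟨h0, ?_⟩
  by_contra hp
  push Not at hp
  have e : deriv f =ᶠ[𝓝 x] f' := h.mono fun z hz => hz.deriv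
  have m := isLocalMin_of_deriv_deriv_pos (f := f) (x₀ := x) (by rw [e.deriv_eq, h2.deriv]; exact hp)
    (by rw [h.self_of_nhds.deriv, h0]) h.self_of_nhds.continuousAt
  have k : f =ᶠ[𝓝 x] fun _ => f x := by
    filter_upwards [m, hm] with z h1 h2 using le_antisymm h2 h1
  have k2 : deriv f =ᶠ[𝓝 x] fun _ => 0 := by
    filter_upwards [k.deriv] with z hz
    rw [hz]; simp
  have := (e.symm.trans k2).deriv_eq
  rw [h2.deriv] at this
  simp at this
  linarith

lemma left_lt {g : ℝ → ℝ} {g' r : ℝ} (h : HasDerivAt g g' r) (hp : 0 < g') : ∀ᶠ t in 𝓝[<] r, g t < g r := by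
  have h1 := (hasDerivAt_iff_tendsto_slope.1 h).eventually (lt_mem_nhds hp)
  have h2 : ∀ᶠ t in 𝓝[<] r, 0 < slope g r t := nhdsWithin_mono r (fun t (ht : t < r) => ht.ne) h1
  filter_upwards [h2, self_mem_nhdsWithin] with t h3 h4
  have h4 : t < r := h4
  rw [slope_def_field] at h3
  rcases div_pos_iff.1 h3 with ⟨_, h5⟩ | ⟨h5, _⟩ <;> linarith

/-- the weak maximum principle on the region between `l` and `β` -/
lemma weakMP {w wx wxx wt a b c : ℝ → ℝ → ℝ} {l : ℝ → ℝ} {t1 s β M : ℝ} (hl : ContinuousOn l (Icc t1 s))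
    (hw : ContinuousOn (fun p : ℝ × ℝ => w p.1 p.2) {p | p.2 ∈ Icc t1 s ∧ p.1 ∈ Icc (l p.2) β})
    (int : ∀ x r, t1 < r → r ≤ s → l r < x → x < β → HasDerivAt (fun z => w z r) (wx x r) x ∧
      HasDerivAt (fun z => wx z r) (wxx x r) x ∧ HasDerivAt (fun q => w x q) (wt x r) r ∧ 0 ≤ a x r ∧ c x r ≤ M ∧
      a x r * wxx x r + b x r * wx x r + c x r * w x r ≤ wt x r)
    (bot : ∀ x, l t1 ≤ x → x ≤ β → 0 ≤ w x t1) (lft : ∀ r ∈ Icc t1 s, l r ≤ β → 0 ≤ w (l r) r)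
    (rgt : ∀ r ∈ Icc t1 s, l r ≤ β → 0 ≤ w β r) : ∀ x r, r ∈ Icc t1 s → x ∈ Icc (l r) β → 0 ≤ w x r := by
  intro x r hr hx
  by_contra hneg
  push Not at hneg
  set R : Set (ℝ × ℝ) := {p | p.2 ∈ Icc t1 s ∧ p.1 ∈ Icc (l p.2) β} with hR
  obtain ⟨m, hm⟩ := (isCompact_Icc.image_of_continuousOn hl).bddBelow
  have cR : IsCompact R := by
    refine IsCompact.of_isClosed_subset (isCompact_Icc (a := m) (b := β) |>.prod (isCompact_Icc (a := t1) (b := s))) ?_ ?_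
    · have h1 : IsClosed {p : ℝ × ℝ | p.2 ∈ Icc t1 s} := isClosed_Icc.preimage continuous_snd
      have h2 : ContinuousOn (fun p : ℝ × ℝ => p.1 - l p.2) {p : ℝ × ℝ | p.2 ∈ Icc t1 s} :=
        continuousOn_fst.sub (hl.comp continuousOn_snd fun p hp => hp)
      have h3 := (h2.preimage_isClosed_of_isClosed h1 (isClosed_Ici (a := 0))).inter
        ((isClosed_Iic (a := β)).preimage continuous_fst)
      convert h3 using 1
      ext p
      simp [hR]
      tauto
    · rintro ⟨y, q⟩ ⟨h1, h2⟩
      exact ⟨⟨(hm ⟨q, h1, rfl⟩).trans h2.1, h2.2⟩, h1⟩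
  obtain ⟨⟨y, q⟩, hq, hmin⟩ := cR.exists_isMinOn ⟨(x, r), hr, hx⟩
    (f := fun p : ℝ × ℝ => Real.exp (-((M + 1) * p.2)) * w p.1 p.2) (ContinuousOn.mul (by fun_prop) hw)
  have hmin : ∀ z p, p ∈ Icc t1 s → z ∈ Icc (l p) β →
      Real.exp (-((M + 1) * q)) * w y q ≤ Real.exp (-((M + 1) * p)) * w z p := fun z p h1 h2 =>
    hmin (show (z, p) ∈ R from ⟨h1, h2⟩)
  obtain ⟨hq1, hq2⟩ := hq
  simp only at hq1 hq2
  have ly : l q ≤ β := hq2.1.trans hq2.2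
  have wn : w y q < 0 := by
    have h1 := hmin x r hr hx
    have h2 := mul_neg_of_pos_of_neg (Real.exp_pos (-((M + 1) * r))) hneg
    by_contra h3
    push Not at h3
    have := mul_nonneg (Real.exp_pos (-((M + 1) * q))).le h3
    linarith
  have q1 : t1 < q := lt_of_le_of_ne hq1.1 (by rintro rfl; exact absurd (bot y hq2.1 hq2.2) (not_le.2 wn))
  have y1 : l q < y := lt_of_le_of_ne hq2.1 (by rintro rfl; exact absurd (lft q hq1 ly) (not_le.2 wn))
  have y2 : y < β := lt_of_le_of_ne hq2.2 (by rintro rfl; exact absurd (rgt q hq1 ly) (not_le.2 wn))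
  obtain ⟨-, i2, i3, i4, i5, i6⟩ := int y q q1 hq1.2 y1 y2
  have nb : ∀ᶠ z in 𝓝 y, l q < z ∧ z < β := Ioo_mem_nhds y1 y2
  obtain ⟨k1, k2⟩ := d2_max (f := fun z => -w z q) (f' := fun z => -wx z q) (x := y)
    (nb.mono fun z hz => (int z q q1 hq1.2 hz.1 hz.2).1.fun_neg) i2.fun_neg
    (nb.mono fun z hz => neg_le_neg (le_of_mul_le_mul_left (hmin z q hq1 ⟨hz.1.le, hz.2.le⟩) (Real.exp_pos _)))
  have k1 : wx y q = 0 := by linarith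
  have k3 : 0 ≤ a y q * wxx y q := mul_nonneg i4 (by linarith)
  have k4 : M * w y q ≤ c y q * w y q := mul_le_mul_of_nonpos_right i5 wn.le
  rw [k1] at i6
  have dg : HasDerivAt (fun p => Real.exp (-((M + 1) * p)) * w y p)
      (Real.exp (-((M + 1) * q)) * (wt y q - (M + 1) * w y q)) q :=
    ((((hasDerivAt_id q).const_mul (M + 1)).fun_neg.exp).fun_mul i3).congr_deriv (by simp; ring)
  have ev := left_lt dg (mul_pos (Real.exp_pos _) (by nlinarith))
  have n2 : ∀ᶠ p in 𝓝[<] q, t1 < p := nhdsWithin_le_nhds (lt_mem_nhds q1)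
  have n3 : ∀ᶠ p in 𝓝[<] q, l p < y := by
    have h1 : ContinuousWithinAt l (Iio q) q := by
      have := (hl q hq1).mono_of_mem_nhdsWithin (s := Iio q) (by
        filter_upwards [n2, self_mem_nhdsWithin] with p h1 h2 using ⟨h1.le, (le_of_lt h2).trans hq1.2⟩)
      exact this
    exact h1.eventually (gt_mem_nhds y1)
  obtain ⟨p, h1, h2, h3, h4⟩ := (ev.and (n2.and (n3.and self_mem_nhdsWithin))).exists
  have h4 : p < q := h4
  have := hmin y p ⟨h2.le, h4.le.trans hq1.2⟩ ⟨h3.le, y2.le⟩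
  linarith

namespace SP
variable {T X : ℝ} {xi : ℝ → ℝ} {a b c u : ℝ → ℝ → ℝ} {M : ℝ}

set_option maxHeartbeats 800000 in
lemma tri (H : SP T X xi a b c u M) {t1 s β xs L : ℝ} (ht1 : 0 < t1) (h1s : t1 < s) (hsT : s ≤ T) (hβ : xs < β)
    (hβX : β < X) (hL : xs + L * (s - t1) = β) (hxi : ∀ r ∈ Icc t1 s, xi r ≤ xs + L * (s - r))
    (hu : ∀ x r, r ∈ Icc t1 s → x ∈ Icc (xs + L * (s - r)) β → 0 ≤ u x r) (hp : ∀ r ∈ Icc t1 s, 0 < u β r) :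
    ∃ κ > 0, ∀ x ∈ Icc xs β, κ * (x - xs) ≤ u x s := by
  have M1 := H.M1
  have L0 : 0 < L := by
    by_contra h
    push Not at h
    have := mul_nonpos_of_nonpos_of_nonneg h (sub_pos.2 h1s).le
    linarith
  have lβ : ∀ r ∈ Icc t1 s, xs + L * (s - r) ≤ β := fun r hr => by
    rw [← hL]; nlinarith [hr.1, hr.2]
  have inC : ∀ x r, r ∈ Icc t1 s → x ∈ Icc (xs + L * (s - r)) β → (x, r) ∈ domLat xi (fun _ => X) T := fun x r hr hx =>
    ⟨⟨ht1.trans_le hr.1, hr.2.trans hsT⟩, (hxi r hr).trans hx.1, hx.2.trans hβX.le⟩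
  obtain ⟨r0, hr0, hm⟩ := isCompact_Icc.exists_isMinOn (nonempty_Icc.2 h1s.le) (f := fun r => u β r)
    (H.sol.cont.comp (s := Icc t1 s) (f := fun r => (β, r)) (by fun_prop) fun r hr =>
      (⟨⟨ht1.le.trans hr.1, hr.2.trans hsT⟩, (hxi r hr).trans (lβ r hr), hβX.le⟩ : (β, r) ∈ domCl xi (fun _ => X) T))
  have hm : ∀ r ∈ Icc t1 s, u β r0 ≤ u β r := fun r hr => hm hr
  have m0 := hp r0 hr0
  set k := M * (L + M + 1) with hk
  have kM : M ≤ k := by rw [hk]; nlinarith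
  have k0 : 0 < k := by linarith
  set η := u β r0 / Real.exp (k * (β - xs)) with hη
  have η0 : 0 < η := div_pos m0 (Real.exp_pos _)
  set E : ℝ → ℝ → ℝ := fun x r => Real.exp (k * (x - (xs + L * (s - r)))) with hE
  have Ec : Continuous (fun p : ℝ × ℝ => E p.1 p.2) := by simp only [hE]; fun_prop
  have dEx : ∀ x r, HasDerivAt (fun z => E z r) (k * E x r) x := fun x r => by
    have := (((hasDerivAt_id x).sub_const (xs + L * (s - r))).const_mul k).exp
    exact this.congr_deriv (by simp [hE]; ring)
  have dEt : ∀ x r, HasDerivAt (fun q => E x q) (k * L * E x r) r := fun x r => by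
    have := ((((((hasDerivAt_id r).const_sub s).const_mul L).const_add xs).const_sub x).const_mul k).exp
    exact this.congr_deriv (by simp [hE]; ring)
  have W := weakMP (w := fun x r => u x r - η * (E x r - 1)) (wx := fun x r => pdx u x r - η * (k * E x r))
    (wxx := fun x r => pdxx u x r - η * (k * (k * E x r))) (wt := fun x r => pdt u x r - η * (k * L * E x r))
    (a := a) (b := b) (c := c) (l := fun r => xs + L * (s - r)) (t1 := t1) (s := s) (β := β) (M := M) (by fun_prop)
    ((H.sol.cont.mono fun p hp => ⟨⟨(inC p.1 p.2 hp.1 hp.2).1.1.le, (inC p.1 p.2 hp.1 hp.2).1.2⟩, (inC p.1 p.2 hp.1 hp.2).2⟩).sub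
      ((continuousOn_const.mul (Ec.continuousOn.sub continuousOn_const))))
    (fun x r h1 h2 h3 h4 => by
      have hd := inC x r ⟨h1.le, h2⟩ ⟨h3.le, h4.le⟩
      obtain ⟨r1, -, -, -, r2, r3, -, -, -, r4, r5⟩ := H.reg _ hd
      have e := H.sol.eqn _ hd
      simp only at r1 r2 r3 r4 r5 e
      refine ⟨(H.sol.diff_x _ hd).hasDerivAt.fun_sub (((dEx x r).sub_const 1).const_mul η),
        (H.sol.diff_xx _ hd).hasDerivAt.fun_sub (((dEx x r).const_mul k).const_mul η),
        (H.sol.diff_t _ hd).hasDerivAt.fun_sub (((dEt x r).sub_const 1).const_mul η), r1.le, (abs_le.1 r5).2, ?_⟩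
      rw [e]
      have E1 : 1 ≤ E x r := Real.one_le_exp (mul_nonneg k0.le (by linarith))
      have q1 : k * (L + M + 1) ≤ a x r * k ^ 2 := by
        have : M⁻¹ ≤ a x r := inv_le_of_inv_le₀ r1 ((le_abs_self _).trans r3)
        have h5 : M⁻¹ * k ^ 2 ≤ a x r * k ^ 2 := mul_le_mul_of_nonneg_right this (by positivity)
        have h6 : M⁻¹ * k ^ 2 = k * (L + M + 1) := by rw [hk]; field_simp
        linarith
      have q2 : -(M * k) ≤ b x r * k := by nlinarith [(abs_le.1 r4).1]
      have q3 : -(M * E x r) ≤ c x r * (E x r - 1) := by nlinarith [(abs_le.1 r5).1]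
      have q4 : 0 ≤ (a x r * k ^ 2 + b x r * k - k * L - M) * E x r := mul_nonneg (by nlinarith) (by linarith)
      have q5 : 0 ≤ η * (a x r * k ^ 2 * E x r + b x r * k * E x r + c x r * (E x r - 1) - k * L * E x r) :=
        mul_nonneg η0.le (by nlinarith)
      nlinarith)
    (fun x h1 h2 => by
      have h3 : x = β := le_antisymm h2 (by simpa [hL] using h1)
      have : E x t1 = 1 := by simp [hE, hL, h3]
      rw [this, h3]; simpa using (hp t1 ⟨le_rfl, h1s.le⟩).le)
    (fun r hr h => by
      have : E (xs + L * (s - r)) r = 1 := by simp [hE]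
      simp only [this]
      simpa using hu _ r hr ⟨le_rfl, h⟩)
    (fun r hr h => by
      have h1 : E β r ≤ Real.exp (k * (β - xs)) :=
        Real.exp_le_exp.2 (mul_le_mul_of_nonneg_left (by nlinarith [hr.2]) k0.le)
      have h2 : η * Real.exp (k * (β - xs)) = u β r0 := by rw [hη]; field_simp
      have h3 := mul_le_mul_of_nonneg_left h1 η0.le
      have := hm r hr
      nlinarith)
  refine ⟨η * k, by positivity, fun x hx => ?_⟩
  have h1 := W x s ⟨h1s.le, le_rfl⟩ (by simpa using hx)
  have h2 : k * (x - xs) + 1 ≤ E x s := by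
    have := Real.add_one_le_exp (k * (x - xs))
    simpa [hE] using this
  have h3 := mul_le_mul_of_nonneg_left h2 η0.le
  nlinarith

end SP

lemma ev_left {P : ℝ → Prop} {s : ℝ} (h : ∀ᶠ r in 𝓝 s, P r) : ∀ᶠ t in 𝓝[<] s, ∀ r ∈ Icc t s, P r := by
  obtain ⟨ε, e0, he⟩ := Metric.eventually_nhds_iff.1 h
  have h1 : ∀ᶠ t in 𝓝[<] s, s - ε < t := nhdsWithin_le_nhds (lt_mem_nhds (by linarith))
  filter_upwards [h1] with t h1 r hr
  refine he ?_
  rw [Real.dist_eq, abs_lt]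
  constructor <;> linarith [hr.1, hr.2]

namespace SP
variable {T X : ℝ} {xi : ℝ → ℝ} {a b c u : ℝ → ℝ → ℝ} {M : ℝ}

lemma mp (H : SP T X xi a b c u M) {l : ℝ → ℝ} {t1 s β : ℝ} (ht1 : 0 < t1) (hsT : s ≤ T) (hβX : β ≤ X)
    (hl : ContinuousOn l (Icc t1 s)) (hxi : ∀ r ∈ Icc t1 s, xi r ≤ l r)
    (bot : ∀ x, l t1 ≤ x → x ≤ β → 0 ≤ u x t1) (lft : ∀ r ∈ Icc t1 s, l r ≤ β → 0 ≤ u (l r) r)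
    (rgt : ∀ r ∈ Icc t1 s, l r ≤ β → 0 ≤ u β r) : ∀ x r, r ∈ Icc t1 s → x ∈ Icc (l r) β → 0 ≤ u x r := by
  have inC : ∀ x r, r ∈ Icc t1 s → x ∈ Icc (l r) β → (x, r) ∈ domLat xi (fun _ => X) T := fun x r hr hx =>
    ⟨⟨ht1.trans_le hr.1, hr.2.trans hsT⟩, (hxi r hr).trans hx.1, hx.2.trans hβX⟩
  refine weakMP (wx := pdx u) (wxx := pdxx u) (wt := pdt u) (a := a) (b := b) (c := c) (M := M) hl
    (H.sol.cont.mono fun p hp => ⟨⟨(inC p.1 p.2 hp.1 hp.2).1.1.le, (inC p.1 p.2 hp.1 hp.2).1.2⟩, (inC p.1 p.2 hp.1 hp.2).2⟩)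
    (fun x r h1 h2 h3 h4 => ?_) bot lft rgt
  have hd := inC x r ⟨h1.le, h2⟩ ⟨h3.le, h4.le⟩
  obtain ⟨r1, -, -, -, r2, r3, -, -, -, r4, r5⟩ := H.reg _ hd
  exact ⟨(H.sol.diff_x _ hd).hasDerivAt, (H.sol.diff_xx _ hd).hasDerivAt, (H.sol.diff_t _ hd).hasDerivAt, r1.le,
    (abs_le.1 r5).2, (H.sol.eqn _ hd).ge⟩

lemma ct (H : SP T X xi a b c u M) {x t : ℝ} (ht : t ∈ Ioo 0 T) (hx : x ∈ Ioo (xi t) X) :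
    ContinuousAt (fun r => u x r) t :=
  ContinuousAt.comp (f := fun r => (x, r)) (H.uc ht hx) (by fun_prop)

lemma lemS (H : SP T X xi a b c u M) {s z Y' Y : ℝ} (hs : s ∈ Ioo 0 T) (h1 : xi s < Y') (h2 : Y' < z) (h3 : z < Y)
    (h4 : Y < X) (hz : u z s = 0) (p1 : 0 < u Y' s) (p2 : 0 < u Y s) :
    ∀ᶠ t in 𝓝[<] s, ∃ p ∈ Ioo Y' Y, u p t < 0 := by
  have e1 : ∀ᶠ r in 𝓝 s, r ∈ Ioo 0 T := Ioo_mem_nhds hs.1 hs.2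
  have e2 : ∀ᶠ r in 𝓝 s, xi r < Y' := (H.xi_at hs).eventually (gt_mem_nhds h1)
  have e3 : ∀ᶠ r in 𝓝 s, 0 < u Y' r := (H.ct hs ⟨h1, by linarith⟩).eventually (lt_mem_nhds p1)
  have e4 : ∀ᶠ r in 𝓝 s, 0 < u Y r := (H.ct hs ⟨by linarith, h4⟩).eventually (lt_mem_nhds p2)
  filter_upwards [ev_left (e1.and (e2.and (e3.and e4))), self_mem_nhdsWithin] with t ht hts
  have hts : t < s := hts
  by_contra hno
  push Not at hno
  have tm : t ∈ Icc t s := ⟨le_rfl, hts.le⟩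
  have nn := H.mp (l := fun _ => Y') (t1 := t) (s := s) (β := Y) (ht t tm).1.1 hs.2.le h4.le continuousOn_const
    (fun r hr => (ht r hr).2.1.le) (fun x hx1 hx2 => by
      rcases hx1.eq_or_lt with rfl | hx1
      · exact (ht t tm).2.2.1.le
      rcases hx2.eq_or_lt with rfl | hx2
      · exact (ht t tm).2.2.2.le
      exact hno x ⟨hx1, hx2⟩) (fun r hr _ => (ht r hr).2.2.1.le) (fun r hr _ => (ht r hr).2.2.2.le)
  have d0 : 0 < s - t := by linarith
  have L0 : 0 ≤ (Y - (Y' + z) / 2) / (s - t) := div_nonneg (by linarith) d0.le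
  have lo : ∀ r ∈ Icc t s, Y' ≤ (Y' + z) / 2 + (Y - (Y' + z) / 2) / (s - t) * (s - r) := fun r hr => by
    nlinarith [mul_nonneg L0 (sub_nonneg.2 hr.2)]
  obtain ⟨κ, κ0, hκ⟩ := H.tri (t1 := t) (s := s) (β := Y) (xs := (Y' + z) / 2) (L := (Y - (Y' + z) / 2) / (s - t))
    (ht t tm).1.1 hts hs.2.le (by linarith) h4 (by field_simp; ring)
    (fun r hr => (ht r hr).2.1.le.trans (lo r hr))
    (fun x r hr hx => nn x r hr ⟨(lo r hr).trans hx.1, hx.2⟩) (fun r hr => (ht r hr).2.2.2)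
  have := hκ z ⟨by linarith, h3.le⟩
  rw [hz] at this
  have := mul_pos κ0 (show 0 < z - (Y' + z) / 2 by linarith)
  linarith

lemma lemS2 (H : SP T X xi a b c u M) {s z Y' Y : ℝ} (hs : s ∈ Ioo 0 T) (h1 : xi s < Y') (h2 : Y' < z) (h3 : z < Y)
    (h4 : Y < X) (hz : u z s = 0) (p1 : 0 < u Y' s * u Y s) :
    ∀ᶠ t in 𝓝[<] s, ∃ p ∈ Ioo Y' Y, u Y' t * u p t < 0 ∧ u p t * u Y t < 0 := by
  have c1 := H.ct hs (x := Y') ⟨h1, by linarith⟩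
  have c2 := H.ct hs (x := Y) ⟨by linarith, h4⟩
  rcases mul_pos_iff.1 p1 with ⟨q1, q2⟩ | ⟨q1, q2⟩
  · filter_upwards [H.lemS hs h1 h2 h3 h4 hz q1 q2, nhdsWithin_le_nhds (c1.eventually (lt_mem_nhds q1)),
      nhdsWithin_le_nhds (c2.eventually (lt_mem_nhds q2))] with t ⟨p, hp, hn⟩ k1 k2
    exact ⟨p, hp, mul_neg_of_pos_of_neg k1 hn, mul_neg_of_neg_of_pos hn k2⟩
  · filter_upwards [H.neg.lemS hs h1 h2 h3 h4 (by simp [hz]) (neg_pos.2 q1) (neg_pos.2 q2), nhdsWithin_le_nhds (c1.eventually (gt_mem_nhds q1)),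
      nhdsWithin_le_nhds (c2.eventually (gt_mem_nhds q2))] with t ⟨p, hp, hn⟩ k1 k2
    exact ⟨p, hp, mul_neg_of_neg_of_pos k1 (neg_lt_zero.1 hn), mul_neg_of_pos_of_neg (neg_lt_zero.1 hn) k2⟩

lemma ivt (H : SP T X xi a b c u M) {t x y : ℝ} (ht : t ∈ Icc 0 T) (hx : xi t ≤ x) (hxy : x < y) (hy : y ≤ X)
    (h : u x t * u y t < 0) : ∃ z ∈ Ioo x y, u z t = 0 := by
  have cc := (H.cx ht).mono (Icc_subset_Icc hx hy)
  rcases mul_neg_iff.1 h with ⟨h1, h2⟩ | ⟨h1, h2⟩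
  · obtain ⟨z, hz, e⟩ := intermediate_value_Ioo' hxy.le cc ⟨h2, h1⟩
    exact ⟨z, hz, e⟩
  · obtain ⟨z, hz, e⟩ := intermediate_value_Ioo hxy.le cc ⟨h1, h2⟩
    exact ⟨z, hz, e⟩

/-- points with nonvanishing values on both sides of an interior point -/
lemma sides (H : SP T X xi a b c u M) {x t δ : ℝ} (ht : t ∈ Ioo 0 T) (hx : x ∈ Ioo (xi t) X) (hδ : 0 < δ) :
    ∃ Y' Y, xi t < Y' ∧ x - δ < Y' ∧ Y' < x ∧ x < Y ∧ Y < x + δ ∧ Y < X ∧ u Y' t ≠ 0 ∧ u Y t ≠ 0 := by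
  have e := H.iso ht hx
  have eL : ∀ᶠ z in 𝓝[<] x, u z t ≠ 0 := nhdsWithin_mono x (fun z (h : z < x) => h.ne) e
  have eR : ∀ᶠ z in 𝓝[>] x, u z t ≠ 0 := nhdsWithin_mono x (fun z (h : x < z) => h.ne') e
  have l1 : ∀ᶠ z in 𝓝[<] x, z ∈ Ioo (max (xi t) (x - δ)) x := Ioo_mem_nhdsLT (max_lt hx.1 (by linarith))
  have r1 : ∀ᶠ z in 𝓝[>] x, z ∈ Ioo x (min X (x + δ)) := Ioo_mem_nhdsGT (lt_min hx.2 (by linarith))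
  obtain ⟨Y', a1, a2⟩ := (eL.and l1).exists
  obtain ⟨Y, b1, b2⟩ := (eR.and r1).exists
  exact ⟨Y', Y, (le_max_left _ _).trans_lt a2.1, (le_max_right _ _).trans_lt a2.1, a2.2, b2.1,
    b2.2.trans_le (min_le_right _ _), b2.2.trans_le (min_le_left _ _), a1, b1⟩

lemma z1 (H : SP T X xi a b c u M) {s z δ : ℝ} (hs : s ∈ Ioo 0 T) (hz : z ∈ Ioo (xi s) X) (hδ : 0 < δ) (h0 : u z s = 0) :
    ∀ᶠ t in 𝓝[<] s, ∃ x ∈ Icc (xi t) X, |x - z| < δ ∧ u x t = 0 := by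
  obtain ⟨Y', Y, a1, a2, a3, b1, b2, b3, a4, b4⟩ := H.sides hs hz hδ
  have e1 : ∀ᶠ r in 𝓝[<] s, r ∈ Ioo 0 T := nhdsWithin_le_nhds (Ioo_mem_nhds hs.1 hs.2)
  have e2 : ∀ᶠ r in 𝓝[<] s, xi r < Y' := nhdsWithin_le_nhds ((H.xi_at hs).eventually (gt_mem_nhds a1))
  have c1 := H.ct hs (x := Y') ⟨a1, by linarith⟩
  have c2 := H.ct hs (x := Y) ⟨by linarith, b3⟩
  have key : ∀ᶠ t in 𝓝[<] s, ∃ p ∈ Ioc Y' Y, u Y' t * u p t < 0 := by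
    rcases lt_or_gt_of_ne (mul_ne_zero a4 b4) with h | h
    · filter_upwards [nhdsWithin_le_nhds ((c1.mul c2).eventually (gt_mem_nhds h))] with t ht
      exact ⟨Y, ⟨by linarith, le_rfl⟩, ht⟩
    · filter_upwards [H.lemS2 hs a1 a3 b1 b3 h0 h] with t ⟨p, hp, k, _⟩
      exact ⟨p, ⟨hp.1, hp.2.le⟩, k⟩
  filter_upwards [e1, e2, key] with t h1 h2 ⟨p, hp, k⟩
  obtain ⟨x, hx, e⟩ := H.ivt ⟨h1.1.le, h1.2.le⟩ h2.le hp.1 (hp.2.trans b3.le) k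
  refine ⟨x, ⟨(h2.trans hx.1).le, by linarith [hx.2, hp.2]⟩, ?_, e⟩
  rw [abs_lt]
  constructor <;> linarith [hx.1, hx.2, hp.2]

end SP

namespace SP
variable {T X : ℝ} {xi : ℝ → ℝ} {a b c u : ℝ → ℝ → ℝ} {M : ℝ}

lemma z2 (H : SP T X xi a b c u M) {s δ : ℝ} (hs : s ∈ Ioo 0 T) (hδ : 0 < δ)
    (hpos : ∀ᶠ t in 𝓝[<] s, 0 < u (xi t) t) (h0 : u (xi s) s = 0) (hL : ∃ L, HasDerivWithinAt xi L (Iio s) s)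
    (hx : pdx u (xi s) s ≤ 0) (hiso : ∀ᶠ y in 𝓝[>] (xi s), u y s ≠ 0) :
    ∀ᶠ t in 𝓝[<] s, ∃ x ∈ Icc (xi t) X, |x - xi s| < δ ∧ u x t = 0 := by
  have sI : s ∈ Icc 0 T := ⟨hs.1.le, hs.2.le⟩
  obtain ⟨y1, hy1, hy2⟩ := mem_nhdsGT_iff_exists_Ioo_subset.1 hiso
  have hy1 : xi s < y1 := hy1
  obtain ⟨y0, k1, k2⟩ := exists_between (lt_min hy1 (lt_min (H.xlt s sI) (show xi s < xi s + δ by linarith)))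
  have k3 : y0 < y1 := k2.trans_le (min_le_left _ _)
  have k4 : y0 < X := k2.trans_le ((min_le_right _ _).trans (min_le_left _ _))
  have k5 : y0 < xi s + δ := k2.trans_le ((min_le_right _ _).trans (min_le_right _ _))
  have e1 : ∀ᶠ r in 𝓝 s, r ∈ Ioo 0 T := Ioo_mem_nhds hs.1 hs.2
  have e2 : ∀ᶠ r in 𝓝 s, xi r < y0 := (H.xi_at hs).eventually (gt_mem_nhds k1)
  have e3 : ∀ᶠ r in 𝓝 s, xi s - δ < xi r := (H.xi_at hs).eventually (lt_mem_nhds (by linarith))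
  have e4 : ∀ᶠ r in 𝓝 s, r < s → 0 < u (xi r) r := eventually_nhdsWithin_iff.1 hpos
  rcases lt_or_gt_of_ne (hy2 ⟨k1, k3⟩ : u y0 s ≠ 0) with hneg | hps
  · have e5 : ∀ᶠ r in 𝓝 s, u y0 r < 0 := (H.ct hs ⟨k1, k4⟩).eventually (gt_mem_nhds hneg)
    filter_upwards [nhdsWithin_le_nhds (e1.and (e2.and (e3.and e5))), hpos] with t ⟨h1, h2, h3, h5⟩ h4
    obtain ⟨x, hx, e⟩ := H.ivt ⟨h1.1.le, h1.2.le⟩ le_rfl h2 k4.le (mul_neg_of_pos_of_neg h4 h5)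
    refine ⟨x, ⟨hx.1.le, by linarith [hx.2]⟩, ?_, e⟩
    rw [abs_lt]
    constructor <;> linarith [hx.1, hx.2]
  · have e5 : ∀ᶠ r in 𝓝 s, 0 < u y0 r := (H.ct hs ⟨k1, k4⟩).eventually (lt_mem_nhds hps)
    filter_upwards [ev_left (e1.and (e2.and (e3.and (e4.and e5)))), self_mem_nhdsWithin] with t ht hts
    have hts : t < s := hts
    by_contra hno
    push Not at hno
    have tm : t ∈ Icc t s := ⟨le_rfl, hts.le⟩
    have lo : ∀ x, xi t ≤ x → x ≤ y0 → 0 ≤ u x t := fun x h1 h2 => by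
      by_contra hn
      push Not at hn
      have q := (ht t tm).2.2.2.1 hts
      rcases h1.eq_or_lt with rfl | h1
      · linarith
      obtain ⟨z, hz, e⟩ := H.ivt ⟨(ht t tm).1.1.le, (ht t tm).1.2.le⟩ le_rfl h1 (h2.trans k4.le) (mul_neg_of_pos_of_neg q hn)
      refine hno z ⟨hz.1.le, by linarith [hz.2]⟩ ?_ e
      rw [abs_lt]
      constructor <;> linarith [hz.1, hz.2, (ht t tm).2.2.1]
    have nn := H.mp (l := xi) (t1 := t) (s := s) (β := y0) (ht t tm).1.1 hs.2.le k4.le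
      (H.xc.mono (Icc_subset_Icc (ht t tm).1.1.le hs.2.le)) (fun r _ => le_rfl) lo (fun r hr _ => by
        rcases hr.2.eq_or_lt with rfl | h
        · exact h0.ge
        · exact ((ht r hr).2.2.2.1 h).le) (fun r hr _ => (ht r hr).2.2.2.2.le)
    obtain ⟨β, b1, b2⟩ := exists_between k1
    have bp : 0 < u β s := lt_of_le_of_ne (nn β s ⟨hts.le, le_rfl⟩ ⟨b1.le, b2.le⟩) (hy2 ⟨b1, b2.trans k3⟩ : u β s ≠ 0).symm
    obtain ⟨L0, hL0⟩ := hL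
    have f1 : ∀ᶠ r in 𝓝 s, r < s → xi r ≤ xi s + (|L0| + 1) * (s - r) := by
      refine eventually_nhdsWithin_iff.1 ?_
      filter_upwards [(hasDerivWithinAt_iff_isLittleO.1 hL0).bound one_pos, self_mem_nhdsWithin] with r h1 h2
      have h2 : r < s := h2
      rw [Real.norm_eq_abs, Real.norm_eq_abs, one_mul, abs_of_neg (sub_neg.2 h2), smul_eq_mul] at h1
      nlinarith [(abs_le.1 h1).2, neg_abs_le L0]
    have f2 : ∀ᶠ r in 𝓝 s, 0 < u β r := (H.ct hs ⟨b1, b2.trans k4⟩).eventually (lt_mem_nhds bp)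
    have f3 : ∀ᶠ r in 𝓝 s, (|L0| + 1) * (s - r) < β - xi s := by
      have : ContinuousAt (fun r => (|L0| + 1) * (s - r)) s := by fun_prop
      exact this.eventually (gt_mem_nhds (by simpa using b1))
    have f4 : ∀ᶠ t1 in 𝓝[<] s, t < t1 := nhdsWithin_le_nhds (lt_mem_nhds hts)
    obtain ⟨t1, g1, g4, g5⟩ := ((ev_left (f1.and (f2.and f3))).and (f4.and self_mem_nhdsWithin)).exists
    have g5 : t1 < s := g5
    have d0 : 0 < s - t1 := by linarith
    have LL : |L0| + 1 ≤ (β - xi s) / (s - t1) := by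
      rw [le_div_iff₀ d0]
      exact (g1 t1 ⟨le_rfl, g5.le⟩).2.2.le
    have lo2 : ∀ r ∈ Icc t1 s, xi r ≤ xi s + (β - xi s) / (s - t1) * (s - r) := fun r hr => by
      rcases hr.2.eq_or_lt with rfl | h
      · simp
      · have := (g1 r hr).1 h
        nlinarith
    obtain ⟨κ, κ0, hκ⟩ := H.tri (t1 := t1) (s := s) (β := β) (xs := xi s) (L := (β - xi s) / (s - t1))
      ((ht t tm).1.1.trans g4) g5 hs.2.le b1 (b2.trans k4) (by field_simp; ring) lo2
      (fun x r hr hx => nn x r ⟨g4.le.trans hr.1, hr.2⟩ ⟨(lo2 r hr).trans hx.1, hx.2.trans b2.le⟩)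
      (fun r hr => (g1 r hr).2.1)
    have dd : HasDerivAt (fun y => u y s) (pdx u (xi s) s) (xi s) :=
      (H.sol.diff_x (xi s, s) ⟨⟨hs.1, hs.2.le⟩, le_rfl, (H.xlt s sI).le⟩).hasDerivAt
    have sl : Tendsto (slope (fun y => u y s) (xi s)) (𝓝[>] (xi s)) (𝓝 (pdx u (xi s) s)) :=
      (hasDerivAt_iff_tendsto_slope.1 dd).mono_left (nhdsWithin_mono _ fun z (h : xi s < z) => h.ne')
    have : κ ≤ pdx u (xi s) s := by
      refine ge_of_tendsto sl ?_
      filter_upwards [Ioo_mem_nhdsGT b1] with z hz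
      have := hκ z ⟨hz.1.le, hz.2.le⟩
      rw [slope_def_field, le_div_iff₀ (sub_pos.2 hz.1), h0]
      linarith
    linarith

end SP

lemma wlem {n : ℕ} (hn : 0 < n) {ζ : ℝ → ℝ} {g : Fin n → ℝ → ℝ → ℝ} (hζ : Continuous ζ)
    (hg : ∀ i, Continuous fun p : ℝ × ℝ => g i p.1 p.2) {t1 t X : ℝ} (htt : t1 ≤ t)
    (sep : ∀ i j : Fin n, i.val + 1 = j.val → ∀ x r, ¬ (0 < g i x r ∧ 0 < g j x r))
    (b0 : ∀ i : Fin n, i.val = 0 → ∀ r ∈ Icc t1 t, ¬ 0 < g i (ζ r) r)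
    (bn : ∀ i : Fin n, i.val + 1 = n → ∀ r ∈ Icc t1 t, ¬ 0 < g i X r)
    (dec : ∀ i x r, t1 < r → r ≤ t → ζ r < x → x < X → 0 < g i x r → IsLocalMax (fun z => g i z r) x →
      ∀ᶠ q in 𝓝[<] r, g i x r < g i x q)
    (y : Fin n → ℝ) (ym : Monotone y) (y1 : ∀ i, ζ t ≤ y i) (y2 : ∀ i, y i ≤ X) (y3 : ∀ i, 0 < g i (y i) t) :
    ∃ y : Fin n → ℝ, StrictMono y ∧ ∀ i, ζ t1 < y i ∧ y i < X ∧ 0 < g i (y i) t1 := by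
  set S : Set ((Fin n → ℝ) × ℝ) := {p | p.2 ∈ Icc t1 t ∧ (∀ i, ζ p.2 ≤ p.1 i) ∧ (∀ i, p.1 i ≤ X) ∧
    (∀ i j, i ≤ j → p.1 i ≤ p.1 j) ∧ ∀ i, 0 ≤ g i (p.1 i) p.2} with hS
  have gc : ∀ i, Continuous fun p : (Fin n → ℝ) × ℝ => g i (p.1 i) p.2 := fun i =>
    (hg i).comp (f := fun p : (Fin n → ℝ) × ℝ => (p.1 i, p.2)) (by fun_prop)
  obtain ⟨m, hm⟩ := ((isCompact_Icc (a := t1) (b := t)).image_of_continuousOn hζ.continuousOn).bddBelow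
  have cS : IsCompact S := by
    refine IsCompact.of_isClosed_subset ((isCompact_Icc (a := fun _ : Fin n => m) (b := fun _ => X)).prod
      (isCompact_Icc (a := t1) (b := t))) ?_ ?_
    · have h1 : IsClosed {p : (Fin n → ℝ) × ℝ | p.2 ∈ Icc t1 t} := isClosed_Icc.preimage continuous_snd
      have h2 : IsClosed {p : (Fin n → ℝ) × ℝ | ∀ i, ζ p.2 ≤ p.1 i} := by
        simp only [ofPred_forall]
        exact isClosed_iInter fun i => isClosed_le (by fun_prop) (by fun_prop)
      have h3 : IsClosed {p : (Fin n → ℝ) × ℝ | ∀ i, p.1 i ≤ X} := by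
        simp only [ofPred_forall]
        exact isClosed_iInter fun i => isClosed_le (by fun_prop) (by fun_prop)
      have h4 : IsClosed {p : (Fin n → ℝ) × ℝ | ∀ i j, i ≤ j → p.1 i ≤ p.1 j} := by
        simp only [ofPred_forall]
        exact isClosed_iInter fun i => isClosed_iInter fun j => isClosed_iInter fun _ => isClosed_le (by fun_prop) (by fun_prop)
      have h5 : IsClosed {p : (Fin n → ℝ) × ℝ | ∀ i, 0 ≤ g i (p.1 i) p.2} := by
        simp only [ofPred_forall]
        exact isClosed_iInter fun i => isClosed_le (by fun_prop) (gc i)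
      exact h1.inter (h2.inter (h3.inter (h4.inter h5)))
    · rintro ⟨z, q⟩ ⟨h1, h2, h3, -⟩
      exact ⟨⟨fun i => (hm ⟨q, h1, rfl⟩).trans (h2 i), h3⟩, h1⟩
  obtain ⟨⟨z, r⟩, hz, hmax⟩ := cS.exists_isMaxOn ⟨(y, t), ⟨htt, le_rfl⟩, y1, y2, fun _ _ h => ym h, fun i => (y3 i).le⟩
    (f := fun p => ∏ i, g i (p.1 i) p.2) (continuous_finsetProd _ fun i _ => gc i).continuousOn
  have hmax : ∀ w q, (w, q) ∈ S → ∏ i, g i (w i) q ≤ ∏ i, g i (z i) r := fun w q h => hmax h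
  obtain ⟨z0, z1, z2, z3, z4⟩ := hz
  simp only at z0 z1 z2 z3 z4
  have pp : 0 < ∏ i, g i (z i) r := lt_of_lt_of_le (Finset.prod_pos fun i _ => y3 i)
    (hmax y t ⟨⟨htt, le_rfl⟩, y1, y2, fun _ _ h => ym h, fun i => (y3 i).le⟩)
  have gp : ∀ i, 0 < g i (z i) r := fun i =>
    lt_of_le_of_ne (z4 i) (Finset.prod_ne_zero_iff.1 pp.ne' i (Finset.mem_univ i)).symm
  have sm : StrictMono z := fun i j hij => by
    have hk : i.val + 1 < n := lt_of_le_of_lt hij j.2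
    have h1 : z i ≤ z ⟨i.val + 1, hk⟩ := z3 _ _ (by simp [Fin.le_def])
    have h2 : z ⟨i.val + 1, hk⟩ ≤ z j := z3 _ _ hij
    refine (lt_of_le_of_ne h1 fun e => ?_).trans_le h2
    exact sep i ⟨i.val + 1, hk⟩ rfl (z i) r ⟨gp i, by have := gp ⟨i.val + 1, hk⟩; rwa [← e] at this⟩
  have lo : ∀ i, ζ r < z i := fun i => by
    refine (lt_of_le_of_ne (z1 ⟨0, hn⟩) fun e => ?_).trans_le (z3 _ _ (by simp [Fin.le_def]))
    exact b0 ⟨0, hn⟩ rfl r z0 (by have := gp ⟨0, hn⟩; rwa [← e] at this)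
  have hi : ∀ i, z i < X := fun i => by
    have hk : n - 1 < n := by omega
    refine (z3 i ⟨n - 1, hk⟩ (by simp [Fin.le_def]; omega)).trans_lt (lt_of_le_of_ne (z2 ⟨n - 1, hk⟩) fun e => ?_)
    exact bn ⟨n - 1, hk⟩ (by simp; omega) r z0 (by have := gp ⟨n - 1, hk⟩; rwa [e] at this)
  rcases z0.1.eq_or_lt with rfl | hr
  · exact ⟨z, sm, fun i => ⟨lo i, hi i, gp i⟩⟩
  exfalso
  have lm : ∀ i, IsLocalMax (fun x => g i x r) (z i) := fun i => by
    have a1 : ∀ᶠ x in 𝓝 (z i), ∀ j, j < i → z j < x := eventually_all.2 fun j => by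
      by_cases h : j < i
      · exact (lt_mem_nhds (sm h)).mono fun x hx _ => hx
      · exact Eventually.of_forall fun x h' => absurd h' h
    have a2 : ∀ᶠ x in 𝓝 (z i), ∀ j, i < j → x < z j := eventually_all.2 fun j => by
      by_cases h : i < j
      · exact (gt_mem_nhds (sm h)).mono fun x hx _ => hx
      · exact Eventually.of_forall fun x h' => absurd h' h
    have a3 : ∀ᶠ x in 𝓝 (z i), 0 < g i x r :=
      (ContinuousAt.comp (f := fun x => (x, r)) (hg i).continuousAt (by fun_prop : ContinuousAt _ (z i))).eventually (lt_mem_nhds (gp i))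
    filter_upwards [a1, a2, a3, lt_mem_nhds (lo i), gt_mem_nhds (hi i)] with x b1 b2 b3 b4 b5
    have hm := hmax (Function.update z i x) r ⟨z0, fun j => ?_, fun j => ?_, fun j k hjk => ?_, fun j => ?_⟩
    · rw [← Finset.prod_erase_mul Finset.univ _ (Finset.mem_univ i),
        ← Finset.prod_erase_mul Finset.univ (fun j => g j (z j) r) (Finset.mem_univ i)] at hm
      rw [Finset.prod_congr rfl (g := fun j => g j (z j) r) fun j hj => by
        rw [Function.update_of_ne (Finset.ne_of_mem_erase hj)], Function.update_self] at hm
      exact le_of_mul_le_mul_left hm (Finset.prod_pos fun j _ => gp j)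
    · by_cases h : j = i
      · subst h; simpa using b4.le
      · simpa [Function.update_of_ne h] using z1 j
    · by_cases h : j = i
      · subst h; simpa using b5.le
      · simpa [Function.update_of_ne h] using z2 j
    · by_cases h : j = i
      · subst h
        by_cases h' : k = j
        · subst h'; exact le_rfl
        · simpa [Function.update_of_ne h'] using (b2 k (lt_of_le_of_ne hjk (Ne.symm h'))).le
      · by_cases h' : k = i
        · subst h'
          simpa [Function.update_of_ne h] using (b1 j (lt_of_le_of_ne hjk h)).le
        · simpa [Function.update_of_ne h, Function.update_of_ne h'] using z3 j k hjk
    · by_cases h : j = i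
      · subst h; simpa using b3.le
      · simpa [Function.update_of_ne h] using z4 j
  have d1 : ∀ᶠ q in 𝓝[<] r, ∀ i, g i (z i) r < g i (z i) q := eventually_all.2 fun i =>
    dec i (z i) r hr z0.2 (lo i) (hi i) (gp i) (lm i)
  have d2 : ∀ᶠ q in 𝓝[<] r, ∀ i, ζ q < z i := eventually_all.2 fun i =>
    nhdsWithin_le_nhds (hζ.continuousAt.eventually (gt_mem_nhds (lo i)))
  have d3 : ∀ᶠ q in 𝓝[<] r, t1 < q := nhdsWithin_le_nhds (lt_mem_nhds hr)
  obtain ⟨q, q1, q2, q3, q4⟩ := (d1.and (d2.and (d3.and self_mem_nhdsWithin))).exists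
  have q4 : q < r := q4
  have hm := hmax z q ⟨⟨q3.le, q4.le.trans z0.2⟩, fun i => (q2 i).le, z2, z3, fun i => ((gp i).trans (q1 i)).le⟩
  have := Finset.prod_lt_prod_of_nonempty (s := Finset.univ) (fun i _ => gp i) (fun i _ => q1 i) ⟨⟨0, hn⟩, Finset.mem_univ _⟩
  linarith

/-- `Qc f lo n Y`: at least `n` sign changes of `f` are witnessed between `lo` and `Y` -/
inductive Qc (f : ℝ → ℝ) (lo : ℝ) : ℕ → ℝ → Prop
  | base : Qc f lo 0 lo
  | same {n : ℕ} {Y Y' : ℝ} : Qc f lo n Y → Y < Y' → 0 < f Y * f Y' → Qc f lo n Y'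
  | flip {n : ℕ} {Y Y' : ℝ} : Qc f lo n Y → Y < Y' → f Y * f Y' < 0 → Qc f lo (n + 1) Y'

lemma Qc.pts {f : ℝ → ℝ} {lo : ℝ} (h0 : 0 < f lo) {n : ℕ} {Y : ℝ} (h : Qc f lo n Y) :
    lo ≤ Y ∧ 0 < (-1) ^ n * f Y ∧ ∃ y : ℕ → ℝ, (∀ i j, i ≤ j → j < n → y i ≤ y j) ∧
      ∀ i < n, lo ≤ y i ∧ y i ≤ Y ∧ 0 < (-1) ^ (i + 1) * f (y i) := by
  induction h with
  | base => exact ⟨le_rfl, by simpa using h0, fun _ => 0, fun i j _ h => by omega, fun i h => by omega⟩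
  | @same n Y Y' h1 h2 h3 ih =>
    obtain ⟨i1, i2, y, y1, y2⟩ := ih
    refine ⟨i1.trans h2.le, ?_, y, y1, fun i hi => ⟨(y2 i hi).1, (y2 i hi).2.1.trans h2.le, (y2 i hi).2.2⟩⟩
    rcases neg_one_pow_eq_or ℝ n with e | e <;> rw [e] at i2 ⊢ <;> rcases mul_pos_iff.1 h3 with h | h <;> linarith
  | @flip n Y Y' h1 h2 h3 ih =>
    obtain ⟨i1, i2, y, y1, y2⟩ := ih
    have k : 0 < (-1) ^ (n + 1) * f Y' := by
      rw [pow_succ]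
      rcases neg_one_pow_eq_or ℝ n with e | e <;> rw [e] at i2 ⊢ <;> rcases mul_neg_iff.1 h3 with h | h <;> linarith
    refine ⟨i1.trans h2.le, k, fun i => if i < n then y i else Y', fun i j hij hj => ?_, fun i hi => ?_⟩
    · by_cases h : j < n
      · simpa [h, lt_of_le_of_lt hij h] using y1 i j hij h
      · by_cases h' : i < n
        · simpa [h, h'] using (y2 i h').2.1.trans h2.le
        · simp [h, h']
    · by_cases h : i < n
      · simpa [h] using ⟨(y2 i h).1, (y2 i h).2.1.trans h2.le, (y2 i h).2.2⟩
      · have : i = n := by omega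
        subst this
        simpa using ⟨i1.trans h2.le, k⟩

namespace SP
variable {T X : ℝ} {xi : ℝ → ℝ} {a b c u : ℝ → ℝ → ℝ} {M : ℝ}

lemma glob (H : SP T X xi a b c u M) (hT : 0 ≤ T) : ∃ (ζ : ℝ → ℝ) (v : ℝ → ℝ → ℝ), Continuous ζ ∧
    Continuous (fun p : ℝ × ℝ => v p.1 p.2) ∧ (∀ t ∈ Icc 0 T, ζ t = xi t) ∧
    ∀ t ∈ Icc 0 T, ∀ x ∈ Icc (xi t) X, v x t = u x t := by
  have zc : Continuous (fun t => xi (projIcc 0 T hT t : ℝ)) :=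
    H.xc.comp_continuous (by fun_prop) fun t => (projIcc 0 T hT t).2
  refine ⟨fun t => xi (projIcc 0 T hT t), fun x t => u (max (xi (projIcc 0 T hT t)) (min x X)) (projIcc 0 T hT t), zc,
    H.sol.cont.comp_continuous (f := fun p : ℝ × ℝ => (max (xi (projIcc 0 T hT p.2)) (min p.1 X), (projIcc 0 T hT p.2 : ℝ))) ?_ ?_, ?_, ?_⟩
  · have : Continuous (fun p : ℝ × ℝ => xi (projIcc 0 T hT p.2 : ℝ)) := zc.comp continuous_snd
    exact (this.max (continuous_fst.min continuous_const)).prodMk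
      (continuous_subtype_val.comp (continuous_projIcc.comp continuous_snd))
  · exact fun p => ⟨(projIcc 0 T hT p.2).2, le_max_left _ _, max_le (H.xlt _ (projIcc 0 T hT p.2).2).le (min_le_right _ _)⟩
  · exact fun t ht => by simp only [projIcc_of_mem hT ht]
  · intro t ht x hx
    simp only [projIcc_of_mem hT ht, min_eq_left hx.2, max_eq_right hx.1]

lemma decr (H : SP T X xi a b c u M) {σ x r : ℝ} (hr : r ∈ Ioo 0 T) (hx : x ∈ Ioo (xi r) X) (hp : 0 < σ * u x r)
    (hm : IsLocalMax (fun z => σ * u z r) x) :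
    ∀ᶠ q in 𝓝[<] r, Real.exp (-((M + 1) * r)) * (σ * u x r) < Real.exp (-((M + 1) * q)) * (σ * u x q) := by
  have hd := lat hr hx
  obtain ⟨k1, k2⟩ := d2_max (f := fun z => σ * u z r) (f' := fun z => σ * pdx u z r) (x := x)
    (by filter_upwards [Ioo_mem_nhds hx.1 hx.2] with z hz using (H.sol.diff_x _ (lat hr hz)).hasDerivAt.const_mul σ)
    ((H.sol.diff_xx _ hd).hasDerivAt.const_mul σ) hm
  obtain ⟨r1, -, -, -, -, -, -, -, -, -, r5⟩ := H.reg _ hd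
  have e := H.sol.eqn _ hd
  simp only at r1 r5 e k1
  have k3 : σ * pdt u x r ≤ M * (σ * u x r) := by
    have h1 : a x r * (σ * pdxx u x r) ≤ 0 := mul_nonpos_of_nonneg_of_nonpos r1.le k2
    have h2 : c x r * (σ * u x r) ≤ M * (σ * u x r) := mul_le_mul_of_nonneg_right (abs_le.1 r5).2 hp.le
    have h3 : σ * pdt u x r = a x r * (σ * pdxx u x r) + b x r * (σ * pdx u x r) + c x r * (σ * u x r) := by rw [e]; ring
    rw [k1] at h3
    linarith
  have dg : HasDerivAt (fun q => -(Real.exp (-((M + 1) * q)) * (σ * u x q)))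
      (Real.exp (-((M + 1) * r)) * ((M + 1) * (σ * u x r) - σ * pdt u x r)) r :=
    ((((hasDerivAt_id r).const_mul (M + 1)).fun_neg.exp).fun_mul
      ((H.sol.diff_t _ hd).hasDerivAt.const_mul σ)).fun_neg.congr_deriv (by simp [pdt]; ring)
  filter_upwards [left_lt dg (mul_pos (Real.exp_pos _) (by linarith))] with q hq
  linarith

lemma sgnX (H : SP T X xi a b c u M) {r t : ℝ} (hr : r ∈ Icc 0 T) (ht : t ∈ Icc 0 T) : 0 < u X r * u X t := by
  by_contra hn
  have h : u X r * u X t < 0 := lt_of_le_of_ne (not_lt.1 hn) (mul_ne_zero (H.hX r hr) (H.hX t ht))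
  have sub : uIcc r t ⊆ Icc 0 T := uIcc_subset_Icc hr ht
  have cc : ContinuousOn (fun q => u X q) (uIcc r t) :=
    H.sol.cont.comp (f := fun q => (X, q)) (by fun_prop) fun q hq => ⟨sub hq, (H.xlt q (sub hq)).le, le_rfl⟩
  obtain ⟨q, hq, e⟩ := intermediate_value_uIcc cc (show (0:ℝ) ∈ uIcc (u X r) (u X t) by
    rw [mem_uIcc]
    rcases mul_neg_iff.1 h with h | h
    · exact Or.inr ⟨h.2.le, h.1.le⟩
    · exact Or.inl ⟨h.1.le, h.2.le⟩)
  exact H.hX q (sub hq) e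

lemma wback (H : SP T X xi a b c u M) {t1 t : ℝ} (ht1 : 0 < t1) (htt : t1 ≤ t) (htT : t < T)
    (pos : ∀ r ∈ Icc t1 t, 0 < u (xi r) r) {n : ℕ} (hq : Qc (fun x => u x t) (xi t) (n + 2) X) :
    (n : ℕ∞) ≤ Znum u xi (fun _ => X) t1 := by
  have inT : ∀ r ∈ Icc t1 t, r ∈ Ioo 0 T := fun r hr => ⟨ht1.trans_le hr.1, hr.2.trans_lt htT⟩
  have inI : ∀ r ∈ Icc t1 t, r ∈ Icc 0 T := fun r hr => ⟨(inT r hr).1.le, (inT r hr).2.le⟩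
  have tm : t ∈ Icc t1 t := ⟨htt, le_rfl⟩
  have tm1 : t1 ∈ Icc t1 t := ⟨le_rfl, htt⟩
  obtain ⟨ζ, v, zc, vc, zx, vu⟩ := H.glob ((ht1.trans_le htt).trans htT).le
  obtain ⟨-, q1, y, q2, q3⟩ := Qc.pts (f := fun x => u x t) (pos t tm) hq
  have vX : ∀ r ∈ Icc t1 t, v X r = u X r := fun r hr => vu r (inI r hr) X ⟨(H.xlt r (inI r hr)).le, le_rfl⟩
  have E0 : ∀ r, 0 < Real.exp (-((M + 1) * r)) := fun r => Real.exp_pos _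
  obtain ⟨w, w1, w2⟩ := wlem (n := n + 1) (Nat.succ_pos n) (ζ := ζ)
    (g := fun i x r => Real.exp (-((M + 1) * r)) * ((-1) ^ (i.val + 1) * v x r)) zc (fun i => by fun_prop) (X := X) htt
    (fun i j hij x r h => by
      have h1 := pos_of_mul_pos_right h.1 (E0 r).le
      have h2 := pos_of_mul_pos_right h.2 (E0 r).le
      rw [← hij, pow_succ] at h2
      linarith)
    (fun i hi r hr h => by
      have h1 := pos_of_mul_pos_right h (E0 r).le
      rw [hi, zx r (inI r hr), vu r (inI r hr) _ ⟨le_rfl, (H.xlt r (inI r hr)).le⟩] at h1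
      have := pos r hr
      simp at h1
      linarith)
    (fun i hi r hr h => by
      have h1 := pos_of_mul_pos_right h (E0 r).le
      rw [hi, vX r hr] at h1
      rw [pow_succ] at q1
      have h2 := H.sgnX (inI r hr) (inI t tm)
      rcases neg_one_pow_eq_or ℝ (n + 1) with e | e <;> rw [e] at h1 q1 <;> rcases mul_pos_iff.1 h2 with h | h <;> linarith)
    (fun i x r h1 h2 h3 h4 h5 h6 => by
      have rm : r ∈ Icc t1 t := ⟨h1.le, h2⟩
      have hx : x ∈ Ioo (xi r) X := ⟨by rwa [zx r (inI r rm)] at h3, h4⟩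
      have ee : ∀ z ∈ Ioo (xi r) X, v z r = u z r := fun z hz => vu r (inI r rm) z ⟨hz.1.le, hz.2.le⟩
      have h7 := pos_of_mul_pos_right h5 (E0 r).le
      rw [ee x hx] at h7
      have h8 : IsLocalMax (fun z => (-1) ^ (i.val + 1) * u z r) x := by
        filter_upwards [h6, Ioo_mem_nhds hx.1 hx.2] with z k1 k2
        have := le_of_mul_le_mul_left k1 (E0 r)
        rwa [ee z k2, ee x hx] at this
      have nb : ∀ᶠ q in 𝓝 r, q ∈ Ioo 0 T ∧ x ∈ Ioo (xi q) X :=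
        (ContinuousAt.tendsto (f := fun q => (x, q)) (by fun_prop)).eventually (H.nh (inT r rm) hx)
      filter_upwards [H.decr (inT r rm) hx h7 h8, nhdsWithin_le_nhds nb] with q k1 k2
      rw [ee x hx, vu q ⟨k2.1.1.le, k2.1.2.le⟩ x ⟨k2.2.1.le, k2.2.2.le⟩]
      exact k1)
    (fun i => y i) (fun i j hij => q2 i j hij (by omega))
    (fun i => by rw [zx t (inI t tm)]; exact (q3 i (by omega)).1) (fun i => (q3 i (by omega)).2.1)
    (fun i => by
      have := q3 i (by omega)
      rw [vu t (inI t tm) _ ⟨this.1, this.2.1⟩]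
      exact mul_pos (E0 t) this.2.2)
  have w3 : ∀ i, xi t1 < w i ∧ 0 < (-1) ^ (i.val + 1) * u (w i) t1 := fun i => by
    obtain ⟨k1, k2, k3⟩ := w2 i
    rw [zx t1 (inI t1 tm1)] at k1
    rw [vu t1 (inI t1 tm1) _ ⟨k1.le, k2.le⟩] at k3
    exact ⟨k1, pos_of_mul_pos_right k3 (E0 t1).le⟩
  have w4 : ∀ i : Fin n, ∃ z ∈ Ioo (w i.castSucc) (w i.succ), u z t1 = 0 := fun i => by
    refine H.ivt (inI t1 tm1) (w3 _).1.le (w1 Fin.castSucc_lt_succ) (w2 _).2.1.le ?_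
    have h1 := (w3 i.castSucc).2
    have h2 := (w3 i.succ).2
    simp only [Fin.val_castSucc, Fin.val_succ] at h1 h2
    rw [pow_succ _ (i.val + 1)] at h2
    rcases neg_one_pow_eq_or ℝ (i.val + 1) with e | e <;> rw [e] at h1 h2
    · exact mul_neg_of_pos_of_neg (by linarith) (by linarith)
    · exact mul_neg_of_neg_of_pos (by linarith) (by linarith)
  choose z hz1 hz2 using w4
  have zm : StrictMono z := fun i j hij => (hz1 i).2.trans_le
    ((w1.monotone (show i.succ ≤ j.castSucc from hij)).trans (hz1 j).1.le)
  calc (n : ℕ∞) ≤ (range z).encard := by simpa using zm.injective.encard_range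
    _ ≤ _ := encard_le_encard (by
      rintro _ ⟨i, rfl⟩
      exact ⟨⟨(w3 _).1.le.trans (hz1 i).1.le, (hz1 i).2.le.trans (w2 _).2.1.le⟩, hz2 i⟩)

end SP

namespace SP
variable {T X : ℝ} {xi : ℝ → ℝ} {a b c u : ℝ → ℝ → ℝ} {M : ℝ}

lemma build (H : SP T X xi a b c u M) {s : ℝ} (hs : s ∈ Ioo 0 T) (hpos : ∀ᶠ t in 𝓝[<] s, 0 < u (xi t) t) (S : Finset ℝ) :
    (∀ x ∈ S, x ∈ Ioo (xi s) X ∧ u x s = 0) → ∀ Y, xi s < Y → Y < X → u Y s ≠ 0 → (∀ x ∈ S, x < Y) →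
      ∀ᶠ t in 𝓝[<] s, ∃ n ≥ S.card, Qc (fun x => u x t) (xi t) n Y := by
  induction S using Finset.induction_on_max with
  | empty =>
    intro _ Y h1 h2 h3 _
    have e2 : ∀ᶠ r in 𝓝[<] s, xi r < Y := nhdsWithin_le_nhds ((H.xi_at hs).eventually (gt_mem_nhds h1))
    have e3 : ∀ᶠ r in 𝓝[<] s, u Y r ≠ 0 := nhdsWithin_le_nhds ((H.ct hs ⟨h1, h2⟩).eventually_ne h3)
    filter_upwards [hpos, e2, e3] with t k1 k2 k3
    rcases lt_or_gt_of_ne (mul_ne_zero k1.ne' k3) with h | h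
    · exact ⟨1, by simp, Qc.flip Qc.base k2 h⟩
    · exact ⟨0, by simp, Qc.same Qc.base k2 h⟩
  | insert m S hS ih =>
    intro hz Y h1 h2 h3 h4
    obtain ⟨hm, hm0⟩ := hz m (Finset.mem_insert_self _ _)
    have hmY := h4 m (Finset.mem_insert_self _ _)
    have eL : ∀ᶠ z in 𝓝[<] m, u z s ≠ 0 := nhdsWithin_mono m (fun z (h : z < m) => h.ne) (H.iso hs hm)
    have l1 : ∀ᶠ z in 𝓝[<] m, z ∈ Ioo (xi s) m := Ioo_mem_nhdsLT hm.1
    have l2 : ∀ᶠ z in 𝓝[<] m, ∀ x ∈ S, x < z := (Filter.eventually_all_finset S).2 fun x hx =>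
      nhdsWithin_le_nhds (lt_mem_nhds (hS x hx))
    obtain ⟨Z, z1, z2, z3⟩ := (eL.and (l1.and l2)).exists
    have I := ih (fun x hx => hz x (Finset.mem_insert_of_mem hx)) Z z2.1 (z2.2.trans hm.2) z1 z3
    have cd : (insert m S).card ≤ S.card + 1 := Finset.card_insert_le _ _
    rcases lt_or_gt_of_ne (mul_ne_zero z1 h3) with h | h
    · have e := ((H.ct hs (x := Z) ⟨z2.1, z2.2.trans hm.2⟩).mul (H.ct hs (x := Y) ⟨h1, h2⟩)).eventually (gt_mem_nhds h)
      filter_upwards [I, nhdsWithin_le_nhds e] with t ⟨n, n1, n2⟩ k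
      exact ⟨n + 1, by omega, Qc.flip n2 (z2.2.trans hmY) k⟩
    · filter_upwards [I, H.lemS2 hs z2.1 z2.2 hmY h2 hm0 h] with t ⟨n, n1, n2⟩ ⟨p, hp, k1, k2⟩
      exact ⟨n + 1 + 1, by omega, Qc.flip (Qc.flip n2 hp.1 k1) hp.2 k2⟩

lemma buildX (H : SP T X xi a b c u M) {s : ℝ} (hs : s ∈ Ioo 0 T) (hpos : ∀ᶠ t in 𝓝[<] s, 0 < u (xi t) t) (S : Finset ℝ)
    (hS : ∀ x ∈ S, x ∈ Ioo (xi s) X ∧ u x s = 0) :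
      ∀ᶠ t in 𝓝[<] s, ∃ n ≥ S.card, Qc (fun x => u x t) (xi t) n X := by
  have sI : s ∈ Icc 0 T := ⟨hs.1.le, hs.2.le⟩
  have l1 : ∀ᶠ z in 𝓝[<] X, z ∈ Ioo (xi s) X := Ioo_mem_nhdsLT (H.xlt s sI)
  have l2 : ∀ᶠ z in 𝓝[<] X, ∀ x ∈ S, x < z := (Filter.eventually_all_finset S).2 fun x hx =>
      nhdsWithin_le_nhds (lt_mem_nhds (hS x hx).1.2)
  have l3 : ∀ᶠ z in 𝓝[<] X, u z s ≠ 0 := by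
    have h1 : ContinuousWithinAt (fun x => u x s) (Iio X) X :=
      (H.cx sI X ⟨(H.xlt s sI).le, le_rfl⟩).mono_of_mem_nhdsWithin (l1.mono fun z hz => ⟨hz.1.le, hz.2.le⟩)
    exact h1.eventually_ne (H.hX s sI)
  obtain ⟨Y, y1, y2, y3⟩ := (l1.and (l2.and l3)).exists
  have e3 : ∀ᶠ r in 𝓝[<] s, u Y r ≠ 0 := nhdsWithin_le_nhds ((H.ct hs y1).eventually_ne y3)
  have e1 : ∀ᶠ r in 𝓝[<] s, r ∈ Ioo 0 T := nhdsWithin_le_nhds (Ioo_mem_nhds hs.1 hs.2)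
  filter_upwards [H.build hs hpos S hS Y y1.1 y1.2 y3 y2, e3, e1] with t ⟨n, n1, n2⟩ k1 k2
  rcases lt_or_gt_of_ne (mul_ne_zero k1 (H.hX t ⟨k2.1.le, k2.2.le⟩)) with h | h
  · exact ⟨n + 1, by omega, Qc.flip n2 y1.2 h⟩
  · exact ⟨n, n1, Qc.same n2 y1.2 h⟩

lemma fin_s (H : SP T X xi a b c u M) {s : ℝ} (hs : s ∈ Ioo 0 T) (hpos : ∀ᶠ t in 𝓝[<] s, 0 < u (xi t) t) :
    (zeroSet u xi (fun _ => X) s).Finite := by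
  by_contra hinf
  have sI : s ∈ Icc 0 T := ⟨hs.1.le, hs.2.le⟩
  have e1 : ∀ᶠ r in 𝓝[<] s, r ∈ Ioo 0 T := nhdsWithin_le_nhds (Ioo_mem_nhds hs.1 hs.2)
  obtain ⟨t1, p1, p2, p3⟩ := ((ev_left (eventually_nhdsWithin_iff.1 hpos)).and (e1.and self_mem_nhdsWithin)).exists
  have p3 : t1 < s := p3
  have f1 := H.fin p2 (p1 t1 ⟨le_rfl, p3.le⟩ p3).ne'
  obtain ⟨S, hS, hc⟩ := (Set.Infinite.sdiff hinf (finite_singleton (xi s))).exists_subset_card_eq (f1.toFinset.card + 3)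
  have e2 : ∀ᶠ r in 𝓝[<] s, t1 < r := nhdsWithin_le_nhds (lt_mem_nhds p3)
  have B := H.buildX hs hpos S fun x hx => by
    obtain ⟨⟨h1, h2⟩, h3⟩ := hS hx
    refine ⟨⟨lt_of_le_of_ne h1.1 fun e => h3 e.symm, lt_of_le_of_ne h1.2 ?_⟩, h2⟩
    rintro rfl
    exact H.hX s sI h2
  obtain ⟨t, ⟨n, n1, n2⟩, k2, k3⟩ := (B.and (e2.and self_mem_nhdsWithin)).exists
  have k3 : t < s := k3
  obtain ⟨m, rfl⟩ : ∃ m, n = m + 2 := ⟨n - 2, by omega⟩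
  have := H.wback p2.1 k2.le (k3.trans hs.2) (fun r hr => p1 r ⟨hr.1, hr.2.trans k3.le⟩ (hr.2.trans_lt k3)) n2
  rw [Znum, f1.encard_eq_coe_toFinset_card] at this
  have := ENat.natCast_le_natCast.1 this
  omega

lemma main (H : SP T X xi a b c u M) {s : ℝ} (hs : s ∈ Ioo 0 T) (hpos : ∀ᶠ t in 𝓝[<] s, 0 < u (xi t) t)
    (h0 : u (xi s) s = 0) (hL : ∃ L, HasDerivWithinAt xi L (Iio s) s) (hx : pdx u (xi s) s ≤ 0) :
    ∀ᶠ t in 𝓝[<] s, Znum u xi (fun _ => X) t < ⊤ ∧ Znum u xi (fun _ => X) s ≤ Znum u xi (fun _ => X) t := by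
  have sI : s ∈ Icc 0 T := ⟨hs.1.le, hs.2.le⟩
  have F := H.fin_s hs hpos
  have e1 : ∀ᶠ r in 𝓝[<] s, r ∈ Ioo 0 T := nhdsWithin_le_nhds (Ioo_mem_nhds hs.1 hs.2)
  have hiso : ∀ᶠ y in 𝓝[>] (xi s), u y s ≠ 0 := by
    have h1 : (zeroSet u xi (fun _ => X) s \ {xi s})ᶜ ∈ 𝓝 (xi s) :=
      (F.subset sdiff_subset).isClosed.isOpen_compl.mem_nhds (by simp)
    filter_upwards [nhdsWithin_le_nhds h1, Ioo_mem_nhdsGT (H.xlt s sI)] with y h2 h3 h4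
    exact h2 ⟨⟨⟨h3.1.le, h3.2.le⟩, h4⟩, h3.1.ne'⟩
  obtain ⟨U, hU, hd⟩ := F.t2_separation
  have near : ∀ x ∈ zeroSet u xi (fun _ => X) s, ∀ᶠ t in 𝓝[<] s, ∃ z ∈ zeroSet u xi (fun _ => X) t, z ∈ U x := fun x hxz => by
    obtain ⟨δ, δ0, hδ⟩ := Metric.isOpen_iff.1 (hU x).2 x (hU x).1
    have key : ∀ᶠ t in 𝓝[<] s, ∃ z ∈ Icc (xi t) X, |z - x| < δ ∧ u z t = 0 := by
      rcases hxz.1.1.eq_or_lt with e | h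
      · subst e
        exact H.z2 hs δ0 hpos h0 hL hx hiso
      · refine H.z1 hs ⟨h, lt_of_le_of_ne hxz.1.2 ?_⟩ δ0 hxz.2
        rintro rfl
        exact H.hX s sI hxz.2
    filter_upwards [key] with t ⟨z, h1, h2, h3⟩
    exact ⟨z, ⟨h1, h3⟩, hδ h2⟩
  filter_upwards [(Filter.eventually_all_finite F).2 near, e1, hpos] with t h1 h2 h3
  refine ⟨encard_lt_top_iff.2 (H.fin h2 h3.ne'), ?_⟩
  choose! f f1 f2 using h1
  refine encard_le_encard_of_injOn (f := f) f1 fun x hxz y hyz e => ?_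
  by_contra hne
  exact Set.disjoint_left.1 (hd hxz hyz hne) (f2 x hxz) (e ▸ f2 y hyz)

end SP

lemma ev_ex {P : ℝ → Prop} {s : ℝ} (h : ∀ᶠ t in 𝓝[<] s, P t) : ∃ ε > 0, ∀ t ∈ Ioo (s - ε) s, P t := by
  obtain ⟨l, hl, h2⟩ := mem_nhdsLT_iff_exists_Ioo_subset.1 h
  exact ⟨s - l, sub_pos.2 hl, fun t ht => h2 ⟨by linarith [ht.1], ht.2⟩⟩

/-- Lemma 2.4: at an NZ*-moment `s` of `w₁` satisfying (H2) (and with (H1) in force),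
`Z(s) ≤ Z(t) < ∞` for all `t < s` sufficiently close to `s`. -/
theorem NZstar_moment_nonincreasing
    (T X : ℝ) (xi1 : ℝ → ℝ) (a b c u : ℝ → ℝ → ℝ)
    (hT : 0 < T)
    (hxc : ContinuousOn xi1 (Icc 0 T)) (hxlt : ∀ t ∈ Icc (0:ℝ) T, xi1 t < X)
    (hsol : IsClassicalSolution a b c xi1 (fun _ => X) T u)
    (hreg : Reg12 a b c xi1 (fun _ => X) T)
    (hX : ∀ t ∈ Icc (0:ℝ) T, u X t ≠ 0)
    (hnz : ∀ t ∈ Icc (0:ℝ) T, ∃ x ∈ Icc (xi1 t) X, u x t ≠ 0)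
    (hH1 : H1cond (bdryTrace u xi1) xi1 T)
    (s : ℝ) (hs : s ∈ Ioo (0:ℝ) T)
    (hNZ : IsNZstar (bdryTrace u xi1) s)
    (hH2 : H2at u xi1 (-1) s) :
    ∃ ε > 0, ∀ t ∈ Ioo (s - ε) s,
      Znum u xi1 (fun _ => X) t < ⊤ ∧
      Znum u xi1 (fun _ => X) s ≤ Znum u xi1 (fun _ => X) t := by
  obtain ⟨M, H⟩ := SP.of hxc hxlt hsol hreg hX
  obtain ⟨w0, ε, ε0, hw⟩ := hNZ
  have w0 : u (xi1 s) s = 0 := w0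
  set J := Ioo (max 0 (s - ε)) s with hJ
  have J1 : ∀ r ∈ J, r ∈ Icc 0 T := fun r hr => ⟨((le_max_left _ _).trans_lt hr.1).le, (hr.2.trans hs.2).le⟩
  have Jn : ∀ r ∈ J, u (xi1 r) r ≠ 0 := fun r hr => hw r ⟨(le_max_right _ _).trans_lt hr.1, hr.2⟩
  have Je : J ∈ 𝓝[<] s := Ioo_mem_nhdsLT (max_lt hs.1 (by linarith))
  have Jc : ContinuousOn (fun r => u (xi1 r) r) J :=
    hsol.cont.comp (f := fun r => (xi1 r, r)) ((hxc.mono J1).prodMk continuousOn_id)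
      fun r hr => ⟨J1 r hr, le_rfl, (hxlt r (J1 r hr)).le⟩
  have sg : (∀ᶠ t in 𝓝[<] s, 0 < u (xi1 t) t) ∨ ∀ᶠ t in 𝓝[<] s, u (xi1 t) t < 0 := by
    by_cases h : ∃ p ∈ J, 0 < u (xi1 p) p
    · obtain ⟨p, hp, hp2⟩ := h
      refine Or.inl (mem_of_superset Je fun q hq => ?_)
      by_contra hn
      obtain ⟨r, hr, e⟩ := isPreconnected_Ioo.intermediate_value hq hp Jc ⟨not_lt.1 hn, hp2.le⟩
      exact Jn r hr e
    · push Not at h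
      exact Or.inr (mem_of_superset Je fun q hq => lt_of_le_of_ne (h q hq) (Jn q hq))
  refine ev_ex ?_
  rcases sg with h | h
  · exact H.main hs h w0 hH2.1 (by linarith [hH2.2.1 (ev_ex h)])
  · have e1 : pdx (fun x t => -u x t) (xi1 s) s = -pdx u (xi1 s) s := by simp [pdx]
    have e2 : ∀ t, Znum (fun x t => -u x t) xi1 (fun _ => X) t = Znum u xi1 (fun _ => X) t := fun t => by
      simp [Znum, zeroSet]
    have := H.neg.main hs (h.mono fun t ht => neg_pos.2 ht) (by simp [w0]) hH2.1
      (by rw [e1]; linarith [hH2.2.2 (ev_ex h)])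
    simpa only [e2] using this
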